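/- For every ε > 0 there exist constants c > 0 and C > 0 such that for all sufficiently large x, |Σ_{M(x) < p ≤ x} {x/p} − x·(log(log x/log M(x)) − 1/2)| ≤ C·x·e^{-c(log x)^{3/5-ε}}, where the sum is over primes p with M(x) < p ≤ x. -/

import Mathlib

open Filter Real MeasureTheory
open scoped Classical

/-- The largest prime factor of `n`, with the convention `P 1 = 1`. -/
noncomputable def largestPrimeFactor (n : ℕ) : ℕ :=
  if n ≤ 1 then 1 else n.primeFactors.sup id

/-- `medianLPF x` is the median largest prime factor of the integers in `[1, x]`:
the `⌈N/2⌉`-th smallest element of the multiset `{P(n) : 1 ≤ n ≤ N}` where `N = ⌊x⌋`. -/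
noncomputable def medianLPF (x : ℝ) : ℕ :=
  (((Finset.Icc 1 ⌊x⌋₊).val.map largestPrimeFactor).sort (· ≤ ·)).getD
    ((⌊x⌋₊ + 1) / 2 - 1) 0

/-- `lif x = ∫₂^x {x/t}/log t dt`. -/
noncomputable def lif (x : ℝ) : ℝ := ∫ t in (2:ℝ)..x, Int.fract (x / t) / Real.log t

namespace VK
open UnitAddTorus Finset

/-- Haar measure -/
noncomputable def mu (k : ℕ) : Measure (UnitAddTorus (Fin k)) :=
  Measure.pi fun _ => AddCircle.haarAddCircle
instance (k : ℕ) : IsFiniteMeasure (mu k) := by unfold mu; infer_instance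

/-- character -/
noncomputable def ec {k : ℕ} (n : Fin k → ℤ) (t : UnitAddTorus (Fin k)) : ℂ := mFourier n t

lemma ec_add {k : ℕ} (m n : Fin k → ℤ) (t) : ec (m + n) t = ec m t * ec n t := mFourier_add
lemma ec_sum {k : ℕ} {ι : Type*} (A : Finset ι) (f : ι → Fin k → ℤ) (t) :
    ec (∑ i ∈ A, f i) t = ∏ i ∈ A, ec (f i) t := by
  induction A using Finset.induction_on with
  | empty => simp [ec, mFourier_zero]
  | insert a s ha ih => rw [sum_insert ha, prod_insert ha, ec_add, ih]
lemma ec_norm {k : ℕ} (n : Fin k → ℤ) (t) : ‖ec n t‖ = 1 := by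
  simp only [ec, mFourier, fourier_apply, ContinuousMap.coe_mk, norm_prod, Circle.norm_coe, prod_const_one]
lemma ec_cont {k : ℕ} (n : Fin k → ℤ) : Continuous (ec n) := (mFourier n).continuous
lemma ec_sub {k : ℕ} (m n : Fin k → ℤ) (t) : ec (m - n) t = ec m t * (starRingEnd ℂ) (ec n t) := by
  rw [sub_eq_add_neg, ec_add]; congr 1; exact mFourier_neg

lemma int_of_cont {k : ℕ} {E : Type*} [NormedAddCommGroup E] {f : UnitAddTorus (Fin k) → E}
    (hf : Continuous f) : Integrable f (mu k) := by
  have : CompactSpace (UnitAddTorus (Fin k)) := by unfold UnitAddTorus; infer_instance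
  exact hf.integrable_of_hasCompactSupport (HasCompactSupport.of_compactSpace f)

lemma ec_int {k : ℕ} (n : Fin k → ℤ) : ∫ t, ec n t ∂mu k = if n = 0 then 1 else 0 := by
  have := (orthonormal_iff_ite.mp (orthonormal_mFourier (d := Fin k))) 0 n
  simp only [ContinuousMap.inner_toLp, mFourier_zero] at this
  simp only [ContinuousMap.one_apply, map_one, mul_one, eq_comm (a := (0 : Fin k → ℤ))] at this
  exact this

/-- twisted count -/
lemma count_twist {k : ℕ} {ι : Type*} (A : Finset ι) (φ : ι → Fin k → ℤ) (d : Fin k → ℤ) :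
    ∫ t, ec (-d) t * ((‖∑ x ∈ A, ec (φ x) t‖ ^ 2 : ℝ) : ℂ) ∂mu k =
      (#{q ∈ A ×ˢ A | φ q.1 - φ q.2 = d} : ℂ) := by
  have h : ∀ t, ec (-d) t * ((‖∑ x ∈ A, ec (φ x) t‖ ^ 2 : ℝ) : ℂ)
      = ∑ q ∈ A ×ˢ A, ec (φ q.1 - φ q.2 - d) t := by
    intro t
    push_cast
    rw [← Complex.mul_conj', map_sum, sum_mul_sum, ← sum_product', mul_sum]
    refine sum_congr rfl fun q _ => ?_
    rw [← ec_sub, ← ec_add]; congr 1; abel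
  simp_rw [h]
  rw [integral_finsetSum _ fun q _ => int_of_cont (ec_cont _)]
  simp_rw [ec_int, sub_eq_zero, card_filter]
  push_cast; rfl

lemma count_eq {k : ℕ} {ι : Type*} (A : Finset ι) (φ : ι → Fin k → ℤ) :
    ∫ t, ‖∑ x ∈ A, ec (φ x) t‖ ^ 2 ∂mu k = (#{q ∈ A ×ˢ A | φ q.1 = φ q.2} : ℝ) := by
  have := count_twist A φ 0
  have h0 : ∀ t, ec (-0 : Fin k → ℤ) t = 1 := fun t => by simp [ec, mFourier_zero]
  simp only [h0, one_mul, sub_eq_zero] at this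
  rw [integral_complex_ofReal] at this
  exact_mod_cast this

lemma count_le {k : ℕ} {ι : Type*} (A : Finset ι) (φ : ι → Fin k → ℤ) (d : Fin k → ℤ) :
    #{q ∈ A ×ˢ A | φ q.1 - φ q.2 = d} ≤ #{q ∈ A ×ˢ A | φ q.1 = φ q.2} := by
  have h1 := count_twist A φ d
  have h2 := count_eq A φ
  have : ‖(#{q ∈ A ×ˢ A | φ q.1 - φ q.2 = d} : ℂ)‖ ≤ (#{q ∈ A ×ˢ A | φ q.1 = φ q.2} : ℝ) := by
    rw [← h1, ← h2]
    refine (norm_integral_le_integral_norm _).trans (le_of_eq ?_)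
    congr 1; ext t
    rw [norm_mul, ec_norm, one_mul, Complex.norm_real, norm_of_nonneg (by positivity)]
  rw [Complex.norm_natCast] at this
  exact_mod_cast this

/-- powers -/
def pw (k : ℕ) (x : ℤ) : Fin k → ℤ := fun j => x ^ ((j : ℕ) + 1)
def psum (k : ℕ) {s : ℕ} (x : Fin s → ℤ) : Fin k → ℤ := ∑ i, pw k (x i)
lemma psum_apply (k : ℕ) {s : ℕ} (x : Fin s → ℤ) (j : Fin k) :
    psum k x j = ∑ i, x i ^ ((j : ℕ) + 1) := by simp [psum, pw]
abbrev box (s : ℕ) (I : Finset ℤ) : Finset (Fin s → ℤ) := Fintype.piFinset fun _ => I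
noncomputable def Jc (k s : ℕ) (I : Finset ℤ) : ℕ :=
  #{q ∈ box s I ×ˢ box s I | psum k q.1 = psum k q.2}

lemma sum_pow_ec (k s : ℕ) (I : Finset ℤ) (t) :
    (∑ x ∈ I, ec (pw k x) t) ^ s = ∑ x ∈ box s I, ec (psum k x) t := by
  have := Finset.prod_univ_sum (fun _ : Fin s => I) (fun _ x => ec (pw k x) t)
  rw [prod_const, card_univ, Fintype.card_fin] at this
  rw [this]; refine sum_congr rfl fun x _ => ?_
  rw [psum, ec_sum]

lemma Jc_int (k s : ℕ) (I : Finset ℤ) :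
    ∫ t, ‖∑ x ∈ I, ec (pw k x) t‖ ^ (2 * s) ∂mu k = (Jc k s I : ℝ) := by
  rw [Jc, ← count_eq]; congr 1; ext t
  rw [← sum_pow_ec, norm_pow]; ring

lemma Jc_mono (k s : ℕ) {I I' : Finset ℤ} (h : I ⊆ I') : Jc k s I ≤ Jc k s I' := by
  refine card_le_card (filter_subset_filter _ (product_subset_product ?_ ?_)) <;>
  exact Fintype.piFinset_subset _ _ fun _ => h

lemma psum_affine {k s : ℕ} {R : Type*} [CommRing R] (x y : Fin s → R) (a b : R)
    (h : ∀ j : Fin k, ∑ i, x i ^ ((j : ℕ) + 1) = ∑ i, y i ^ ((j : ℕ) + 1)) (j : Fin k) :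
    ∑ i, (a * x i + b) ^ ((j : ℕ) + 1) = ∑ i, (a * y i + b) ^ ((j : ℕ) + 1) := by
  simp_rw [add_pow, mul_pow]
  rw [sum_comm, sum_comm (s := univ) (t := range _)]
  refine sum_congr rfl fun m hm => ?_
  simp_rw [← sum_mul, ← mul_sum]
  congr 3
  rcases m with _ | m
  · simp
  · exact h ⟨m, by have := mem_range.1 hm; omega⟩

lemma Jc_affine (k s : ℕ) (I : Finset ℤ) (p a : ℤ) (hp : p ≠ 0) :
    Jc k s (I.image fun m => p * m + a) ≤ Jc k s I := by
  refine card_le_card_of_injOn (fun q => (fun i => (q.1 i - a) / p, fun i => (q.2 i - a) / p)) ?_ ?_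
  · intro q hq
    simp only [coe_filter, mem_product, Fintype.mem_piFinset, mem_image, Set.mem_ofPred_eq] at hq ⊢
    obtain ⟨⟨h1, h2⟩, h3⟩ := hq
    choose x hx hx' using h1
    choose y hy hy' using h2
    have e1 : (fun i => (q.1 i - a) / p) = x := by
      ext i; rw [← hx' i]; simp [hp]
    have e2 : (fun i => (q.2 i - a) / p) = y := by
      ext i; rw [← hy' i]; simp [hp]
    rw [e1, e2]
    refine ⟨⟨fun i => congrFun e1 i ▸ hx i, fun i => congrFun e2 i ▸ hy i⟩, ?_⟩
    have h4 := fun j => congrFun h3 j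
    simp only [psum_apply, ← hx', ← hy'] at h4
    ext j
    have := psum_affine (k := k) (fun i => p * x i + a) (fun i => p * y i + a) 1 (-a) h4 j
    simp only [one_mul, add_neg_cancel_right, mul_pow, ← mul_sum] at this
    rw [psum_apply, psum_apply]
    exact mul_left_cancel₀ (pow_ne_zero _ hp) this
  · intro q hq q' hq' h
    simp only [coe_filter, mem_product, Fintype.mem_piFinset, mem_image, Set.mem_ofPred_eq] at hq hq'
    obtain ⟨⟨h1, h2⟩, -⟩ := hq
    obtain ⟨⟨h1', h2'⟩, -⟩ := hq'
    simp only [Prod.mk.injEq] at h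
    ext i
    · obtain ⟨m, -, e⟩ := h1 i; obtain ⟨m', -, e'⟩ := h1' i
      have := congrFun h.1 i
      simp only [← e, ← e', add_sub_cancel_right, Int.mul_ediv_cancel_left _ hp] at this
      rw [← e, ← e', this]
    · obtain ⟨m, -, e⟩ := h2 i; obtain ⟨m', -, e'⟩ := h2' i
      have := congrFun h.2 i
      simp only [← e, ← e', add_sub_cancel_right, Int.mul_ediv_cancel_left _ hp] at this
      rw [← e, ← e', this]

end VK

namespace VK
open UnitAddTorus Finset

lemma hensel {k p : ℕ} (hp : p.Prime) (hkp : k < p) (x z : Fin k → ℤ)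
    (hxz : ∀ i, (p : ℤ) ∣ x i - z i) (hz : ∀ i i', (p : ℤ) ∣ z i - z i' → i = i') (K : ℕ)
    (h : ∀ j : Fin k, (p : ℤ) ^ K ∣ ∑ i, x i ^ ((j : ℕ) + 1) - ∑ i, z i ^ ((j : ℕ) + 1)) (m : ℕ)
    (hm : m + 1 ≤ K) : ∀ i, (p : ℤ) ^ (m + 1) ∣ x i - z i := by
  have := Fact.mk hp
  induction m with
  | zero => simpa using hxz
  | succ m ih =>
    choose d hd using ih (by omega)
    have key : (fun i => ((d i : ℤ) : ZMod p)) = 0 := by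
      refine Matrix.eq_zero_of_forall_pow_sum_mul_pow_eq_zero (f := fun i => ((z i : ℤ) : ZMod p))
        ?_ ?_
      · intro i i' hii
        refine hz i i' ?_
        rw [← ZMod.intCast_eq_intCast_iff_dvd_sub]; exact hii.symm
      · intro j
        have h1 : (p : ℤ) ^ (m + 2) ∣ ((j : ℕ) + 1) * ((p : ℤ) ^ (m + 1) * ∑ i, d i * z i ^ (j : ℕ)) := by
          have h2 := (pow_dvd_pow (p : ℤ) (show m + 2 ≤ K by omega)).trans (h j)
          rw [← sum_sub_distrib] at h2
          have h3 : (p : ℤ) ^ (m + 2) ∣ ∑ i, (x i ^ ((j : ℕ) + 1) - z i ^ ((j : ℕ) + 1)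
              - ((j : ℕ) + 1) * ((p : ℤ) ^ (m + 1) * (d i * z i ^ (j : ℕ)))) := by
            refine dvd_sum fun i _ => ?_
            obtain ⟨c, hc⟩ := Polynomial.powAddExpansion (z i) (p ^ (m + 1) * d i) ((j : ℕ) + 1)
            have e : x i = z i + p ^ (m + 1) * d i := by linarith [hd i]
            rw [e, hc]
            refine ⟨c * d i ^ 2 * p ^ m, ?_⟩
            push_cast; ring
          rw [sum_sub_distrib] at h3
          have := (dvd_sub_right h2).1 h3
          simpa only [← mul_sum] using this
        have h4 : (p : ℤ) ∣ ((j : ℕ) + 1) * ∑ i, d i * z i ^ (j : ℕ) := by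
          have e : ((j : ℕ) + 1) * ((p : ℤ) ^ (m + 1) * ∑ i, d i * z i ^ (j : ℕ))
            = p ^ (m + 1) * (((j : ℕ) + 1) * ∑ i, d i * z i ^ (j : ℕ)) := by ring
          rw [e, pow_succ _ (m + 1)] at h1
          exact (mul_dvd_mul_iff_left (pow_ne_zero _ (by exact_mod_cast hp.ne_zero))).1 h1
        rcases (Nat.prime_iff_prime_int.1 hp).dvd_or_dvd h4 with h5 | h5
        · have := Int.le_of_dvd (by positivity) h5
          have := j.2; omega
        · have := (ZMod.intCast_zmod_eq_zero_iff_dvd _ p).2 h5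
          push_cast at this; exact this
    intro i
    have := (ZMod.intCast_zmod_eq_zero_iff_dvd _ p).1 (congrFun key i)
    rw [hd i, pow_succ]; exact mul_dvd_mul_left _ this

lemma linnik {k p X : ℕ} (hp : p.Prime) (hkp : k < p) (hX : X ≤ p ^ k) (b : ℤ) (y : Fin k → ℤ)
    (hy : ∀ i i', (p : ℤ) ∣ y i - y i' → i = i') :
    #{x ∈ box k (Icc (1 : ℤ) X) | (∀ i, (p : ℤ) ∣ x i - y i) ∧ ∀ j : Fin k, (p : ℤ) ^ ((j : ℕ) + 1) ∣
      ∑ i, (x i - b) ^ ((j : ℕ) + 1) - ∑ i, (y i - b) ^ ((j : ℕ) + 1)} ≤ p ^ (k * (k - 1) / 2) := by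
  rcases Nat.eq_zero_or_pos k with rfl | hk
  · refine card_le_one.2 fun a _ b _ => Subsingleton.elim _ _
  have hp0 : (0 : ℤ) < p := by exact_mod_cast hp.pos
  set g : (Fin k → ℤ) → Fin k → ℤ := fun x j =>
    (∑ i, (x i - b) ^ ((j : ℕ) + 1) - ∑ i, (y i - b) ^ ((j : ℕ) + 1)) / (p : ℤ) ^ ((j : ℕ) + 1)
      % (p : ℤ) ^ (k - 1 - (j : ℕ)) with hg
  have hcard : #(Fintype.piFinset fun j : Fin k => Ico (0 : ℤ) (p ^ (k - 1 - (j : ℕ)))) =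
      p ^ (k * (k - 1) / 2) := by
    rw [Fintype.card_piFinset]
    have : ∀ j : Fin k, #(Ico (0 : ℤ) ((p : ℤ) ^ (k - 1 - (j : ℕ)))) = p ^ (k - 1 - (j : ℕ)) := by
      intro j; rw [Int.card_Ico, sub_zero, ← Nat.cast_pow, Int.toNat_natCast]
    simp_rw [this]
    rw [prod_pow_eq_pow_sum, Fin.sum_univ_eq_sum_range (fun j => k - 1 - j),
      sum_range_reflect (fun j => j), sum_range_id]
  rw [← hcard]
  refine card_le_card_of_injOn g ?_ ?_
  · intro x _
    simp only [Fintype.coe_piFinset, Set.mem_pi, hg]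
    intro j _
    simp only [coe_Ico, Set.mem_Ico]
    exact ⟨Int.emod_nonneg _ (by positivity), Int.emod_lt_of_pos _ (by positivity)⟩
  · intro x hx z hz hxz
    simp only [coe_filter, Fintype.mem_piFinset, mem_Icc, Set.mem_ofPred_eq] at hx hz
    obtain ⟨hx1, hx2, hx3⟩ := hx
    obtain ⟨hz1, hz2, hz3⟩ := hz
    have := hensel hp hkp (fun i => x i - b) (fun i => z i - b)
      (fun i => by have := dvd_sub (hx2 i) (hz2 i); simpa using this)
      (fun i i' h => hy i i' (by
        have h2 := dvd_sub (dvd_sub h (hz2 i)) (dvd_neg.2 (hz2 i'))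
        have e : z i - b - (z i' - b) - (z i - y i) - -(z i' - y i') = y i - y i' := by ring
        rwa [e] at h2)) k (fun j => by
        have h1 := congrFun hxz j
        simp only [hg] at h1
        obtain ⟨c, hc⟩ := hx3 j
        obtain ⟨c', hc'⟩ := hz3 j
        rw [hc, hc', Int.mul_ediv_cancel_left _ (by positivity),
          Int.mul_ediv_cancel_left _ (by positivity)] at h1
        have h2 : (p : ℤ) ^ (k - 1 - (j : ℕ)) ∣ c - c' := (Int.ModEq.symm h1).dvd
        have e : ∑ i, (x i - b) ^ ((j : ℕ) + 1) - ∑ i, (z i - b) ^ ((j : ℕ) + 1) =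
          p ^ ((j : ℕ) + 1) * (c - c') := by rw [mul_sub, ← hc, ← hc']; ring
        have e2 : (p : ℤ) ^ k = p ^ ((j : ℕ) + 1) * p ^ (k - 1 - (j : ℕ)) := by
          rw [← pow_add]; congr 1; have := j.2; omega
        rw [e, e2]; exact mul_dvd_mul_left _ h2) (k - 1) (by omega)
    ext i
    have h3 := this i
    rw [Nat.sub_add_cancel hk, sub_sub_sub_cancel_right] at h3
    have hX' : (X : ℤ) ≤ p ^ k := by exact_mod_cast hX
    have := Int.eq_zero_of_abs_lt_dvd h3 (by
      rw [abs_lt]; constructor <;> linarith [(hx1 i).1, (hx1 i).2, (hz1 i).1, (hz1 i).2])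
    omega

lemma pm_le {ι : Type*} (A : Finset ι) (f : ι → ℝ) (hf : ∀ i ∈ A, 0 ≤ f i) (n : ℕ) (hn : 1 ≤ n) :
    (∑ i ∈ A, f i) ^ n ≤ (#A : ℝ) ^ (n - 1) * ∑ i ∈ A, f i ^ n := by
  obtain ⟨m, rfl⟩ : ∃ m, n = m + 1 := ⟨n - 1, by omega⟩
  have := pow_sum_div_card_le_sum_pow hf m
  rcases A.eq_empty_or_nonempty with rfl | hA
  · simp
  rwa [div_le_iff₀' (by have := hA.card_pos; positivity)] at this

lemma broad (A : Finset ℤ) (hA : A.Nonempty) (c : ℤ → ℂ) (k s : ℕ) (hs : 1 ≤ s) (Y : ℝ)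
    (hY : ∀ a ∈ A, ‖c a‖ ≤ Y) (hk : 1 ≤ k) :
    ‖∑ a ∈ A, c a‖ ^ (2 * (s + k)) ≤
      (2 * #A : ℝ) ^ (2 * k) * (#A : ℝ) ^ (2 * s - 1) * ∑ b ∈ A, ∑ a ∈ box k A with a.Injective,
        (∏ i, ‖c (a i)‖ ^ 2) * ‖c b‖ ^ (2 * s)
      + (2 * k : ℝ) ^ (2 * (s + k)) * Y ^ (2 * k) * ∑ b ∈ A, ‖c b‖ ^ (2 * s) := by
  set S := ‖∑ a ∈ A, c a‖ with hS
  have hS0 : 0 ≤ S := norm_nonneg _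
  have hA' : (0 : ℝ) < #A := by exact_mod_cast hA.card_pos
  set B := A.filter fun a => S ≤ 2 * #A * ‖c a‖ with hB
  have t1 : 0 ≤ (2 * #A : ℝ) ^ (2 * k) * (#A : ℝ) ^ (2 * s - 1) * ∑ b ∈ A,
      ∑ a ∈ box k A with a.Injective, (∏ i, ‖c (a i)‖ ^ 2) * ‖c b‖ ^ (2 * s) := by positivity
  have hY0 : 0 ≤ Y := by obtain ⟨a, ha⟩ := hA; exact (norm_nonneg _).trans (hY a ha)
  have t2 : 0 ≤ (2 * k : ℝ) ^ (2 * (s + k)) * Y ^ (2 * k) * ∑ b ∈ A, ‖c b‖ ^ (2 * s) := by positivity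
  by_cases hBk : k ≤ #B
  · refine le_add_of_le_of_nonneg ?_ t2
    obtain ⟨a, ha⟩ : ∃ a : Fin k → ℤ, a.Injective ∧ ∀ i, a i ∈ B := by
      refine ⟨fun i => (B.equivFin.symm (Fin.castLE hBk i) : ℤ), ?_, fun i => coe_mem _⟩
      intro i j hij
      simpa using hij
    have h1 : S ^ (2 * k) ≤ (2 * #A : ℝ) ^ (2 * k) * ∏ i, ‖c (a i)‖ ^ 2 := by
      have : ∏ i : Fin k, S ^ 2 ≤ ∏ i : Fin k, ((2 * #A : ℝ) ^ 2 * ‖c (a i)‖ ^ 2) := by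
        refine prod_le_prod (fun _ _ => by positivity) fun i _ => ?_
        rw [← mul_pow]; exact pow_le_pow_left₀ hS0 (mem_filter.1 (ha.2 i)).2 2
      simpa [prod_mul_distrib, ← pow_mul] using this
    have h2 : S ^ (2 * s) ≤ (#A : ℝ) ^ (2 * s - 1) * ∑ b ∈ A, ‖c b‖ ^ (2 * s) :=
      (pow_le_pow_left₀ hS0 (norm_sum_le _ _) _).trans
        (pm_le A (fun b => ‖c b‖) (fun _ _ => norm_nonneg _) _ (by omega))
    rw [mul_add, pow_add]
    calc S ^ (2 * s) * S ^ (2 * k) ≤ _ := mul_le_mul h2 h1 (by positivity) (by positivity)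
      _ = (2 * #A : ℝ) ^ (2 * k) * (#A : ℝ) ^ (2 * s - 1) * ∑ b ∈ A,
        (∏ i, ‖c (a i)‖ ^ 2) * ‖c b‖ ^ (2 * s) := by rw [← mul_sum]; ring
      _ ≤ _ := by
        refine mul_le_mul_of_nonneg_left (sum_le_sum fun b _ => ?_) (by positivity)
        refine single_le_sum (f := fun a : Fin k → ℤ => (∏ i, ‖c (a i)‖ ^ 2) * ‖c b‖ ^ (2 * s))
          (fun _ _ => by positivity) ?_
        simp only [mem_filter, Fintype.mem_piFinset]
        exact ⟨fun i => (mem_filter.1 (ha.2 i)).1, ha.1⟩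
  · refine le_add_of_nonneg_of_le t1 ?_
    obtain ⟨a0, ha0, hmax⟩ := exists_max_image A (fun a => ‖c a‖) hA
    have h1 : S ≤ 2 * k * ‖c a0‖ := by
      have h2 : S ≤ ∑ a ∈ B, ‖c a‖ + ∑ a ∈ A with ¬ S ≤ 2 * #A * ‖c a‖, ‖c a‖ := by
        rw [hB, sum_filter_add_sum_filter_not]; exact norm_sum_le _ _
      have h3 : ∑ a ∈ B, ‖c a‖ ≤ k * ‖c a0‖ := by
        refine (sum_le_card_nsmul _ _ _ fun a ha => hmax a (mem_filter.1 ha).1).trans ?_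
        rw [nsmul_eq_mul]
        exact mul_le_mul_of_nonneg_right (Nat.cast_le.2 (not_le.1 hBk).le) (norm_nonneg _)
      have h4 : ∑ a ∈ A with ¬ S ≤ 2 * #A * ‖c a‖, ‖c a‖ ≤ S / 2 := by
        refine (sum_le_card_nsmul _ _ (S / (2 * #A)) fun a ha => ?_).trans ?_
        · rw [le_div_iff₀ (by positivity)]; linarith [not_le.1 (mem_filter.1 ha).2]
        · rw [nsmul_eq_mul]
          calc _ ≤ (#A : ℝ) * (S / (2 * #A)) := mul_le_mul_of_nonneg_right
                (by exact_mod_cast card_filter_le _ _) (by positivity)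
            _ = S / 2 := by field_simp
      linarith
    calc S ^ (2 * (s + k)) ≤ (2 * k * ‖c a0‖) ^ (2 * (s + k)) := pow_le_pow_left₀ hS0 h1 _
      _ = (2 * k : ℝ) ^ (2 * (s + k)) * ‖c a0‖ ^ (2 * k) * ‖c a0‖ ^ (2 * s) := by
        rw [mul_pow, mul_assoc, ← pow_add]; congr 2; ring
      _ ≤ _ := by
        gcongr
        · exact hY _ ha0
        · exact single_le_sum (f := fun b => ‖c b‖ ^ (2 * s)) (fun _ _ => by positivity) ha0

end VK

namespace VK
open UnitAddTorus Finset

noncomputable abbrev J (k s X : ℕ) : ℕ := Jc k s (Icc (1 : ℤ) X)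
noncomputable abbrev cl (X p : ℕ) (a : ℤ) : Finset ℤ := (Icc (1 : ℤ) X).filter fun x => x % p = a

lemma cl_sub (X p : ℕ) (hp : 0 < p) (a : ℤ) :
    cl X p a ⊆ (Icc (0 : ℤ) (X / p : ℕ)).image fun m => (p : ℤ) * m + a := by
  intro x hx
  simp only [mem_filter, mem_Icc, mem_image] at hx ⊢
  refine ⟨x / p, ⟨Int.ediv_nonneg (by omega) (by positivity), ?_⟩, ?_⟩
  · push_cast; exact Int.ediv_le_ediv (by positivity) hx.1.2
  · rw [← hx.2]; exact Int.mul_ediv_add_emod x p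

lemma cl_card (X p : ℕ) (hp : 0 < p) (a : ℤ) : #(cl X p a) ≤ X / p + 1 := by
  refine (card_le_card (cl_sub X p hp a)).trans (card_image_le.trans ?_)
  rw [Int.card_Icc]; generalize X / p = y; omega

lemma cl_J (k s X p : ℕ) (hp : 0 < p) (a : ℤ) : Jc k s (cl X p a) ≤ J k s (X / p + 1) := by
  refine (Jc_mono k s (cl_sub X p hp a)).trans ((Jc_affine k s _ p a (by positivity)).trans ?_)
  refine le_trans (Jc_mono k s ?_) (Jc_affine k s (Icc (1 : ℤ) (X / p + 1 : ℕ)) 1 (-1) one_ne_zero)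
  intro m hm
  simp only [mem_Icc, mem_image] at hm ⊢
  exact ⟨m + 1, by push_cast at *; omega, by ring⟩

lemma mixed_count {k s p X : ℕ} (hp : p.Prime) (hkp : k < p) (hX : X ≤ p ^ k) (b : ℤ)
    (a : Fin k → ℤ) (ha : ∀ i, a i ∈ Ico (0 : ℤ) p) (hai : a.Injective) :
    ∫ t, (∏ i, ‖∑ x ∈ cl X p (a i), ec (pw k x) t‖ ^ 2) * ‖∑ x ∈ cl X p b, ec (pw k x) t‖ ^ (2 * s)
      ∂mu k ≤ (p : ℝ) ^ (k * (k - 1) / 2) * J k s (X / p + 1) * ∏ i, (#(cl X p (a i)) : ℝ) := by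
  set P := Fintype.piFinset fun i => cl X p (a i) with hP
  set Q := box s (cl X p b)
  have h1 : ∀ t, (∏ i, ‖∑ x ∈ cl X p (a i), ec (pw k x) t‖ ^ 2) *
      ‖∑ x ∈ cl X p b, ec (pw k x) t‖ ^ (2 * s)
      = ‖∑ q ∈ P ×ˢ Q, ec (psum k q.1 + psum k q.2) t‖ ^ 2 := by
    intro t
    simp_rw [ec_add]
    rw [sum_product]
    dsimp only
    rw [← sum_mul_sum, ← sum_pow_ec, norm_mul, mul_pow, norm_pow, ← pow_mul,
      mul_comm s 2, prod_pow, ← norm_prod, prod_univ_sum]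
    congr 3; refine sum_congr rfl fun x _ => ?_
    rw [psum, ec_sum]
  simp_rw [h1]
  rw [count_eq]
  set F := {q ∈ (P ×ˢ Q) ×ˢ (P ×ˢ Q) | psum k q.1.1 + psum k q.1.2 = psum k q.2.1 + psum k q.2.2}
  set T := {r ∈ P ×ˢ P | ∀ j : Fin k, (p : ℤ) ^ ((j : ℕ) + 1) ∣
      ∑ i, (r.1 i - b) ^ ((j : ℕ) + 1) - ∑ i, (r.2 i - b) ^ ((j : ℕ) + 1)}
  have hF : #F ≤ J k s (X / p + 1) * #T := by
    refine card_le_mul_card_image_of_maps_to (f := fun q => (q.1.1, q.2.1)) ?_ _ ?_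
    · intro q hq
      simp only [F, T, Q, mem_filter, mem_product] at hq ⊢
      refine ⟨⟨hq.1.1.1, hq.1.2.1⟩, fun j => ?_⟩
      have e := psum_affine (k := k) (Fin.append q.1.1 q.1.2) (Fin.append q.2.1 q.2.2) 1 (-b)
        (fun j => by
          have := congrFun hq.2 j
          simpa [psum_apply, Fin.sum_univ_add] using this) j
      simp only [one_mul, Fin.sum_univ_add, Fin.append_left, Fin.append_right, ← sub_eq_add_neg] at e
      have e2 : ∑ i, (q.1.1 i - b) ^ ((j : ℕ) + 1) - ∑ i, (q.2.1 i - b) ^ ((j : ℕ) + 1) =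
        ∑ i, (q.2.2 i - b) ^ ((j : ℕ) + 1) - ∑ i, (q.1.2 i - b) ^ ((j : ℕ) + 1) := by linarith
      rw [e2]
      have hd : ∀ u : Fin s → ℤ, u ∈ box s (cl X p b) → ∀ i, (p : ℤ) ∣ u i - b := by
        intro u hu i
        have := (mem_filter.1 (Fintype.mem_piFinset.1 hu i)).2
        exact this ▸ Int.dvd_self_sub_emod
      exact dvd_sub (dvd_sum fun i _ => pow_dvd_pow_of_dvd (hd _ hq.1.2.2 i) _)
        (dvd_sum fun i _ => pow_dvd_pow_of_dvd (hd _ hq.1.1.2 i) _)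
    · rintro ⟨x, y⟩ -
      refine le_trans ?_ ((count_le Q (psum k) (psum k y - psum k x)).trans (cl_J k s X p hp.pos b))
      refine card_le_card_of_injOn (fun q => (q.1.2, q.2.2)) ?_ ?_
      · intro q hq
        simp only [F, coe_filter, mem_filter, mem_product, Set.mem_ofPred_eq, Prod.mk.injEq] at hq ⊢
        refine ⟨⟨hq.1.1.1.2, hq.1.1.2.2⟩, ?_⟩
        have := hq.1.2
        rw [hq.2.1, hq.2.2] at this
        rw [sub_eq_sub_iff_add_eq_add, add_comm]; rw [this]
      · intro q hq q' hq' h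
        simp only [coe_filter, mem_filter, Set.mem_ofPred_eq, Prod.mk.injEq] at hq hq' h
        ext1 <;> ext1
        · rw [hq.2.1, hq'.2.1]
        · exact h.1
        · rw [hq.2.2, hq'.2.2]
        · exact h.2
  have hT : #T ≤ p ^ (k * (k - 1) / 2) * #P := by
    refine card_le_mul_card_image_of_maps_to (f := fun r => r.2) ?_ _ ?_
    · intro r hr; exact (mem_product.1 (mem_filter.1 hr).1).2
    · intro y hy
      have hy' : ∀ i, y i % p = a i := fun i => (mem_filter.1 (Fintype.mem_piFinset.1 hy i)).2
      refine le_trans ?_ (linnik hp hkp hX b y ?_)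
      · refine card_le_card_of_injOn (fun r => r.1) ?_ ?_
        · intro r hr
          simp only [T, coe_filter, mem_filter, mem_product, Set.mem_ofPred_eq] at hr ⊢
          obtain ⟨⟨⟨h1, h2⟩, h3⟩, rfl⟩ := hr
          have h4 := fun i => mem_filter.1 (Fintype.mem_piFinset.1 h1 i)
          refine ⟨Fintype.mem_piFinset.2 fun i => (h4 i).1, fun i => ?_, h3⟩
          exact (show r.2 i ≡ r.1 i [ZMOD p] by rw [Int.ModEq, hy', (h4 i).2]).dvd
        · intro r hr r' hr' h
          simp only [coe_filter, Set.mem_ofPred_eq] at hr hr'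
          exact Prod.ext h (hr.2.trans hr'.2.symm)
      · intro i i' h
        have := (Int.modEq_iff_dvd.2 h)
        rw [Int.ModEq, hy', hy'] at this
        exact (hai this).symm
  have hPc : #P = ∏ i, #(cl X p (a i)) := Fintype.card_piFinset _
  calc (#F : ℝ) ≤ (J k s (X / p + 1) * (p ^ (k * (k - 1) / 2) * #P) : ℕ) := by
        exact_mod_cast hF.trans (Nat.mul_le_mul_left _ hT)
    _ = _ := by rw [hPc]; push_cast; ring

set_option maxHeartbeats 800000 in
lemma J_rec {k s p X : ℕ} (hp : p.Prime) (hkp : k < p) (hX : X ≤ p ^ k) (hk : 1 ≤ k) (hs : 1 ≤ s) :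
    (J k (s + k) X : ℝ) ≤ ((2 * p : ℝ) ^ (2 * k) * (p : ℝ) ^ (2 * s) * p ^ (k * (k - 1) / 2) * X ^ k
      + (2 * k : ℝ) ^ (2 * (s + k)) * (X / p + 1 : ℕ) ^ (2 * k) * p) * J k s (X / p + 1) := by
  set Y := X / p + 1
  set A := Ico (0 : ℤ) p with hA
  have hp0 : (0 : ℤ) < p := by exact_mod_cast hp.pos
  have hAc : #A = p := by simp [hA]
  have hAn : A.Nonempty := ⟨0, by simp [hA, hp.pos]⟩
  set c : UnitAddTorus (Fin k) → ℤ → ℂ := fun t a => ∑ x ∈ cl X p a, ec (pw k x) t with hc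
  have cc : ∀ a, Continuous fun t => c t a := fun a => continuous_finsetSum _ fun x _ => ec_cont _
  have hS : ∀ t, ∑ x ∈ Icc (1 : ℤ) X, ec (pw k x) t = ∑ a ∈ A, c t a := fun t => by
    refine (sum_fiberwise_of_maps_to (fun x _ => ?_) _).symm
    exact mem_Ico.2 ⟨Int.emod_nonneg _ hp0.ne', Int.emod_lt_of_pos _ hp0⟩
  have hY : ∀ t, ∀ a ∈ A, ‖c t a‖ ≤ Y := fun t a _ => by
    refine (norm_sum_le _ _).trans ?_
    simp only [ec_norm, sum_const, nsmul_eq_mul, mul_one]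
    exact_mod_cast cl_card X p hp.pos a
  have hmain := fun t => broad A hAn (c t) k s hs Y (hY t) hk
  rw [← Jc_int]
  simp_rw [hS]
  rw [hAc] at hmain
  have i1 : ∀ (b : ℤ) (a : Fin k → ℤ), Integrable (fun t => (∏ i : Fin k, ‖c t (a i)‖ ^ 2) * ‖c t b‖ ^ (2 * s)) (mu k) :=
    fun b a => int_of_cont <| (continuous_finsetProd _ fun i _ => ((cc _).norm.pow _)).mul
      ((cc _).norm.pow _)
  have i2 : ∀ b, Integrable (fun t => ‖c t b‖ ^ (2 * s)) (mu k) :=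
    fun b => int_of_cont ((cc _).norm.pow _)
  have i3 : Integrable (fun t => ∑ b ∈ A, ∑ a ∈ box k A with a.Injective,
        (∏ i, ‖c t (a i)‖ ^ 2) * ‖c t b‖ ^ (2 * s)) (mu k) :=
    integrable_finsetSum _ fun b _ => integrable_finsetSum _ fun a _ => i1 b a
  have i4 : Integrable (fun t => ∑ b ∈ A, ‖c t b‖ ^ (2 * s)) (mu k) :=
    integrable_finsetSum _ fun b _ => i2 b
  refine (integral_mono (int_of_cont ((continuous_finsetSum _ fun a _ => cc a).norm.pow _))
    ((i3.const_mul _).add (i4.const_mul _)) hmain).trans ?_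
  simp only [Pi.add_apply]
  rw [integral_add (i3.const_mul _) (i4.const_mul _), integral_const_mul, integral_const_mul,
    integral_finsetSum _ fun b _ => integrable_finsetSum _ fun a _ => i1 b a,
    integral_finsetSum _ fun b _ => i2 b, add_mul]
  have b2 : ∑ b ∈ A, ∫ t, ‖c t b‖ ^ (2 * s) ∂mu k ≤ p * J k s Y := by
    refine (sum_le_card_nsmul A _ (J k s Y : ℝ) fun b _ => ?_).trans_eq (by rw [hAc, nsmul_eq_mul])
    rw [hc, Jc_int]; exact_mod_cast cl_J k s X p hp.pos b
  have b1 : ∑ b ∈ A, ∫ t, ∑ a ∈ box k A with a.Injective,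
        (∏ i, ‖c t (a i)‖ ^ 2) * ‖c t b‖ ^ (2 * s) ∂mu k
      ≤ p * ((p : ℝ) ^ (k * (k - 1) / 2) * J k s Y * X ^ k) := by
    refine (sum_le_card_nsmul A _ ((p : ℝ) ^ (k * (k - 1) / 2) * J k s Y * X ^ k)
      fun b _ => ?_).trans_eq (by rw [hAc, nsmul_eq_mul])
    rw [integral_finsetSum _ fun a _ => i1 b a]
    have hx : ∑ a ∈ box k A, ∏ i, (#(cl X p (a i)) : ℝ) = (X : ℝ) ^ k := by
      rw [← prod_univ_sum (fun _ : Fin k => A) (fun _ a => (#(cl X p a) : ℝ)), prod_const, card_univ,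
        Fintype.card_fin]
      congr 1
      rw [← Nat.cast_sum, ← card_eq_sum_card_fiberwise (fun x _ => ?_)]
      · simp
      · simp only [hA, coe_Ico, Set.mem_Ico]
        exact ⟨Int.emod_nonneg _ hp0.ne', Int.emod_lt_of_pos _ hp0⟩
    rw [← hx, mul_sum]
    have hm : ∀ a ∈ (box k A).filter (fun a => a.Injective),
        ∫ t, (∏ i, ‖c t (a i)‖ ^ 2) * ‖c t b‖ ^ (2 * s) ∂mu k ≤ (p : ℝ) ^ (k * (k - 1) / 2) *
          J k s Y * ∏ i, (#(cl X p (a i)) : ℝ) := by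
      intro a ha
      obtain ⟨h1, h2⟩ := mem_filter.1 ha
      exact mixed_count hp hkp hX b a (Fintype.mem_piFinset.1 h1) h2
    refine (sum_le_sum hm).trans ?_
    exact sum_le_sum_of_subset_of_nonneg (filter_subset _ _) fun _ _ _ => mul_nonneg (mul_nonneg
      (pow_nonneg (Nat.cast_nonneg _) _) (Nat.cast_nonneg _)) (prod_nonneg fun _ _ => Nat.cast_nonneg _)
  refine add_le_add ?_ ?_
  · refine (mul_le_mul_of_nonneg_left b1 (by positivity)).trans (le_of_eq ?_)
    have : (p : ℝ) ^ (2 * s) = p ^ (2 * s - 1) * p := by rw [← pow_succ]; congr 1; omega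
    rw [this]; ring
  · refine (mul_le_mul_of_nonneg_left b2 (by positivity)).trans (le_of_eq ?_)
    push_cast; ring

end VK

namespace VK
open UnitAddTorus Finset

lemma J_triv (k s m X : ℕ) : (J k (s + m) X : ℝ) ≤ (X : ℝ) ^ (2 * m) * J k s X := by
  rw [← Jc_int, ← Jc_int, ← integral_const_mul]
  have cc : Continuous fun t => ‖∑ x ∈ Icc (1 : ℤ) X, ec (pw k x) t‖ :=
    (continuous_finsetSum _ fun x _ => ec_cont _).norm
  refine integral_mono (int_of_cont (cc.pow _)) ((int_of_cont (cc.pow _)).const_mul _) fun t => ?_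
  simp only []
  rw [mul_add, pow_add, mul_comm]
  gcongr
  refine (norm_sum_le _ _).trans ?_
  simp [ec_norm]

lemma J_zero (k X : ℕ) : (J k 0 X : ℝ) ≤ 1 := by
  have : Jc k 0 (Icc (1 : ℤ) X) ≤ 1 := by
    unfold Jc
    exact (card_filter_le _ _).trans (by simp)
  exact_mod_cast this

lemma J_step {k s X : ℕ} (hk : 2 ≤ k) (hs : k ^ 2 ≤ s) (hX : (4 * k ^ 2) ^ k < X) :
    ∃ p : ℕ, 0 < p ∧ (p : ℝ) ≤ 4 * (X : ℝ) ^ (1 / k : ℝ) ∧ p * (X / p + 1) ≤ 2 * X ∧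
      (J k (s + k) X : ℝ) ≤
        2 * ((2 * p : ℝ) ^ (2 * k) * (p : ℝ) ^ (2 * s) * p ^ (k * (k - 1) / 2) * X ^ k) *
          J k s (X / p + 1) := by
  set z : ℝ := (X : ℝ) ^ (1 / k : ℝ) with hz
  have hzk : z ^ k = X := by
    rw [hz, ← rpow_natCast, ← rpow_mul (by positivity)]; field_simp; simp
  have hz0 : 0 ≤ z := by positivity
  have hz1 : (4 * k ^ 2 : ℝ) < z := by
    refine lt_of_pow_lt_pow_left₀ k hz0 ?_
    rw [hzk]; exact_mod_cast hX
  have hk2 : (2 : ℝ) ≤ k := by exact_mod_cast hk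
  have hz16 : 16 ≤ z := by nlinarith
  obtain ⟨p, hp, hp1, hp2⟩ := Nat.exists_prime_lt_and_le_two_mul ⌈z⌉₊
    (by have := Nat.ceil_pos.2 (show 0 < z by linarith); omega)
  have hzp : z < p := (Nat.le_ceil z).trans_lt (by exact_mod_cast hp1)
  have hpz : (p : ℝ) ≤ 4 * z := by
    have h1 := Nat.ceil_lt_add_one hz0
    have h2 : (p : ℝ) ≤ 2 * ⌈z⌉₊ := by exact_mod_cast hp2
    linarith
  have hpX : (p : ℝ) ≤ X := by
    rw [← hzk]
    have : z ^ 2 ≤ z ^ k := pow_le_pow_right₀ (by linarith) hk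
    nlinarith
  have hYp : p * (X / p + 1) ≤ 2 * X := by
    have := Nat.mul_div_le X p
    have h3 : p ≤ X := by exact_mod_cast hpX
    rw [mul_add]; omega
  refine ⟨p, hp.pos, hpz, hYp, ?_⟩
  have hp2k : ((2 * k) ^ 2 : ℝ) ≤ p := by nlinarith
  have hkp : k < p := by
    have : (k : ℝ) < p := by nlinarith
    exact_mod_cast this
  have hXp : (X : ℝ) ≤ p ^ k := by rw [← hzk]; gcongr
  have hs1 : 1 ≤ s := by nlinarith
  refine (J_rec hp hkp (by exact_mod_cast hXp) (by omega) hs1).trans ?_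
  refine mul_le_mul_of_nonneg_right ?_ (Nat.cast_nonneg _)
  rw [two_mul (_ * _)]
  refine add_le_add_right ?_ _
  set Y := X / p + 1
  have hp0 : (0 : ℝ) < p := by exact_mod_cast hp.pos
  have hp1 : (1 : ℝ) ≤ p := by exact_mod_cast hp.one_le
  have e1 : (2 * k : ℝ) ^ (2 * (s + k)) ≤ p ^ (s + k) := by rw [pow_mul]; gcongr
  have e2 : (Y : ℝ) ^ (2 * k) * p ^ (2 * k) ≤ 2 ^ (2 * k) * X ^ k * p ^ (k * k) := by
    have : (p : ℝ) * Y ≤ 2 * X := by exact_mod_cast hYp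
    calc (Y : ℝ) ^ (2 * k) * p ^ (2 * k) = (p * Y) ^ (2 * k) := by rw [mul_pow]; ring
      _ ≤ (2 * X) ^ (2 * k) := by gcongr
      _ = 2 ^ (2 * k) * X ^ k * X ^ k := by rw [mul_pow]; ring
      _ ≤ 2 ^ (2 * k) * X ^ k * (p ^ k) ^ k := by gcongr
      _ = _ := by rw [pow_mul (p : ℝ)]
  refine le_of_mul_le_mul_right ?_ (pow_pos hp0 (2 * k))
  calc (2 * k : ℝ) ^ (2 * (s + k)) * Y ^ (2 * k) * p * p ^ (2 * k)
      = (2 * k : ℝ) ^ (2 * (s + k)) * (Y ^ (2 * k) * p ^ (2 * k)) * p := by ring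
    _ ≤ p ^ (s + k) * (2 ^ (2 * k) * X ^ k * p ^ (k * k)) * p := by gcongr
    _ = 2 ^ (2 * k) * X ^ k * p ^ (s + k + k * k + 1) := by ring
    _ ≤ 2 ^ (2 * k) * X ^ k * p ^ (2 * k + 2 * s + 2 * k) :=
        mul_le_mul_of_nonneg_left (pow_le_pow_right₀ hp1 (by nlinarith)) (by positivity)
    _ = 2 ^ (2 * k) * X ^ k * p ^ (2 * k + 2 * s + 2 * k) * 1 := by ring
    _ ≤ 2 ^ (2 * k) * X ^ k * p ^ (2 * k + 2 * s + 2 * k) * p ^ (k * (k - 1) / 2) := by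
        gcongr; exact one_le_pow₀ hp1
    _ = _ := by rw [mul_pow 2 (p : ℝ)]; ring

/-- exponent loss -/
noncomputable def Dl (k : ℕ) : ℕ → ℝ
  | 0 => k ^ 2
  | r + 1 => Dl k r * (1 - 1 / k) + 2

lemma Dl_bd {k : ℕ} (hk : 2 ≤ k) (r : ℕ) : 0 ≤ Dl k r ∧ Dl k r ≤ k ^ 2 ∧
    Dl k r ≤ 2 * k + k ^ 2 * (1 - 1 / k) ^ r := by
  have hk2 : (2 : ℝ) ≤ k := by exact_mod_cast hk
  have h1 : (0 : ℝ) ≤ 1 - 1 / k := by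
    rw [sub_nonneg, div_le_one (by linarith)]; linarith
  have h3 : (k : ℝ) * (1 - 1 / k) = k - 1 := by field_simp
  induction r with
  | zero => simp [Dl]
  | succ r ih =>
    obtain ⟨a, b, c⟩ := ih
    refine ⟨by simp only [Dl]; positivity, ?_, ?_⟩
    · simp only [Dl]
      nlinarith [mul_le_mul_of_nonneg_right b h1]
    · simp only [Dl]
      have := mul_le_mul_of_nonneg_right c h1
      rw [pow_succ _ r, ← mul_assoc]; linarith

noncomputable def Ex (k r : ℕ) : ℝ := 2 * (k ^ 2 + r * k) - k * (k + 1) / 2 + Dl k r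

lemma J_ind {k : ℕ} (hk : 2 ≤ k) (r : ℕ) (hr : r ≤ 7 * k) : ∀ X : ℕ, 1 ≤ X →
    (J k (k ^ 2 + r * k) X : ℝ) ≤ ((2 ^ 28 * k ^ 2 : ℝ) ^ (k ^ 2)) ^ r * (X : ℝ) ^ (Ex k r) := by
  have hk2 : (2 : ℝ) ≤ k := by exact_mod_cast hk
  induction r with
  | zero =>
    intro X hX
    have hX1 : (1 : ℝ) ≤ X := by exact_mod_cast hX
    have := (J_triv k 0 (k ^ 2) X).trans (mul_le_of_le_one_right (by positivity) (J_zero k X))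
    simp only [zero_mul, add_zero, pow_zero, one_mul, zero_add] at this ⊢
    refine this.trans ?_
    rw [← rpow_natCast]
    refine rpow_le_rpow_of_exponent_le hX1 ?_
    simp only [Ex, Dl]; push_cast; nlinarith
  | succ r ih =>
    intro X hX
    have hX1 : (1 : ℝ) ≤ X := by exact_mod_cast hX
    have hX0 : (0 : ℝ) < X := by linarith
    have ih := ih (by omega)
    obtain ⟨d0, d1, d2⟩ := Dl_bd hk r
    have hEx : Ex k (r + 1) = Ex k r + 2 * k + 2 - Dl k r / k := by
      simp only [Ex, Dl]; push_cast; ring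
    have hdk : Dl k r / k ≤ k := by rw [div_le_iff₀ (by linarith)]; nlinarith
    set B := (2 ^ 28 * k ^ 2 : ℝ) ^ (k ^ 2) with hB
    have hBe : B = (4 * k ^ 2 : ℝ) ^ (k ^ 2) * 2 ^ (26 * k ^ 2) := by
      rw [hB, pow_mul, ← mul_pow]; congr 1; ring
    rw [show k ^ 2 + (r + 1) * k = k ^ 2 + r * k + k by ring]
    set s := k ^ 2 + r * k with hs
    rcases le_or_gt X ((4 * k ^ 2) ^ k) with h | h
    · have hX2 : (X : ℝ) ≤ (4 * k ^ 2 : ℝ) ^ k := by exact_mod_cast h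
      calc (J k (s + k) X : ℝ) ≤ (X : ℝ) ^ (2 * k) * J k s X := J_triv k s k X
        _ ≤ (X : ℝ) ^ (2 * k) * (B ^ r * (X : ℝ) ^ (Ex k r)) := by gcongr; exact ih X hX
        _ = B ^ r * (X : ℝ) ^ (Ex k r + 2 * k) := by
            rw [rpow_add hX0, show (2 * k : ℝ) = (2 * k : ℕ) by push_cast; ring, rpow_natCast]; ring
        _ ≤ B ^ r * (X : ℝ) ^ (Ex k (r + 1) + k) := by
            refine mul_le_mul_of_nonneg_left (rpow_le_rpow_of_exponent_le hX1 ?_) (by positivity)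
            rw [hEx]; linarith
        _ = B ^ r * X ^ k * (X : ℝ) ^ (Ex k (r + 1)) := by
            rw [rpow_add hX0, rpow_natCast]; ring
        _ ≤ B ^ r * B * (X : ℝ) ^ (Ex k (r + 1)) := by
            gcongr
            calc (X : ℝ) ^ k ≤ ((4 * k ^ 2 : ℝ) ^ k) ^ k := by gcongr
              _ = (4 * k ^ 2 : ℝ) ^ (k ^ 2) * 1 := by rw [← pow_mul, ← pow_two, mul_one]
              _ ≤ B := by rw [hBe]; gcongr; exact one_le_pow₀ (by norm_num)
        _ = _ := by rw [pow_succ]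
    · obtain ⟨p, hp, hpz, hY, hJ⟩ := J_step hk (show k ^ 2 ≤ s by rw [hs]; exact Nat.le_add_right _ _) h
      set Y := X / p + 1
      have hp0 : (0 : ℝ) < p := by exact_mod_cast hp
      have hY0 : (0 : ℝ) < Y := by positivity
      have hYp : (Y : ℝ) ≤ 2 * X / p := by
        rw [le_div_iff₀ hp0, mul_comm]; exact_mod_cast hY
      have hE0 : 0 ≤ Ex k r := by
        simp only [Ex]
        have : (0 : ℝ) ≤ r * k := by positivity
        nlinarith
      have hE1 : Ex k r + 2 * (2 * k + k ^ 2 - Dl k r) + 2 * k + 1 ≤ (26 * k ^ 2 : ℕ) := by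
        have : (r : ℝ) ≤ 7 * k := by
          have : r ≤ 7 * k := by omega
          exact_mod_cast this
        simp only [Ex]; push_cast; nlinarith
      have he : (k * (k - 1) / 2 : ℕ) = (k * (k - 1) / 2 : ℝ) := by
        rw [Nat.cast_div (by exact (Nat.even_mul_pred_self k).two_dvd) (by norm_num)]
        push_cast [Nat.cast_sub (show 1 ≤ k by omega)]; ring
      calc (J k (s + k) X : ℝ) ≤ _ := hJ
        _ ≤ 2 * ((2 * p : ℝ) ^ (2 * k) * (p : ℝ) ^ (2 * s) * p ^ (k * (k - 1) / 2) * X ^ k) *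
          (B ^ r * (2 * X / p) ^ (Ex k r)) := by
            gcongr; exact (ih Y (by simp [Y])).trans (by gcongr)
        _ = B ^ r * (2 : ℝ) ^ (Ex k r + 2 * k + 1) * X ^ (Ex k r + k) *
            (p : ℝ) ^ (2 * k + k ^ 2 - Dl k r) := by
            rw [div_rpow (by positivity) hp0.le, mul_rpow (by norm_num) hX0.le,
              rpow_add hX0, rpow_natCast, rpow_add two_pos, rpow_add two_pos, rpow_one,
              show (2 * k + k ^ 2 - Dl k r : ℝ) = (2 * k : ℕ) + (2 * s : ℕ) + (k * (k - 1) / 2 : ℕ)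
                - Ex k r by rw [he]; simp only [Ex, hs]; push_cast; ring,
              rpow_sub hp0, rpow_add hp0, rpow_add hp0, rpow_natCast, rpow_natCast, rpow_natCast,
              show (2 * k : ℝ) = (2 * k : ℕ) by push_cast; ring, rpow_natCast, mul_pow]
            ring
        _ ≤ B ^ r * (2 : ℝ) ^ (Ex k r + 2 * k + 1) * X ^ (Ex k r + k) *
            (4 * (X : ℝ) ^ (1 / k : ℝ)) ^ (2 * k + k ^ 2 - Dl k r) := by
            gcongr; nlinarith
        _ = B ^ r * (2 : ℝ) ^ (Ex k r + 2 * (2 * k + k ^ 2 - Dl k r) + 2 * k + 1) *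
            X ^ (Ex k (r + 1)) := by
            rw [mul_rpow (by norm_num) (by positivity), ← rpow_mul hX0.le,
              show (4 : ℝ) = 2 ^ (2 : ℝ) by norm_num, ← rpow_mul two_pos.le, hEx,
              show Ex k r + 2 * k + 2 - Dl k r / k = (Ex k r + k) +
                1 / k * (2 * k + k ^ 2 - Dl k r) by field_simp; ring,
              rpow_add hX0 (Ex k r + k), show Ex k r + 2 * (2 * k + k ^ 2 - Dl k r) + 2 * k + 1 =
                (Ex k r + 2 * k + 1) + 2 * (2 * k + k ^ 2 - Dl k r) by ring,
              rpow_add two_pos (Ex k r + 2 * k + 1)]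
            ring
        _ ≤ B ^ r * B * X ^ (Ex k (r + 1)) := by
            gcongr
            refine (rpow_le_rpow_of_exponent_le one_le_two hE1).trans ?_
            rw [rpow_natCast, hBe]
            exact le_mul_of_one_le_left (by positivity) (one_le_pow₀ (by nlinarith))
        _ = _ := by rw [pow_succ]

/-- Vinogradov mean value bound with `s = 8k²`. -/
lemma vmvt {k X : ℕ} (hk : 2 ≤ k) (hX : 1 ≤ X) : (J k (8 * k ^ 2) X : ℝ) ≤
    (2 ^ 28 * k ^ 2 : ℝ) ^ (7 * k ^ 3) *
      (X : ℝ) ^ (16 * k ^ 2 - k * (k + 1) / 2 + (2 * k + k ^ 2 / 100) : ℝ) := by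
  have h := J_ind hk (7 * k) le_rfl X hX
  have hX1 : (1 : ℝ) ≤ X := by exact_mod_cast hX
  have hk2 : (2 : ℝ) ≤ k := by exact_mod_cast hk
  rw [show k ^ 2 + 7 * k * k = 8 * k ^ 2 by ring] at h
  refine h.trans ?_
  rw [← pow_mul, show k ^ 2 * (7 * k) = 7 * k ^ 3 by ring]
  refine mul_le_mul_of_nonneg_left (rpow_le_rpow_of_exponent_le hX1 ?_) (by positivity)
  · have := (Dl_bd hk (7 * k)).2.2
    have e : (1 - 1 / k : ℝ) ^ (7 * k) ≤ 1 / 100 := by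
      have h1 : (1 - 1 / k : ℝ) ≤ exp (-(1 / k)) := by linarith [add_one_le_exp (-(1 / k : ℝ))]
      have h0 : (0 : ℝ) ≤ 1 - 1 / k := by
        rw [sub_nonneg, div_le_one (by linarith)]; linarith
      calc (1 - 1 / k : ℝ) ^ (7 * k) ≤ exp (-(1 / k)) ^ (7 * k) := by gcongr
        _ = exp (-7) := by rw [← exp_nat_mul]; congr 1; push_cast; field_simp
        _ = (exp 1 ^ 7)⁻¹ := by rw [exp_neg, ← exp_nat_mul]; norm_num
        _ ≤ ((2 : ℝ) ^ 7)⁻¹ := by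
            gcongr; linarith [add_one_le_exp (1 : ℝ)]
        _ ≤ 1 / 100 := by norm_num
    simp only [Ex]; push_cast
    nlinarith [sq_nonneg (k : ℝ)]

end VK

namespace VK
open UnitAddTorus Finset

lemma ec_pow_norm {k : ℕ} (s : ℕ) (I : Finset ℤ) (a : Fin k → ℤ) (t) :
    ((‖∑ v ∈ I, ec (a * pw k v) t‖ ^ (2 * s) : ℝ) : ℂ) =
      ∑ q ∈ box s I ×ˢ box s I, ec (a * (psum k q.1 - psum k q.2)) t := by
  have h : (∑ x ∈ I, ec (a * pw k x) t) ^ s = ∑ x ∈ box s I, ec (a * psum k x) t := by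
    have := Finset.prod_univ_sum (fun _ : Fin s => I) (fun _ x => ec (a * pw k x) t)
    rw [prod_const, card_univ, Fintype.card_fin] at this
    rw [this]; refine sum_congr rfl fun x _ => ?_
    rw [psum, mul_sum, ec_sum]
  rw [mul_comm, pow_mul, ← norm_pow, h]
  push_cast
  rw [← Complex.mul_conj', map_sum, sum_mul_sum, ← sum_product']
  refine sum_congr rfl fun q _ => ?_
  rw [← ec_sub, mul_sub]

lemma large_dual {k : ℕ} {ι : Type*} (s : ℕ) (I : Finset ℤ) (A : Finset ι) (a : ι → Fin k → ℤ) (t) :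
    ∑ i ∈ A, ‖∑ v ∈ I, ec (a i * pw k v) t‖ ^ (2 * s) ≤
      ∑ q ∈ box s I ×ˢ box s I, ‖∑ i ∈ A, ec (a i * (psum k q.1 - psum k q.2)) t‖ := by
  have h : ((∑ i ∈ A, ‖∑ v ∈ I, ec (a i * pw k v) t‖ ^ (2 * s) : ℝ) : ℂ) =
      ∑ q ∈ box s I ×ˢ box s I, ∑ i ∈ A, ec (a i * (psum k q.1 - psum k q.2)) t := by
    rw [Complex.ofReal_sum, sum_congr rfl fun i _ => ec_pow_norm s I (a i) t, sum_comm]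
  calc _ = ‖((∑ i ∈ A, ‖∑ v ∈ I, ec (a i * pw k v) t‖ ^ (2 * s) : ℝ) : ℂ)‖ := by
        rw [Complex.norm_real, norm_of_nonneg (sum_nonneg fun _ _ => by positivity)]
    _ ≤ _ := by rw [h]; exact norm_sum_le _ _

/-- difference box -/
noncomputable abbrev DB (k s U : ℕ) : Finset (Fin k → ℤ) :=
  Fintype.piFinset fun j : Fin k => Icc (-((s * U ^ ((j : ℕ) + 1) : ℕ) : ℤ)) (s * U ^ ((j : ℕ) + 1) : ℕ)

lemma sum_diff_le (k s U : ℕ) (G : (Fin k → ℤ) → ℝ) (hG : ∀ d, 0 ≤ G d) :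
    ∑ q ∈ box s (Icc (1 : ℤ) U) ×ˢ box s (Icc (1 : ℤ) U), G (psum k q.1 - psum k q.2) ≤
      J k s U * ∑ d ∈ DB k s U, G d := by
  have hb : ∀ v ∈ box s (Icc (1 : ℤ) U), ∀ j, 0 ≤ psum k v j ∧
      psum k v j ≤ (s * U ^ ((j : ℕ) + 1) : ℕ) := by
    intro v hv j
    have hv := fun i => mem_Icc.1 (Fintype.mem_piFinset.1 hv i)
    rw [psum_apply]
    refine ⟨sum_nonneg fun i _ => pow_nonneg (by linarith [(hv i).1]) _, ?_⟩
    refine (sum_le_card_nsmul univ _ ((U : ℤ) ^ ((j : ℕ) + 1)) fun i _ => ?_).trans_eq (by simp)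
    exact pow_le_pow_left₀ (by linarith [(hv i).1]) (hv i).2 _
  rw [← sum_fiberwise_of_maps_to (t := DB k s U) (g := fun q => psum k q.1 - psum k q.2), mul_sum]
  · refine sum_le_sum fun d _ => ?_
    rw [sum_congr rfl (g := fun _ => G d) fun q hq => by rw [(mem_filter.1 hq).2], sum_const,
      nsmul_eq_mul]
    refine mul_le_mul_of_nonneg_right ?_ (hG d)
    exact_mod_cast count_le (box s (Icc (1 : ℤ) U)) (psum k) d
  · intro q hq
    obtain ⟨h1, h2⟩ := mem_product.1 hq
    refine Fintype.mem_piFinset.2 fun j => mem_Icc.2 ?_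
    have := hb _ h1 j; have := hb _ h2 j
    simp only [Pi.sub_apply]; constructor <;> linarith

noncomputable def Kf (D : ℕ) (a : ℝ) : ℝ :=
  ∑ c ∈ Icc (-(D : ℤ)) D, ‖∑ d ∈ Icc (-(D : ℤ)) D, (fourier (d * c) (a : UnitAddCircle) : ℂ)‖

lemma bilin (k s U : ℕ) (hs : 1 ≤ s) (α : Fin k → ℝ) :
    ‖∑ u ∈ Icc (1 : ℤ) U, ∑ v ∈ Icc (1 : ℤ) U, ec (pw k u * pw k v) (fun j => (α j : UnitAddCircle))‖
      ^ (4 * s ^ 2) ≤ (U : ℝ) ^ (4 * s * (2 * s - 1)) * (J k s U : ℝ) ^ 2 *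
        ∏ j : Fin k, Kf (s * U ^ ((j : ℕ) + 1)) (α j) := by
  set t : UnitAddTorus (Fin k) := fun j => (α j : UnitAddCircle)
  set I := Icc (1 : ℤ) U with hI
  have hIc : (#I : ℝ) = U := by simp [hI]
  set Q := box s I ×ˢ box s I with hQ
  have hQc : (#Q : ℝ) = (U : ℝ) ^ (2 * s) := by
    rw [hQ, card_product, Fintype.card_piFinset]; push_cast
    simp only [hIc, prod_const, card_univ, Fintype.card_fin]; ring
  set g : (Fin k → ℤ) → ℝ := fun d => ‖∑ u ∈ I, ec (d * pw k u) t‖ with hg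
  have h1 : ‖∑ u ∈ I, ∑ v ∈ I, ec (pw k u * pw k v) t‖ ^ (2 * s) ≤
      (U : ℝ) ^ (2 * s - 1) * ∑ q ∈ Q, g (psum k q.1 - psum k q.2) := by
    calc _ ≤ (∑ u ∈ I, ‖∑ v ∈ I, ec (pw k u * pw k v) t‖) ^ (2 * s) := by
          gcongr; exact norm_sum_le _ _
      _ ≤ _ := pm_le I _ (fun _ _ => norm_nonneg _) _ (by omega)
      _ ≤ _ := by
          rw [hIc]; gcongr
          refine (large_dual s I I (pw k) t).trans_eq ?_
          simp only [hg, mul_comm (pw k _)]; rfl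
  have h2 : (∑ q ∈ Q, g (psum k q.1 - psum k q.2)) ^ (2 * s) ≤ (U : ℝ) ^ (2 * s * (2 * s - 1)) *
      (J k s U * ∑ d ∈ DB k s U, g d ^ (2 * s)) := by
    refine (pm_le Q _ (fun _ _ => norm_nonneg _) _ (by omega)).trans ?_
    rw [hQc, ← pow_mul]; gcongr
    exact sum_diff_le k s U (fun d => g d ^ (2 * s)) fun d => by positivity
  have h3 : ∑ d ∈ DB k s U, g d ^ (2 * s) ≤
      J k s U * ∑ c ∈ DB k s U, ‖∑ d ∈ DB k s U, ec (d * c) t‖ :=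
    (large_dual s I (DB k s U) id t).trans (sum_diff_le k s U
      (fun c => ‖∑ d ∈ DB k s U, ec (d * c) t‖) fun d => norm_nonneg _)
  have h4 : ∑ c ∈ DB k s U, ‖∑ d ∈ DB k s U, ec (d * c) t‖ =
      ∏ j : Fin k, Kf (s * U ^ ((j : ℕ) + 1)) (α j) := by
    simp only [Kf]
    rw [prod_univ_sum]
    refine sum_congr rfl fun c _ => ?_
    rw [← norm_prod, prod_univ_sum]
    rfl
  rw [h4] at h3
  have h0 : 0 ≤ ∑ q ∈ Q, g (psum k q.1 - psum k q.2) := sum_nonneg fun _ _ => norm_nonneg _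
  calc _ = (‖∑ u ∈ I, ∑ v ∈ I, ec (pw k u * pw k v) t‖ ^ (2 * s)) ^ (2 * s) := by
        rw [← pow_mul]; congr 1; ring
    _ ≤ ((U : ℝ) ^ (2 * s - 1) * ∑ q ∈ Q, g (psum k q.1 - psum k q.2)) ^ (2 * s) := by gcongr
    _ ≤ (U : ℝ) ^ (2 * s * (2 * s - 1)) * ((U : ℝ) ^ (2 * s * (2 * s - 1)) *
      (J k s U * (J k s U * ∏ j : Fin k, Kf (s * U ^ ((j : ℕ) + 1)) (α j)))) := by
        rw [mul_pow, ← pow_mul, mul_comm (2 * s - 1)]; gcongr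
        exact h2.trans (by gcongr)
    _ = _ := by
        rw [show 4 * s * (2 * s - 1) = 2 * s * (2 * s - 1) + 2 * s * (2 * s - 1) by ring, pow_add]
        ring

lemma Kf_triv (D : ℕ) (a : ℝ) : Kf D a ≤ (2 * D + 1) ^ 2 := by
  have hc : (#(Icc (-(D : ℤ)) D) : ℝ) = 2 * D + 1 := by
    rw [Int.card_Icc, show ((D : ℤ) + 1 - -D).toNat = 2 * D + 1 by omega]; push_cast; ring
  have : ∀ c ∈ Icc (-(D : ℤ)) D,
      ‖∑ d ∈ Icc (-(D : ℤ)) D, (fourier (d * c) (a : UnitAddCircle) : ℂ)‖ ≤ 2 * D + 1 := by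
    intro c _
    refine (norm_sum_le _ _).trans ?_
    simp only [fourier_apply, Circle.norm_coe, sum_const, nsmul_eq_mul, mul_one, hc]; exact le_rfl
  refine (sum_le_card_nsmul _ _ _ this).trans_eq ?_
  rw [nsmul_eq_mul, hc]; ring

lemma geo_bd (D : ℕ) (b : ℝ) (hb : |b| ≤ 1 / 2) (hb0 : b ≠ 0) :
    ‖∑ d ∈ Icc (-(D : ℤ)) D, Complex.exp (2 * π * Complex.I * b) ^ d‖ ≤ 1 / (2 * |b|) := by
  set z := Complex.exp (2 * π * Complex.I * b)
  have hz : ‖z‖ = 1 := by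
    rw [show z = Complex.exp ((2 * π * b : ℝ) * Complex.I) by simp only [z]; congr 1; push_cast; ring]
    exact Complex.norm_exp_ofReal_mul_I _
  have hz0 : z ≠ 0 := Complex.exp_ne_zero _
  have tel : ∀ n : ℕ, (z - 1) * ∑ d ∈ Icc (-(n : ℤ)) n, z ^ d = z ^ ((n : ℤ) + 1) - z ^ (-(n : ℤ)) := by
    intro n
    induction n with
    | zero => simp
    | succ n ih =>
      have : Icc (-((n + 1 : ℕ) : ℤ)) (n + 1 : ℕ) =
          insert (-((n : ℤ) + 1)) (insert ((n : ℤ) + 1) (Icc (-(n : ℤ)) n)) := by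
        ext x; simp only [mem_Icc, mem_insert]; push_cast; omega
      rw [this, sum_insert, sum_insert, mul_add, mul_add, ih]
      · push_cast
        rw [show -((n : ℤ) + 1) = -n - 1 by ring, zpow_sub₀ hz0, zpow_add₀ hz0 ((n : ℤ) + 1),
          zpow_one]
        field_simp; ring
      · simp
      · simp; omega
  have hs : 4 * |b| ≤ ‖z - 1‖ := by
    rw [show z = Complex.exp (Complex.I * (2 * π * b : ℝ)) by
      simp only [z]; congr 1; push_cast; ring, Complex.norm_exp_I_mul_ofReal_sub_one, norm_mul,
      norm_eq_abs, norm_eq_abs]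
    have := Real.mul_abs_le_abs_sin (x := π * b) (by
      rw [abs_mul, abs_of_pos pi_pos]; nlinarith [pi_pos])
    rw [show 2 * π * b / 2 = π * b by ring, abs_of_pos (two_pos (α := ℝ))]
    rw [abs_mul, abs_of_pos pi_pos] at this
    have e : 2 / π * (π * |b|) = 2 * |b| := by field_simp
    linarith
  have hb1 := abs_pos.2 hb0
  have h2 : ‖z - 1‖ * ‖∑ d ∈ Icc (-(D : ℤ)) D, z ^ d‖ ≤ 2 := by
    rw [← norm_mul, tel]
    refine (norm_sub_le _ _).trans ?_
    simp [norm_zpow, hz]; norm_num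
  rw [le_div_iff₀ (by positivity)]
  nlinarith [norm_nonneg (∑ d ∈ Icc (-(D : ℤ)) D, z ^ d)]

lemma Kf_bd (D : ℕ) (a : ℝ) (ha : |a| * D ≤ 1 / 2) (ha0 : a ≠ 0) :
    Kf D a ≤ 2 * D + 1 + 1 / |a| * (1 + Real.log D) := by
  have ha1 := abs_pos.2 ha0
  have h : ∀ c ∈ Icc (-(D : ℤ)) D, c ≠ 0 →
      ‖∑ d ∈ Icc (-(D : ℤ)) D, (fourier (d * c) (a : UnitAddCircle) : ℂ)‖ ≤ 1 / (2 * |a|) * (1 / |(c : ℝ)|) := by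
    intro c hc hc0
    have hcD : |(c : ℝ)| ≤ D := by
      rw [abs_le]; have := mem_Icc.1 hc; exact ⟨by exact_mod_cast this.1, by exact_mod_cast this.2⟩
    have := geo_bd D (a * c) (by rw [abs_mul]; nlinarith) (mul_ne_zero ha0 (by exact_mod_cast hc0))
    rw [abs_mul] at this
    refine le_trans (le_of_eq ?_) (this.trans_eq (by field_simp))
    congr 1; refine sum_congr rfl fun d _ => ?_
    rw [fourier_coe_apply, ← Complex.exp_int_mul]; congr 1; push_cast; ring
  have h0 : ‖∑ d ∈ Icc (-(D : ℤ)) D, (fourier (d * 0) (a : UnitAddCircle) : ℂ)‖ ≤ 2 * D + 1 := by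
    refine (norm_sum_le _ _).trans ?_
    simp only [fourier_apply, Circle.norm_coe, sum_const, nsmul_eq_mul, mul_one, Int.card_Icc]
    rw [show ((D : ℤ) + 1 - -D).toNat = 2 * D + 1 by omega]; push_cast; linarith
  have hsp : Icc (-(D : ℤ)) D = insert 0 ((Icc 1 D).image (fun n : ℕ => (n : ℤ)) ∪
      (Icc 1 D).image (fun n : ℕ => -(n : ℤ))) := by
    ext x; simp only [mem_Icc, mem_insert, mem_union, mem_image]
    constructor
    · intro hx
      rcases lt_trichotomy x 0 with h | h | h
      · exact Or.inr (Or.inr ⟨x.natAbs, by omega, by omega⟩)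
      · exact Or.inl h
      · exact Or.inr (Or.inl ⟨x.natAbs, by omega, by omega⟩)
    · rintro (h | ⟨n, h, rfl⟩ | ⟨n, h, rfl⟩) <;> omega
  have hH : ∑ n ∈ Icc 1 D, (1 / (n : ℝ)) ≤ 1 + Real.log D := by
    have := harmonic_le_one_add_log D
    rw [harmonic_eq_sum_Icc] at this
    push_cast at this; simpa using this
  set f : ℤ → ℝ := fun c => ‖∑ d ∈ Icc (-(D : ℤ)) D, (fourier (d * c) (a : UnitAddCircle) : ℂ)‖ with hf
  have key : ∀ g : ℕ → ℤ, (∀ n ∈ Icc 1 D, g n ∈ Icc (-(D : ℤ)) D ∧ g n ≠ 0 ∧ |(g n : ℝ)| = n) →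
      g.Injective → ∑ c ∈ (Icc 1 D).image g, f c ≤ 1 / (2 * |a|) * (1 + Real.log D) := by
    intro g hg hi
    rw [sum_image hi.injOn]
    refine (sum_le_sum fun n hn => ((h _ (hg n hn).1 (hg n hn).2.1).trans_eq (by
      rw [(hg n hn).2.2]))).trans ?_
    rw [← mul_sum]; gcongr
  calc Kf D a = ∑ c ∈ Icc (-(D : ℤ)) D, f c := rfl
    _ = f 0 + ∑ c ∈ (Icc 1 D).image (fun n : ℕ => (n : ℤ)) ∪
      (Icc 1 D).image (fun n : ℕ => -(n : ℤ)), f c := by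
        conv_lhs => rw [hsp]
        rw [sum_insert]; simp
    _ ≤ f 0 + (∑ c ∈ (Icc 1 D).image (fun n : ℕ => (n : ℤ)), f c +
      ∑ c ∈ (Icc 1 D).image (fun n : ℕ => -(n : ℤ)), f c) := by
        gcongr; rw [← sum_union_inter]
        exact le_add_of_nonneg_right (sum_nonneg fun _ _ => norm_nonneg _)
    _ ≤ (2 * D + 1) + (1 / (2 * |a|) * (1 + Real.log D) + 1 / (2 * |a|) * (1 + Real.log D)) := by
        gcongr
        · refine key _ (fun n hn => ?_) Nat.cast_injective
          have := mem_Icc.1 hn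
          exact ⟨mem_Icc.2 (by omega), by omega, by simp⟩
        · refine key _ (fun n hn => ?_) (neg_injective.comp Nat.cast_injective)
          have := mem_Icc.1 hn
          exact ⟨mem_Icc.2 (by omega), by omega, by simp⟩
    _ = _ := by field_simp; ring

end VK

namespace VK
open UnitAddTorus Finset

lemma num2 {l L : ℝ} (h : 10 ^ 12 ≤ l) (h2 : l ^ 2 ≤ L) : 10 ^ 12 * l ≤ L := by nlinarith
lemma num3 {l : ℝ} (h : 10 ^ 12 ≤ l) : 128 * l ^ 2 ≤ 8 * (4 * l + 4) ^ 2 ∧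
    8 * (4 * l + 4) ^ 2 ≤ 130 * l ^ 2 ∧ 10 ^ 12 * l ≤ l ^ 2 := by
  refine ⟨?_, ?_, ?_⟩ <;> nlinarith
lemma num4 {L x : ℝ} (h : L / 4 + 1 ≤ x) (h2 : 10 ^ 12 ≤ L) : 1000 * L ≤ x * x := by nlinarith
lemma num5 {l L x s : ℝ} (h1 : s ≤ 130 * l ^ 2) (h2 : 1000 * L ≤ x) (h3 : l ^ 2 ≤ L)
    (h4 : 10 ^ 12 ≤ l) : s ≤ x * x := by
  have : 10 ^ 12 ≤ L := by nlinarith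
  nlinarith
lemma num6 {l k : ℝ} (h : 10 ^ 12 ≤ l) (h0 : 0 ≤ k) (h1 : k ≤ 5 * l) :
    2 ^ 28 * k ^ 2 ≤ l ^ 3 ∧ 3 * (8 * k ^ 2) ≤ l ^ 3 := by
  have : k ^ 2 ≤ 25 * l ^ 2 := by nlinarith
  have := mul_le_mul_of_nonneg_left h (sq_nonneg l)
  constructor <;> linarith [sq_nonneg l]
lemma num7 {l : ℝ} (h : 10 ^ 12 ≤ l) :
    4 * (4 * l + 4) + (4 * l + 4) ^ 2 / 50 - (l - 2) * (l - 1) ≤ -(0.65 * l ^ 2) := by nlinarith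

set_option maxHeartbeats 1000000 in
lemma Kf_good {l U j s : ℕ} {t x : ℝ} (hl : 10 ^ 12 ≤ l) (hU : (l : ℝ) ^ 2 ≤ Real.log U)
    (ht : (U : ℝ) ^ (4 * l) ≤ t) (ht' : t ≤ (U : ℝ) ^ (4 * l + 4)) (hx : (U : ℝ) ^ 3 ≤ x)
    (hx' : x ≤ 4 * (U : ℝ) ^ 3) (hj : 2 * l + 3 ≤ j) (hj' : j ≤ 3 * l) (hs : s = 8 * (4 * l + 4) ^ 2)
    {a : ℝ} (ha : |a| = t / (2 * π * j * x ^ j)) :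
    Kf (s * U ^ j) a ≤ exp (2 * Real.log (3 * s) + 2 * j * Real.log U - (l - 1) * Real.log U) := by
  have hlR : (10 ^ 12 : ℝ) ≤ l := by exact_mod_cast hl
  have hL : (10 ^ 12 : ℝ) * l ≤ Real.log U := by exact num2 hlR hU
  have hU0 : (0 : ℝ) < U := by
    by_contra h
    have : (U : ℝ) = 0 := le_antisymm (not_lt.1 h) (by positivity)
    rw [this] at hL; simp at hL; linarith
  have hUe : exp (Real.log U) = U := exp_log hU0
  set L := Real.log U
  have hjR : (2 * l + 3 : ℝ) ≤ j := by exact_mod_cast hj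
  have hjR' : (j : ℝ) ≤ 3 * l := by exact_mod_cast hj'
  have hsR : (s : ℝ) = 8 * (4 * l + 4) ^ 2 := by rw [hs]; push_cast; ring
  have hs1 : (128 * l ^ 2 : ℝ) ≤ s := by rw [hsR]; exact (num3 hlR).1
  have hs2 : (s : ℝ) ≤ 130 * l ^ 2 := by rw [hsR]; exact (num3 hlR).2.1
  have hU1 : (1 : ℝ) ≤ U := by rw [← hUe]; exact one_le_exp (by linarith)
  have hU2 : 1000 * L ≤ exp (L / 2) := by
    have := add_one_le_exp (L / 4)
    have e : exp (L / 2) = exp (L / 4) * exp (L / 4) := by rw [← exp_add]; congr 1; ring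
    rw [e]; exact num4 this (by linarith)
  have hpi := pi_gt_three
  have hpi' := pi_lt_d2
  have hx0 : 0 < x := lt_of_lt_of_le (by positivity) hx
  have ht0 : 0 < t := lt_of_lt_of_le (by positivity) ht
  have hj0 : (0 : ℝ) < j := by linarith
  have ha0 : a ≠ 0 := abs_pos.1 (by rw [ha]; positivity)
  have hsU : (s : ℝ) ≤ U := by
    have : (U : ℝ) = exp (L / 2) * exp (L / 2) := by rw [← exp_add, ← hUe]; congr 1; ring
    rw [this]; exact num5 hs2 hU2 hU hlR
  have hD : |a| * (s * U ^ j : ℕ) ≤ 1 / 2 := by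
    rw [ha]; push_cast
    rw [div_mul_eq_mul_div, div_le_iff₀ (by positivity)]
    have h1 : (U : ℝ) ^ 3 ^ 1 = U ^ 3 := by norm_num
    calc t * (s * U ^ j) ≤ U ^ (4 * l + 4) * (U * U ^ j) := by gcongr
      _ = U ^ (4 * l + 4 + 1 + j) := by ring
      _ ≤ U ^ (3 * j) := pow_le_pow_right₀ hU1 (by omega)
      _ = (U ^ 3) ^ j := by rw [pow_mul]
      _ ≤ x ^ j := by gcongr
      _ ≤ 1 / 2 * (2 * π * j * x ^ j) := by
          have : 1 ≤ π * j := by exact one_le_mul_of_one_le_of_one_le (by linarith) (by linarith)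
          linarith [mul_le_mul_of_nonneg_right this (pow_pos hx0 j).le]
  refine (Kf_bd _ a hD ha0).trans ?_
  have hE : exp (2 * Real.log (3 * s) + 2 * j * L - (l - 1) * L) = (3 * s) ^ 2 * exp ((2 * j - (l - 1)) * L) := by
    rw [show 2 * Real.log (3 * s) + 2 * j * L - (l - 1) * L =
      Real.log (3 * s) + Real.log (3 * s) + (2 * j - (l - 1)) * L by ring, exp_add, exp_add,
      exp_log (by linarith [(num3 hlR).2.2])]; ring
  rw [hE]
  have hs0 : (3 : ℝ) ≤ s := by linarith [(num3 hlR).2.2]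
  have p1 : 2 * ((s * U ^ j : ℕ) : ℝ) + 1 ≤ s ^ 2 * exp ((2 * j - (l - 1)) * L) := by
    have : (U : ℝ) ^ j = exp (j * L) := by rw [exp_nat_mul, hUe]
    have h2 : exp (j * L) ≤ exp ((2 * j - (l - 1)) * L) := exp_le_exp.2 (by
      gcongr; linarith)
    have h3 : 1 ≤ exp (j * L) := one_le_exp (by positivity)
    push_cast; rw [this]
    calc 2 * (s * exp (j * L)) + 1 ≤ 3 * s * exp (j * L) := by
          linarith [one_le_mul_of_one_le_of_one_le (show (1 : ℝ) ≤ s by linarith) h3]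
      _ ≤ s ^ 2 * exp (j * L) := by rw [pow_two]; gcongr
      _ ≤ _ := by gcongr
  have p2 : 1 / |a| * (1 + Real.log ((s * U ^ j : ℕ) : ℝ)) ≤
      s ^ 2 * exp ((2 * j - (l - 1)) * L) := by
    have hlog : 1 + Real.log ((s * U ^ j : ℕ) : ℝ) ≤ s * (L * 2) := by
      push_cast
      rw [Real.log_mul (by positivity) (by positivity), Real.log_pow]
      have := Real.log_le_sub_one_of_pos (show (0 : ℝ) < s by linarith)
      change 1 + (Real.log s + j * L) ≤ _
      have h1 : (j : ℝ) ≤ s := by linarith [(num3 hlR).2.2]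
      have h2 : (1 : ℝ) ≤ L := by linarith
      linarith [mul_le_mul_of_nonneg_right h1 (show 0 ≤ L by linarith), mul_le_mul_of_nonneg_left h2 (show (0 : ℝ) ≤ s by linarith)]
    have h1a : 1 / |a| ≤ 7 * j * exp (5 * l) * exp ((3 * j - 4 * l) * L) := by
      rw [ha, one_div_div, div_le_iff₀ ht0]
      have h4 : (4 : ℝ) ^ j ≤ exp (5 * l) := by
        calc (4 : ℝ) ^ j ≤ 4 ^ (3 * l) := pow_le_pow_right₀ (by norm_num) hj'
          _ = 64 ^ l := by rw [pow_mul]; norm_num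
          _ ≤ (exp 1 ^ 5) ^ l := by
              gcongr
              have := exp_one_gt_d9
              calc (64 : ℝ) ≤ 2.7 ^ 5 := by norm_num
                _ ≤ _ := by gcongr; linarith
          _ = exp (5 * l) := by rw [← pow_mul, ← exp_nat_mul]; push_cast; ring_nf
      have hxj : x ^ j ≤ exp (5 * l) * exp (3 * j * L) := by
        calc x ^ j ≤ (4 * U ^ 3) ^ j := by gcongr
          _ = 4 ^ j * exp (3 * j * L) := by
              rw [mul_pow, ← hUe, ← exp_nat_mul, ← exp_nat_mul]; push_cast; ring_nf
          _ ≤ _ := by gcongr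
      have htl : exp (4 * l * L) ≤ t := by
        refine le_trans (le_of_eq ?_) ht
        rw [← hUe, ← exp_nat_mul]; push_cast; ring_nf
      calc 2 * π * j * x ^ j ≤ 7 * j * (exp (5 * l) * exp (3 * j * L)) := by
            gcongr; linarith
        _ = 7 * j * exp (5 * l) * exp ((3 * j - 4 * l) * L) * exp (4 * l * L) := by
            rw [show exp (3 * j * L) = exp ((3 * j - 4 * l) * L) * exp (4 * l * L) by
              rw [← exp_add]; ring_nf]
            ring
        _ ≤ _ := by gcongr
    calc _ ≤ 7 * j * exp (5 * l) * exp ((3 * j - 4 * l) * L) * (s * (L * 2)) := by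
          gcongr
      _ ≤ 7 * s * exp (L / 2) * exp ((2 * j - l) * L) * (s * (exp (L / 2) / 7)) := by
          have f1 : (j : ℝ) ≤ s := by linarith [(num3 hlR).2.2]
          have f2 : exp (5 * l) ≤ exp (L / 2) := exp_le_exp.2 (by linarith)
          have f3 : exp ((3 * j - 4 * l) * L) ≤ exp ((2 * j - l) * L) :=
            exp_le_exp.2 (mul_le_mul_of_nonneg_right (by linarith) (by linarith))
          have f4 : L * 2 ≤ exp (L / 2) / 7 := by linarith
          gcongr
      _ = s ^ 2 * (exp (L / 2) * exp ((2 * j - l) * L) * exp (L / 2)) := by ring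
      _ = _ := by rw [← exp_add, ← exp_add]; ring_nf
  linarith [mul_nonneg (sq_nonneg (s : ℝ)) (exp_pos ((2 * j - (l - 1)) * L)).le]

lemma num1 {l q L A B : ℝ} (a1 : A ≤ (14 * (65 * l ^ 3)) * (6 * q)) (a2 : B ≤ 2 * (5 * l) * (6 * q))
    (a3 : l ^ 2 * l ^ 2 ≤ l ^ 2 * L) (a4 : l ^ 3 * q * 10 ^ 6 ≤ l ^ 2 * l ^ 2)
    (a5 : l * q ≤ l ^ 3 * q) : A + B ≤ l ^ 2 * L / 10 := by
  linarith [sq_nonneg (l ^ 2)]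

set_option maxHeartbeats 1000000 in
lemma poly_sum {l U k : ℕ} {t x : ℝ} (hl : 10 ^ 12 ≤ l) (hU : (l : ℝ) ^ 2 ≤ Real.log U)
    (ht : (U : ℝ) ^ (4 * l) ≤ t) (ht' : t ≤ (U : ℝ) ^ (4 * l + 4)) (hx : (U : ℝ) ^ 3 ≤ x)
    (hx' : x ≤ 4 * (U : ℝ) ^ 3) (hk : k = 4 * l + 4) (α : Fin k → ℝ)
    (hα : ∀ j : Fin k, |α j| = t / (2 * π * (j + 1 : ℕ) * x ^ ((j : ℕ) + 1))) :
    ‖∑ u ∈ Icc (1 : ℤ) U, ∑ v ∈ Icc (1 : ℤ) U, ec (pw k u * pw k v)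
      (fun j => (α j : UnitAddCircle))‖ ≤ exp ((2 - 1 / 1000000 / l ^ 2) * Real.log U) := by
  set s := 8 * k ^ 2 with hs
  have hlR : (10 ^ 12 : ℝ) ≤ l := by exact_mod_cast hl
  have hL : (10 ^ 12 : ℝ) * l ≤ Real.log U := by exact num2 hlR hU
  have hU0 : (0 : ℝ) < U := by
    by_contra h
    have : (U : ℝ) = 0 := le_antisymm (not_lt.1 h) (by positivity)
    rw [this] at hL; simp at hL; linarith
  have hUe : exp (Real.log U) = U := exp_log hU0
  have hU1 : 1 ≤ U := by exact_mod_cast hU0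
  have hkR : (k : ℝ) = 4 * l + 4 := by rw [hk]; push_cast; ring
  have hsR : (s : ℝ) = 8 * k ^ 2 := by rw [hs]; push_cast; ring
  have hk0 : (0 : ℝ) < k := by linarith
  have hk1' : (1 : ℝ) ≤ k := by linarith
  have hsp : 0 < s := by rw [hs]; have : 0 < k := by omega
                         positivity
  have hprod : ∏ j : Fin k, Kf (s * U ^ ((j : ℕ) + 1)) (α j) ≤
      exp (2 * k * Real.log (3 * s) + k * (k + 1) * Real.log U - (l - 2) * (l - 1) * Real.log U) := by
    have h1 : ∀ j : Fin k, Kf (s * U ^ ((j : ℕ) + 1)) (α j) ≤ exp (2 * Real.log (3 * s) +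
        2 * (j + 1 : ℕ) * Real.log U - if (j : ℕ) ∈ Ico (2 * l + 2) (3 * l) then (l - 1) * Real.log U else 0) := by
      intro j
      split_ifs with h
      · rw [mem_Ico] at h
        exact Kf_good hl hU ht ht' hx hx' (by omega) (by omega) (by rw [hs, hk]) (hα j)
      · refine (Kf_triv _ _).trans ?_
        rw [sub_zero, exp_add, two_mul (Real.log _), exp_add (Real.log _), exp_log (by rw [hsR]; positivity),
          show 2 * ((j + 1 : ℕ) : ℝ) * Real.log U = (2 * (j + 1) : ℕ) * Real.log U by push_cast; ring,
          exp_nat_mul, hUe, mul_comm 2 ((j : ℕ) + 1), pow_mul]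
        push_cast
        have : (1 : ℝ) ≤ s * U ^ ((j : ℕ) + 1) := by
          rw [← Nat.cast_pow, ← Nat.cast_mul]; exact_mod_cast Nat.mul_pos hsp (by positivity)
        have h9 := mul_le_mul_of_nonneg_left this (zero_le_one.trans this)
        linarith
    refine (prod_le_prod (fun j _ => sum_nonneg fun _ _ => norm_nonneg _) fun j _ => h1 j).trans ?_
    rw [← exp_sum, sum_sub_distrib, sum_add_distrib]
    refine exp_le_exp.2 (le_of_eq ?_)
    congr 1
    · congr 1
      · simp; ring
      · rw [← sum_mul, ← mul_sum, Fin.sum_univ_eq_sum_range (fun j => ((j + 1 : ℕ) : ℝ)) k]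
        congr 1
        have : ∀ n : ℕ, 2 * ∑ j ∈ range n, ((j + 1 : ℕ) : ℝ) = n * (n + 1) := by
          intro n
          induction n with
          | zero => simp
          | succ n ih => rw [sum_range_succ, mul_add, ih]; push_cast; ring
        exact this k
    · rw [Fin.sum_univ_eq_sum_range (fun j => if j ∈ Ico (2 * l + 2) (3 * l) then ((l : ℝ) - 1) *
        Real.log U else 0) k, sum_ite_mem, inter_eq_right.2, sum_const, Nat.card_Ico, nsmul_eq_mul,
        show 3 * l - (2 * l + 2) = l - 2 by omega, Nat.cast_sub (by omega)]
      · push_cast; ring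
      · intro i hi; rw [mem_Ico] at hi; exact mem_range.2 (by omega)
  have hJ := vmvt (k := k) (X := U) (by omega) hU1
  have hJe : (J k s U : ℝ) ≤ exp (7 * k ^ 3 * Real.log (2 ^ 28 * k ^ 2) +
      (2 * s - k * (k + 1) / 2 + (2 * k + k ^ 2 / 100)) * Real.log U) := by
    refine hJ.trans (le_of_eq ?_)
    rw [exp_add, show (7 * k ^ 3 * Real.log (2 ^ 28 * k ^ 2) : ℝ) = (7 * k ^ 3 : ℕ) *
      Real.log (2 ^ 28 * k ^ 2) by push_cast; ring, exp_nat_mul, exp_log (by positivity),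
      rpow_def_of_pos hU0, hsR]
    congr 2; ring
  have hb := bilin k s U hsp α
  set T := ‖∑ u ∈ Icc (1 : ℤ) U, ∑ v ∈ Icc (1 : ℤ) U, ec (pw k u * pw k v)
      (fun j => (α j : UnitAddCircle))‖
  set L := Real.log U
  have hlog : Real.log (2 ^ 28 * k ^ 2) ≤ 6 * √l ∧ Real.log (3 * s) ≤ 6 * √l := by
    have h3 : Real.log ((l : ℝ) ^ 3) ≤ 6 * √l := by
      rw [Real.log_pow, ← sq_sqrt (show (0 : ℝ) ≤ l by positivity), Real.log_pow, sqrt_sq (by positivity)]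
      have := Real.log_le_self (sqrt_nonneg (l : ℝ))
      push_cast; linarith
    have hk5 : (k : ℝ) ≤ 5 * l := by linarith
    constructor
    on_goal 1 => refine le_trans (Real.log_le_log (by positivity) ?_) h3
    on_goal 2 => refine le_trans (Real.log_le_log (by rw [hsR]; positivity) ?_) h3
    · exact (num6 hlR hk0.le hk5).1
    · rw [hsR]; exact (num6 hlR hk0.le hk5).2
  have hq : √(l : ℝ) * 10 ^ 6 ≤ l := by
    have : (10 : ℝ) ^ 6 ≤ √l := by
      rw [show (10 : ℝ) ^ 6 = √(10 ^ 12) by rw [show (10 : ℝ) ^ 12 = (10 ^ 6) ^ 2 by norm_num, sqrt_sq (by norm_num)]]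
      exact sqrt_le_sqrt hlR
    linarith [mul_self_sqrt (show (0 : ℝ) ≤ l by positivity), mul_le_mul_of_nonneg_left this (sqrt_nonneg (l : ℝ))]
  have hl0 : (0 : ℝ) < l := by linarith
  have hk1 : (k : ℝ) ≤ 4.0001 * l := by linarith
  have hk3 : (k : ℝ) ^ 3 ≤ 65 * l ^ 3 := by
    calc (k : ℝ) ^ 3 ≤ (4.0001 * l) ^ 3 := by gcongr
      _ ≤ _ := by rw [mul_pow]; gcongr; norm_num
  have hmain : (14 * k ^ 3) * Real.log (2 ^ 28 * k ^ 2) + 2 * k * Real.log (3 * s) ≤ l ^ 2 * L / 10 := by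
    have a1 : (14 * k ^ 3) * Real.log (2 ^ 28 * k ^ 2) ≤ (14 * (65 * l ^ 3)) * (6 * √l) := by
      have := hlog.1
      have h0 : 0 ≤ Real.log (2 ^ 28 * k ^ 2) := Real.log_nonneg (by linarith [one_le_pow₀ hk1' (n := 2)])
      gcongr
    have a2 : 2 * k * Real.log (3 * s) ≤ 2 * (5 * l) * (6 * √l) := by
      have h0 : 0 ≤ Real.log (3 * s) := Real.log_nonneg (by rw [hsR]; linarith [one_le_pow₀ hk1' (n := 2)])
      gcongr
      · linarith
      · exact hlog.2
    have a3 : (l : ℝ) ^ 2 * l ^ 2 ≤ l ^ 2 * L := by gcongr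
    have a4 : (l : ℝ) ^ 3 * √l * 10 ^ 6 ≤ l ^ 2 * l ^ 2 := by
      have := mul_le_mul_of_nonneg_left hq (show (0 : ℝ) ≤ (l : ℝ) ^ 3 by positivity)
      linarith
    have a5 : (l : ℝ) * √l ≤ l ^ 3 * √l := by
      gcongr; exact le_self_pow₀ (by linarith) (by norm_num)
    exact num1 a1 a2 a3 a4 a5
  have hTe : T ^ (4 * s ^ 2) ≤ exp ((8 * s ^ 2 - l ^ 2 / 2) * L) := by
    calc T ^ (4 * s ^ 2) ≤ _ := hb
      _ ≤ exp ((4 * s * (2 * s - 1)) * L) * exp (7 * k ^ 3 * Real.log (2 ^ 28 * k ^ 2) +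
        (2 * s - k * (k + 1) / 2 + (2 * k + k ^ 2 / 100)) * L) ^ 2 *
        exp (2 * k * Real.log (3 * s) + k * (k + 1) * L - (l - 2) * (l - 1) * L) := by
          gcongr
          · exact prod_nonneg fun _ _ => sum_nonneg fun _ _ => norm_nonneg _
          · rw [← hUe, ← exp_nat_mul]
            refine exp_le_exp.2 (le_of_eq ?_)
            push_cast [Nat.cast_sub (show 1 ≤ 2 * s by omega)]; ring
      _ ≤ _ := by
          rw [← exp_nat_mul, ← exp_add, ← exp_add]
          refine exp_le_exp.2 ?_
          have e : 4 * k + k ^ 2 / 50 - (l - 2) * (l - 1) ≤ -(0.65 * l ^ 2 : ℝ) := by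
            rw [hkR]; exact num7 hlR
          have e2 := mul_le_mul_of_nonneg_right e (show 0 ≤ L by linarith)
          push_cast
          linarith [mul_nonneg (sq_nonneg (l : ℝ)) (show 0 ≤ L by linarith)]
  have hs0 : (0 : ℝ) < s := by rw [hsR]; positivity
  refine le_of_pow_le_pow_left₀ (n := 4 * s ^ 2) (by have : s ≠ 0 := by exact_mod_cast hs0.ne'
                                                     positivity) (exp_pos _).le (hTe.trans ?_)
  rw [← exp_nat_mul]
  refine exp_le_exp.2 ?_
  rw [← mul_assoc]
  gcongr
  push_cast
  have : (s : ℝ) ^ 2 ≤ 20000 * l ^ 4 := by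
    have : (s : ℝ) ≤ 130 * l ^ 2 := by rw [hsR, hkR]; exact (num3 hlR).2.1
    calc (s : ℝ) ^ 2 ≤ (130 * l ^ 2) ^ 2 := by gcongr
      _ ≤ _ := by linarith [pow_pos hl0 4]
  have e3 : 4 * s ^ 2 * (1 / 1000000 / l ^ 2) ≤ (l : ℝ) ^ 2 / 2 := by
    rw [div_div, mul_one_div, div_le_iff₀ (by positivity)]
    linarith [pow_pos hl0 4]
  linarith

end VK

namespace VK
open UnitAddTorus Finset

/-- `e^{iθ}` -/
noncomputable def ei (θ : ℝ) : ℂ := Complex.exp (θ * Complex.I)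
lemma ei_norm (θ : ℝ) : ‖ei θ‖ = 1 := Complex.norm_exp_ofReal_mul_I θ
lemma ei_add (a b : ℝ) : ei (a + b) = ei a * ei b := by
  simp only [ei]; rw [← Complex.exp_add]; congr 1; push_cast; ring
lemma ei_sub_le (a b : ℝ) : ‖ei a - ei b‖ ≤ |a - b| := by
  have : ei a - ei b = ei b * (Complex.exp (Complex.I * (a - b : ℝ)) - 1) := by
    rw [show a = b + (a - b) by ring, ei_add]; simp only [ei]; push_cast; ring_nf
  rw [this, norm_mul, ei_norm, one_mul]
  exact Real.norm_exp_I_mul_ofReal_sub_one_le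

lemma ei_ec {k : ℕ} (α : Fin k → ℝ) (n : Fin k → ℤ) :
    ec n (fun j => (α j : UnitAddCircle)) = ei (∑ j, 2 * π * α j * n j) := by
  simp only [ec, mFourier, ContinuousMap.coe_mk, fourier_coe_apply, ei]
  rw [← Complex.exp_sum]; congr 1; push_cast; rw [sum_mul]
  refine sum_congr rfl fun j _ => ?_
  simp; ring

lemma bil_log {l U : ℕ} {t x : ℝ} (hl : 10 ^ 12 ≤ l) (hU : (l : ℝ) ^ 2 ≤ Real.log U)
    (ht : (U : ℝ) ^ (4 * l) ≤ t) (ht' : t ≤ (U : ℝ) ^ (4 * l + 4)) (hx : (U : ℝ) ^ 3 ≤ x)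
    (hx' : x ≤ 4 * (U : ℝ) ^ 3) :
    ‖∑ u ∈ Icc (1 : ℤ) U, ∑ v ∈ Icc (1 : ℤ) U, ei (t * Real.log (x + u * v))‖ ≤
      3 * U ^ 2 * exp (-(1 / 1000000) * (Real.log U / l ^ 2)) := by
  have hlR : (10 ^ 12 : ℝ) ≤ l := by exact_mod_cast hl
  have hL : (10 ^ 12 : ℝ) * l ≤ Real.log U := num2 hlR hU
  have hU0 : (0 : ℝ) < U := by
    by_contra h
    have : (U : ℝ) = 0 := le_antisymm (not_lt.1 h) (by positivity)
    rw [this] at hL; simp at hL; linarith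
  have hUe : exp (Real.log U) = U := exp_log hU0
  have hU2 : (2 : ℝ) ≤ U := by rw [← hUe]; linarith [add_one_le_exp (Real.log U)]
  have hx0 : 0 < x := lt_of_lt_of_le (by positivity) hx
  have ht0 : 0 < t := lt_of_lt_of_le (by positivity) ht
  obtain ⟨k, hk⟩ : ∃ k, k = 4 * l + 4 := ⟨_, rfl⟩
  set α : Fin k → ℝ := fun j => t * (-1) ^ (j : ℕ) / (2 * π * (j + 1 : ℕ) * x ^ ((j : ℕ) + 1)) with hα
  have hp := poly_sum hl hU ht ht' hx hx' hk α (fun j => by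
    simp only [hα]; rw [abs_div, abs_mul, abs_pow]
    simp only [abs_neg, abs_one, one_pow, mul_one]
    rw [abs_of_pos ht0, abs_of_pos]; positivity)
  have hterm : ∀ u ∈ Icc (1 : ℤ) U, ∀ v ∈ Icc (1 : ℤ) U,
      ‖ei (t * Real.log (x + u * v)) - ei (t * Real.log x) *
        ec (pw k u * pw k v) (fun j => (α j : UnitAddCircle))‖ ≤ 2 / U := by
    intro u hu v hv
    rw [mem_Icc] at hu hv
    have hu1 : (1 : ℝ) ≤ u := by exact_mod_cast hu.1
    have hv1 : (1 : ℝ) ≤ v := by exact_mod_cast hv.1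
    have hu2 : (u : ℝ) ≤ U := by exact_mod_cast hu.2
    have hv2 : (v : ℝ) ≤ U := by exact_mod_cast hv.2
    rw [ei_ec, ← ei_add]
    refine (ei_sub_le _ _).trans ?_
    set w := (u * v : ℝ) / x with hw
    have hw0 : 0 ≤ w := by positivity
    have hwU : w ≤ 1 / U := by
      rw [hw, div_le_div_iff₀ hx0 hU0]
      calc (u * v * U : ℝ) ≤ U * U * U := by gcongr
        _ ≤ 1 * x := by linarith
    have hw1 : w ≤ 1 / 2 := hwU.trans (by gcongr)
    have hlogx : Real.log (x + u * v) = Real.log x + Real.log (1 + w) := by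
      rw [← Real.log_mul hx0.ne' (by positivity), hw]; congr 1; field_simp
    have htay := Real.abs_log_sub_add_sum_range_le (x := -w) (by rw [abs_neg, abs_of_nonneg hw0]; linarith) k
    rw [sub_neg_eq_add, abs_neg, abs_of_nonneg hw0] at htay
    have hsum : ∑ j : Fin k, 2 * π * α j * ((pw k u * pw k v) j : ℤ) =
        -(t * ∑ i ∈ range k, (-w) ^ (i + 1) / (i + 1)) := by
      refine (Fin.sum_univ_eq_sum_range (fun j : ℕ => 2 * π * (t * (-1) ^ j / (2 * π * (j + 1 : ℕ) * x ^ (j + 1)))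
        * (((u ^ (j + 1) * v ^ (j + 1) : ℤ)) : ℝ)) k).trans ?_
      rw [mul_sum, ← sum_neg_distrib]
      refine sum_congr rfl fun j _ => ?_
      rw [hw, neg_pow (_ / x) (j + 1), div_pow, mul_pow]; push_cast
      field_simp; ring
    rw [hsum, hlogx]
    rw [show t * (Real.log x + Real.log (1 + w)) - (t * Real.log x + -(t * ∑ i ∈ range k, (-w) ^ (i + 1) / (i + 1)))
      = t * (∑ i ∈ range k, (-w) ^ (i + 1) / (i + 1) + Real.log (1 + w)) by ring, abs_mul, abs_of_pos ht0]
    calc t * _ ≤ U ^ k * (w ^ (k + 1) / (1 - w)) := by rw [hk] at htay ⊢; gcongr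
      _ ≤ U ^ k * ((1 / U) ^ (k + 1) / (1 / 2)) := by
          gcongr; linarith
      _ = 2 / U := by rw [div_pow, one_pow, pow_succ]; field_simp
  have hc : ∀ c : ℝ, ∑ u ∈ Icc (1 : ℤ) U, ∑ v ∈ Icc (1 : ℤ) U, c = U ^ 2 * c := by
    intro c; simp; ring
  have hd : ‖∑ u ∈ Icc (1 : ℤ) U, ∑ v ∈ Icc (1 : ℤ) U, ei (t * Real.log (x + u * v)) - ei (t * Real.log x) *
      ∑ u ∈ Icc (1 : ℤ) U, ∑ v ∈ Icc (1 : ℤ) U, ec (pw k u * pw k v) (fun j => (α j : UnitAddCircle))‖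
      ≤ U ^ 2 * (2 / U) := by
    simp_rw [mul_sum]
    rw [← sum_sub_distrib, ← hc]
    refine (norm_sum_le _ _).trans (sum_le_sum fun u hu => ?_)
    rw [← sum_sub_distrib]
    exact (norm_sum_le _ _).trans (sum_le_sum fun v hv => hterm u hu v hv)
  set S := ∑ u ∈ Icc (1 : ℤ) U, ∑ v ∈ Icc (1 : ℤ) U, ec (pw k u * pw k v) (fun j => (α j : UnitAddCircle))
  have h1 := norm_sub_norm_le (∑ u ∈ Icc (1 : ℤ) U, ∑ v ∈ Icc (1 : ℤ) U, ei (t * Real.log (x + u * v)))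
    (ei (t * Real.log x) * S)
  rw [norm_mul, ei_norm, one_mul] at h1
  have e1 : exp ((2 - 1 / 1000000 / l ^ 2) * Real.log U) =
      U ^ 2 * exp (-(1 / 1000000) * (Real.log U / l ^ 2)) := by
    rw [← hUe, ← exp_nat_mul, ← exp_add, hUe]; congr 1; push_cast; ring
  have e2 : 2 / (U : ℝ) ≤ 2 * exp (-(1 / 1000000) * (Real.log U / l ^ 2)) := by
    rw [div_eq_mul_inv, ← hUe, ← exp_neg, hUe]; gcongr
    have : Real.log U / l ^ 2 ≤ Real.log U := div_le_self (by linarith) (one_le_pow₀ (by linarith))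
    have : 0 ≤ Real.log U / l ^ 2 := div_nonneg (by linarith) (by positivity)
    linarith
  rw [e1] at hp
  have := mul_le_mul_of_nonneg_left e2 (sq_nonneg (U : ℝ))
  linarith

/-- The main exponential sum bound. -/
lemma expsum {l U N N' : ℕ} {t : ℝ} (hl : 10 ^ 12 ≤ l) (hU : (l : ℝ) ^ 2 ≤ Real.log U)
    (ht : (U : ℝ) ^ (4 * l) ≤ t) (ht' : t ≤ (U : ℝ) ^ (4 * l + 4)) (hN : U ^ 3 ≤ N)
    (hN' : N' ≤ 2 * N) :
    ‖∑ n ∈ Ioc N N', ei (t * Real.log n)‖ ≤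
      5 * N * exp (-(1 / 1000000) * (Real.log U / l ^ 2)) := by
  have hlR : (10 ^ 12 : ℝ) ≤ l := by exact_mod_cast hl
  have hL : (10 ^ 12 : ℝ) * l ≤ Real.log U := num2 hlR hU
  have hU0 : (0 : ℝ) < U := by
    by_contra h
    have : (U : ℝ) = 0 := le_antisymm (not_lt.1 h) (by positivity)
    rw [this] at hL; simp at hL; linarith
  have hU0' : 0 < U := by exact_mod_cast hU0
  have hUe : exp (Real.log U) = U := exp_log hU0
  set E := exp (-(1 / 1000000) * (Real.log U / l ^ 2)) with hE
  have e2 : 1 / (U : ℝ) ≤ E := by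
    rw [one_div, hE, ← hUe, ← exp_neg, hUe]; gcongr
    have : Real.log U / l ^ 2 ≤ Real.log U := div_le_self (by linarith) (one_le_pow₀ (by linarith))
    have : 0 ≤ Real.log U / l ^ 2 := div_nonneg (by linarith) (by positivity)
    linarith
  set q := N / U ^ 3 with hq
  have hq1 : 1 ≤ q := (Nat.one_le_div_iff (by positivity)).2 hN
  have hqN : q * U ^ 3 ≤ N := Nat.div_mul_le_self _ _
  have hqN' : N ≤ 2 * q * U ^ 3 := by
    have : N < (q + 1) * U ^ 3 := (Nat.div_lt_iff_lt_mul (by positivity)).1 (Nat.lt_succ_self _)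
    have h2 : (q + 1) * U ^ 3 ≤ 2 * q * U ^ 3 := Nat.mul_le_mul_right _ (by omega)
    omega
  have hq0 : (0 : ℝ) < q := by exact_mod_cast hq1
  set f : ℕ → ℂ := fun n => ei (t * Real.log n) with hf
  have hf1 : ∀ n, ‖f n‖ = 1 := fun n => ei_norm _
  have hinner : ∀ n ∈ Ioc N N', ‖∑ u ∈ Icc 1 U, ∑ v ∈ Icc 1 U, f (n + q * (u * v))‖ ≤ 3 * U ^ 2 * E := by
    intro n hn
    rw [mem_Ioc] at hn
    have h := bil_log (x := n / q) hl hU ht ht' (by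
      rw [le_div_iff₀ hq0, mul_comm]; exact_mod_cast hqN.trans hn.1.le) (by
      rw [div_le_iff₀ hq0]
      have : n ≤ 4 * U ^ 3 * q := by nlinarith
      exact_mod_cast this)
    refine le_trans (le_of_eq ?_) h
    have him : Icc (1 : ℤ) U = (Icc 1 U).image (fun n : ℕ => (n : ℤ)) := by
      ext x; simp only [mem_Icc, mem_image]
      exact ⟨fun h => ⟨x.toNat, by omega, by omega⟩, by rintro ⟨n, h, rfl⟩; omega⟩
    rw [him]
    simp_rw [sum_image Nat.cast_injective.injOn]
    suffices he : ∑ u ∈ Icc 1 U, ∑ v ∈ Icc 1 U, f (n + q * (u * v)) = ei (t * Real.log q) *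
        ∑ u ∈ Icc 1 U, ∑ v ∈ Icc 1 U, ei (t * Real.log (n / q + ((u : ℤ) : ℝ) * ((v : ℤ) : ℝ))) by
      rw [he, norm_mul, ei_norm, one_mul]
    simp_rw [mul_sum, ← ei_add]
    refine sum_congr rfl fun u _ => sum_congr rfl fun v _ => ?_
    rw [← mul_add, ← Real.log_mul hq0.ne' (by
      have : (0 : ℝ) < n := by exact_mod_cast (by omega : 0 < n)
      positivity)]
    simp only [hf]; push_cast; congr 3; field_simp
  have hshift : ∀ h : ℕ, ‖∑ n ∈ Ioc N N', f n - ∑ n ∈ Ioc N N', f (n + h)‖ ≤ 2 * h := by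
    intro h
    rw [show ∑ n ∈ Ioc N N', f (n + h) = ∑ n ∈ Ioc (N + h) (N' + h), f n by
      rw [← map_add_right_Ioc, sum_map]; rfl]
    rw [← sum_sdiff_sub_sum_sdiff]
    refine (norm_sub_le _ _).trans ?_
    have b : ∀ A : Finset ℕ, #A ≤ h → ‖∑ n ∈ A, f n‖ ≤ h := fun A hA => by
      refine (norm_sum_le _ _).trans ?_
      simp only [hf1, sum_const, nsmul_eq_mul, mul_one]; exact_mod_cast hA
    have c1 : #(Ioc N N' \ Ioc (N + h) (N' + h)) ≤ h := by
      refine (card_le_card (t := Ioc N (N + h)) fun x hx => ?_).trans (by simp)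
      simp only [Finset.mem_sdiff, mem_Ioc] at hx ⊢; omega
    have c2 : #(Ioc (N + h) (N' + h) \ Ioc N N') ≤ h := by
      refine (card_le_card (t := Ioc N' (N' + h)) fun x hx => ?_).trans (by simp)
      simp only [Finset.mem_sdiff, mem_Ioc] at hx ⊢; omega
    linarith [b _ c1, b _ c2]
  have hc : ∀ c : ℝ, ∑ u ∈ Icc 1 U, ∑ v ∈ Icc 1 U, c = U ^ 2 * c := by
    intro c; simp; ring
  set S := ∑ n ∈ Ioc N N', f n
  have hd : ‖(U : ℂ) ^ 2 * S - ∑ n ∈ Ioc N N', ∑ u ∈ Icc 1 U, ∑ v ∈ Icc 1 U, f (n + q * (u * v))‖ ≤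
      U ^ 2 * (2 * (N / U)) := by
    have : (U : ℂ) ^ 2 * S = ∑ u ∈ Icc 1 U, ∑ v ∈ Icc 1 U, S := by simp; ring
    rw [this, sum_comm]
    simp_rw [sum_comm (s := Ioc N N')]
    rw [← sum_sub_distrib, ← hc]
    refine (norm_sum_le _ _).trans (sum_le_sum fun u hu => ?_)
    rw [← sum_sub_distrib]
    refine (norm_sum_le _ _).trans (sum_le_sum fun v hv => (hshift _).trans ?_)
    gcongr
    rw [le_div_iff₀ hU0]
    have hu := (mem_Icc.1 hu).2
    have hv := (mem_Icc.1 hv).2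
    have : q * (u * v) * U ≤ N := by
      calc q * (u * v) * U ≤ q * (U * U) * U := by gcongr
        _ = q * U ^ 3 := by ring
        _ ≤ N := hqN
    exact_mod_cast this
  have hb : ‖∑ n ∈ Ioc N N', ∑ u ∈ Icc 1 U, ∑ v ∈ Icc 1 U, f (n + q * (u * v))‖ ≤ N * (3 * U ^ 2 * E) := by
    refine (norm_sum_le _ _).trans ((sum_le_card_nsmul _ _ _ hinner).trans ?_)
    rw [nsmul_eq_mul, Nat.card_Ioc]
    gcongr
    omega
  have h1 := norm_sub_norm_le ((U : ℂ) ^ 2 * S)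
    (∑ n ∈ Ioc N N', ∑ u ∈ Icc 1 U, ∑ v ∈ Icc 1 U, f (n + q * (u * v)))
  rw [norm_mul, norm_pow, Complex.norm_natCast] at h1
  have hNE : (N : ℝ) / U ≤ N * E := by rw [div_eq_mul_one_div]; gcongr
  refine le_of_mul_le_mul_left ?_ (show (0 : ℝ) < U ^ 2 by positivity)
  have := mul_le_mul_of_nonneg_left hNE (sq_nonneg (U : ℝ))
  linarith

end VK

namespace VK
open UnitAddTorus Finset

/-- The tail integral of the fractional part. -/
noncomputable def Hz (N : ℝ) (s : ℂ) : ℂ :=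
  ∫ x in Set.Ioi N, ((Int.fract x : ℝ) : ℂ) * (x : ℂ) ^ (-(s + 1))

lemma cpow_int {N : ℝ} (hN : 1 ≤ N) {s : ℂ} (hs : 0 < s.re) :
    IntegrableOn (fun x : ℝ => (x : ℂ) ^ (-(s + 1))) (Set.Ioi N) :=
  integrableOn_Ioi_cpow_of_lt (by simp; linarith) (by linarith)

lemma fract_int {N : ℝ} (hN : 1 ≤ N) {s : ℂ} (hs : 0 < s.re) :
    IntegrableOn (fun x : ℝ => ((Int.fract x : ℝ) : ℂ) * (x : ℂ) ^ (-(s + 1))) (Set.Ioi N) := by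
  refine (cpow_int hN hs).bdd_mul (c := 1) ?_ ?_
  · exact (Complex.measurable_ofReal.comp measurable_fract).aestronglyMeasurable
  · filter_upwards with x
    rw [Complex.norm_real, Real.norm_of_nonneg (Int.fract_nonneg _)]; exact (Int.fract_lt_one _).le

lemma Hz_norm {N : ℝ} (hN : 1 ≤ N) {s : ℂ} (hs : 0 < s.re) : ‖Hz N s‖ ≤ N ^ (-s.re) / s.re := by
  have h : ∫ x in Set.Ioi N, x ^ (-(s.re + 1)) = N ^ (-s.re) / s.re := by
    rw [integral_Ioi_rpow_of_lt (by linarith) (by linarith)]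
    rw [show -(s.re + 1) + 1 = -s.re by ring, div_neg, neg_div, neg_neg]
  rw [← h]
  refine norm_integral_le_of_norm_le (integrableOn_Ioi_rpow_of_lt (by linarith) (by linarith)) ?_
  filter_upwards [ae_restrict_mem measurableSet_Ioi] with x hx
  have hx0 : 0 < x := by linarith [Set.mem_Ioi.1 hx]
  rw [norm_mul, Complex.norm_real, Real.norm_of_nonneg (Int.fract_nonneg _),
    Complex.norm_cpow_eq_rpow_re_of_pos hx0]
  simp only [Complex.neg_re, Complex.add_re, Complex.one_re]
  exact mul_le_of_le_one_left (by positivity) (Int.fract_lt_one _).le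

lemma Hz_diff {s : ℂ} (hs : 0 < s.re) : DifferentiableAt ℂ (Hz 1) s := by
  set f : ℝ → ℂ := (Set.Ioi 1).indicator fun x => ((Int.fract x : ℝ) : ℂ) with hf
  have hm : Measurable f :=
    (Complex.measurable_ofReal.comp measurable_fract).indicator measurableSet_Ioi
  have hb : ∀ x, ‖f x‖ ≤ 1 := fun x => by
    refine (norm_indicator_le_norm_self _ _).trans ?_
    rw [Complex.norm_real, Real.norm_of_nonneg (Int.fract_nonneg _)]; exact (Int.fract_lt_one _).le
  have hd := mellin_differentiableAt_of_isBigO_rpow (f := f) (s := -s) (a := 0) (b := -s.re - 1)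
    (by
      refine LocallyIntegrable.locallyIntegrableOn (fun x => ?_) _
      refine ⟨Metric.closedBall x 1, Metric.closedBall_mem_nhds _ one_pos, ?_⟩
      refine Measure.integrableOn_of_bounded (M := 1) (by
        rw [Real.volume_closedBall]; simp) hm.aestronglyMeasurable (by filter_upwards with x using hb x))
    (by
      refine Asymptotics.IsBigO.of_bound 1 (by filter_upwards with x; simpa using hb x)) (by simpa using hs)
    (by
      refine Asymptotics.IsBigO.of_bound 1 ?_
      filter_upwards [Ioo_mem_nhdsGT (one_pos : (0:ℝ) < 1)] with x hx
      rw [hf, Set.indicator_of_notMem (by simp [hx.2.le])]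
      simp) (by simp)
  have he : Hz 1 = fun s => mellin f (-s) := by
    ext s
    rw [Hz, mellin, hf]
    have : ∀ x : ℝ, (x : ℂ) ^ (-s - 1) • (Set.Ioi 1).indicator (fun x : ℝ => ((Int.fract x : ℝ) : ℂ)) x =
        (Set.Ioi 1).indicator (fun x : ℝ => ((Int.fract x : ℝ) : ℂ) * (x : ℂ) ^ (-(s + 1))) x := fun x => by
      by_cases h : x ∈ Set.Ioi (1 : ℝ)
      · rw [Set.indicator_of_mem h, Set.indicator_of_mem h, smul_eq_mul, mul_comm]; ring_nf
      · rw [Set.indicator_of_notMem h, Set.indicator_of_notMem h, smul_zero]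
    simp_rw [this]
    rw [setIntegral_indicator measurableSet_Ioi]
    congr 2; ext x; simp
  rw [he]
  exact DifferentiableAt.comp (f := fun s : ℂ => -s) s hd differentiable_neg.differentiableAt

lemma cpow_shift {x : ℝ} (hx : 0 < x) {s : ℂ} : (x : ℂ) ^ (-s) = x * (x : ℂ) ^ (-(s + 1)) := by
  have hx1 : (x : ℂ) ≠ 0 := by exact_mod_cast hx.ne'
  rw [show -s = 1 + -(s + 1) by ring, Complex.cpow_add _ _ hx1, Complex.cpow_one]

lemma fl_eq {x : ℝ} (hx : 0 < x) : ((⌊x⌋₊ : ℕ) : ℂ) = x - (Int.fract x : ℝ) := by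
  have : ((⌊x⌋₊ : ℕ) : ℝ) = x - Int.fract x := by
    rw [natCast_floor_eq_intCast_floor hx.le]; linarith [Int.self_sub_floor x]
  rw [← Complex.ofReal_natCast, this]; push_cast; rfl

lemma zeta_gt {s : ℂ} (hs : 1 < s.re) : riemannZeta s = s / (s - 1) - s * Hz 1 s := by
  have h1 := LSeries_eq_mul_integral_of_nonneg (fun _ => 1) (r := 1) zero_le_one hs
    (by
      refine Asymptotics.IsBigO.of_bound 1 (by filter_upwards with n; simp)) (fun _ => zero_le_one)
  have h2 := LSeries_one_eq_riemannZeta hs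
  have h3 : LSeries (fun n : ℕ => ((1 : ℝ) : ℂ)) s = riemannZeta s := by
    rw [← h2]; congr 1
  rw [← h3, h1]
  have hs1 : s - 1 ≠ 0 := fun h => by
    have := congrArg Complex.re h; simp at this; linarith
  have h4 : ∫ x in Set.Ioi (1 : ℝ), (x : ℂ) ^ (-s) = 1 / (s - 1) := by
    rw [integral_Ioi_cpow_of_lt (by simpa using hs) one_pos]
    simp; rw [← neg_sub, neg_add_eq_sub, ← neg_inv]; ring
  have h5 : IntegrableOn (fun x : ℝ => (x : ℂ) ^ (-s)) (Set.Ioi 1) :=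
    integrableOn_Ioi_cpow_of_lt (by simpa using hs) one_pos
  rw [show s / (s - 1) = s * (1 / (s - 1)) by ring, ← mul_sub, ← h4, Hz,
    ← integral_sub h5 (fract_int le_rfl (by linarith))]
  congr 1
  refine setIntegral_congr_fun measurableSet_Ioi fun x hx => ?_
  have hx0 : (0 : ℝ) < x := by linarith [Set.mem_Ioi.1 hx]
  simp only [Complex.ofReal_one, sum_const, Nat.card_Icc, add_tsub_cancel_right, nsmul_eq_mul, mul_one]
  rw [cpow_shift hx0 (s := s), fl_eq hx0]; ring

lemma zeta_pos {s : ℂ} (hs : 0 < s.re) (hs1 : s ≠ 1) : riemannZeta s = s / (s - 1) - s * Hz 1 s := by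
  have hU : IsOpen {s : ℂ | 0 < s.re} := isOpen_lt continuous_const Complex.continuous_re
  have h1 : AnalyticOnNhd ℂ riemannZeta₁ {s : ℂ | 0 < s.re} :=
    differentiable_riemannZeta₁.differentiableOn.analyticOnNhd hU
  have h2 : AnalyticOnNhd ℂ (fun s => s - s * (s - 1) * Hz 1 s) {s : ℂ | 0 < s.re} := by
    refine DifferentiableOn.analyticOnNhd (fun s hs => ?_) hU
    have := Hz_diff hs
    exact DifferentiableAt.differentiableWithinAt (by fun_prop)
  have hc : IsPreconnected {s : ℂ | 0 < s.re} := (convex_halfSpace_re_gt 0).isPreconnected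
  have he := h1.eqOn_of_preconnected_of_eventuallyEq h2 hc (z₀ := 2) (by simp) (by
    filter_upwards [(isOpen_lt continuous_const Complex.continuous_re).mem_nhds
      (show (1 : ℝ) < (2 : ℂ).re by simp)] with z (hz : 1 < z.re)
    have hz1 : z ≠ 1 := fun h => by rw [h] at hz; simp at hz
    have h := zeta_gt hz
    rw [riemannZeta_eq_inv_sub_mul hz1] at h
    have hz2 := sub_ne_zero.2 hz1
    field_simp at h
    rw [h]; ring)
  have h := he hs
  have hz2 := sub_ne_zero.2 hs1
  simp only at h
  rw [riemannZeta_eq_inv_sub_mul hs1, h]; field_simp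

lemma zeta_approx {s : ℂ} (hs : 0 < s.re) (hs1 : s ≠ 1) {N : ℕ} (hN : 1 ≤ N) :
    ‖riemannZeta s - ∑ n ∈ Icc 1 N, (n : ℂ) ^ (-s)‖ ≤
      (N : ℝ) ^ (1 - s.re) / ‖s - 1‖ + ‖s‖ * ((N : ℝ) ^ (-s.re) / s.re) := by
  have hN1 : (1 : ℝ) ≤ N := by exact_mod_cast hN
  have hN0 : (N : ℂ) ≠ 0 := by exact_mod_cast (by omega : N ≠ 0)
  have hs0 : s ≠ 0 := fun h => by rw [h] at hs; simp at hs
  have hz2 := sub_ne_zero.2 hs1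
  have hd : ∀ x ∈ Set.Icc (1 : ℝ) N, HasDerivAt (fun x : ℝ => (x : ℂ) ^ (-s)) (-s * (x : ℂ) ^ (-(s + 1))) x := by
    intro x hx
    have := hasDerivAt_ofReal_cpow_const (x := x) (r := -s) (by linarith [hx.1]) (by simpa using hs0)
    rwa [show -s - 1 = -(s + 1) by ring] at this
  have hIoc : IntegrableOn (fun x : ℝ => (x : ℂ) ^ (-(s + 1))) (Set.Icc 1 N) := by
    rw [integrableOn_Icc_iff_integrableOn_Ioc]
    exact (cpow_int le_rfl hs).mono_set Set.Ioc_subset_Ioi_self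
  have hA := sum_mul_eq_sub_integral_mul₀' (f := fun x : ℝ => (x : ℂ) ^ (-s))
    (fun n => if n = 0 then (0 : ℂ) else 1) (by simp) N
    (fun x hx => (hd x hx).differentiableAt)
    (IntegrableOn.congr_fun (hIoc.const_mul (-s)) (fun x hx => (hd x hx).deriv.symm) measurableSet_Icc)
  have hc : ∀ n : ℕ, ∑ k ∈ Icc 0 n, (if k = 0 then (0 : ℂ) else 1) = n := fun n => by
    rw [← Nat.range_succ_eq_Icc_zero, sum_range_succ']; simp
  simp_rw [hc] at hA
  have hL : ∑ k ∈ Icc 0 N, ((k : ℝ) : ℂ) ^ (-s) * (if k = 0 then (0 : ℂ) else 1) =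
      ∑ n ∈ Icc 1 N, (n : ℂ) ^ (-s) := by
    rw [← sum_subset (Icc_subset_Icc_left zero_le_one) (fun k hk hk' => ?_)]
    · refine sum_congr rfl fun k hk => ?_
      rw [if_neg (by have := (mem_Icc.1 hk).1; omega)]; simp
    · rw [mem_Icc] at hk hk'
      rw [if_pos (by omega), mul_zero]
  rw [hL] at hA
  have hP : ∫ x in Set.Ioc (1 : ℝ) N, (x : ℂ) ^ (-s) = ((N : ℂ) ^ (1 - s) - 1) / (1 - s) := by
    rw [← intervalIntegral.integral_of_le hN1, integral_cpow (Or.inr ⟨fun h => hs1 (neg_inj.1 h), fun h => by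
      rw [Set.uIcc_of_le hN1] at h; linarith [h.1]⟩)]
    simp [neg_add_eq_sub]
  have hPi : IntegrableOn (fun x : ℝ => (x : ℂ) ^ (-s)) (Set.Ioc 1 N) := by
    rw [← intervalIntegrable_iff_integrableOn_Ioc_of_le hN1]
    exact intervalIntegral.intervalIntegrable_cpow (Or.inr fun h => by
      rw [Set.uIcc_of_le hN1] at h; linarith [h.1])
  have hFi := (fract_int le_rfl hs).mono_set (Set.Ioc_subset_Ioi_self : Set.Ioc (1 : ℝ) N ⊆ _)
  have hH : Hz 1 s = (∫ x in Set.Ioc (1 : ℝ) N, ((Int.fract x : ℝ) : ℂ) * (x : ℂ) ^ (-(s + 1))) + Hz N s := by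
    rw [Hz, Hz, ← setIntegral_union (Set.Ioc_disjoint_Ioi le_rfl) measurableSet_Ioi hFi (fract_int hN1 hs),
      Set.Ioc_union_Ioi_eq_Ioi hN1]
  have hI : ∫ t in Set.Ioc (1 : ℝ) N, deriv (fun x : ℝ => (x : ℂ) ^ (-s)) t * (⌊t⌋₊ : ℂ) =
      -s * (((N : ℂ) ^ (1 - s) - 1) / (1 - s) - (Hz 1 s - Hz N s)) := by
    rw [hH, add_sub_cancel_right, ← hP, ← integral_sub hPi hFi, ← integral_const_mul]
    refine setIntegral_congr_fun measurableSet_Ioc fun x hx => ?_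
    have hx0 : (0 : ℝ) < x := by linarith [hx.1]
    rw [(hd x ⟨hx.1.le, hx.2⟩).deriv, fl_eq hx0, cpow_shift hx0 (s := s)]; ring
  have hN' : (N : ℂ) ^ (-s) * N = (N : ℂ) ^ (1 - s) := by
    rw [sub_eq_add_neg, Complex.cpow_add _ _ hN0, Complex.cpow_one, mul_comm]
  have key : riemannZeta s - ∑ n ∈ Icc 1 N, (n : ℂ) ^ (-s) = (N : ℂ) ^ (1 - s) / (s - 1) - s * Hz N s := by
    rw [zeta_pos hs hs1, hA, hI, Complex.ofReal_natCast, hN']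
    have : 1 - s ≠ 0 := fun h => hz2 (by linear_combination -h)
    field_simp
    ring
  rw [key]
  refine (norm_sub_le _ _).trans ?_
  rw [norm_div, norm_mul, ← Complex.ofReal_natCast, Complex.norm_cpow_eq_rpow_re_of_pos (by linarith)]
  have := mul_le_mul_of_nonneg_left (Hz_norm hN1 hs) (norm_nonneg s)
  simpa using this
end VK

namespace VK
open UnitAddTorus Finset

lemma abel_mono {a : ℕ → ℝ} {f : ℕ → ℂ} {B : ℝ} (N N' : ℕ) (h : N ≤ N') (ha : ∀ n > N, 0 ≤ a n)
    (hm : ∀ n > N, a (n + 1) ≤ a n) (hB : ∀ M ≤ N', ‖∑ n ∈ Ioc N M, f n‖ ≤ B) :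
    ‖∑ n ∈ Ioc N N', (a n : ℂ) * f n‖ ≤ a (N + 1) * B := by
  have key : ∀ m, N + m ≤ N' → ∃ R : ℂ, ∑ n ∈ Ioc N (N + m), (a n : ℂ) * f n =
      a (N + m + 1) * ∑ n ∈ Ioc N (N + m), f n + R ∧ ‖R‖ ≤ (a (N + 1) - a (N + m + 1)) * B := by
    intro m
    induction m with
    | zero => intro _; exact ⟨0, by simp⟩
    | succ m ih =>
      intro hm'
      obtain ⟨R, h1, h2⟩ := ih (by omega)
      refine ⟨R + (a (N + m + 1) - a (N + m + 2)) * ∑ n ∈ Ioc N (N + (m + 1)), f n, ?_, ?_⟩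
      · rw [← add_assoc, ← insert_Ioc_right_eq_Ioc_add_one (by omega), sum_insert (by simp), sum_insert (by simp), h1]
        push_cast; ring_nf
      · refine (norm_add_le _ _).trans ?_
        rw [norm_mul, ← Complex.ofReal_sub, Complex.norm_real,
          Real.norm_of_nonneg (sub_nonneg.2 (hm _ (by omega)))]
        have := mul_le_mul_of_nonneg_left (hB _ hm') (sub_nonneg.2 (hm (N + m + 1) (by omega)))
        rw [show N + (m + 1) + 1 = N + m + 2 by ring]
        linarith
  obtain ⟨m, rfl⟩ := Nat.exists_eq_add_of_le h
  obtain ⟨R, h1, h2⟩ := key m le_rfl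
  rw [h1]
  refine (norm_add_le _ _).trans ?_
  rw [norm_mul, Complex.norm_real, Real.norm_of_nonneg (ha _ (by omega))]
  have := mul_le_mul_of_nonneg_left (hB _ le_rfl) (ha (N + m + 1) (by omega))
  linarith

lemma blk {t : ℝ} {N N' : ℕ} (ht : 1 < t) (hN1 : 2 ≤ N) (h2 : Real.log N ≤ 2 * Real.log t)
    (h3 : 10 ^ 39 * Real.log t ^ 2 ≤ Real.log N ^ 3) (hN' : N' ≤ 2 * N) :
    ‖∑ n ∈ Ioc N N', ei (t * Real.log n)‖ ≤
      5 * N * exp (-(Real.log N ^ 3 / (10 ^ 45 * Real.log t ^ 2))) := by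
  set L := Real.log t with hL
  set lam := Real.log N with hlam
  have hL0 : 0 < L := Real.log_pos ht
  have hl0 : 0 < lam := Real.log_pos (by exact_mod_cast hN1)
  set A := L / lam with hA
  have hA2 : 1 / 2 ≤ A := by rw [hA, le_div_iff₀ hl0]; linarith
  have hA3 : 10 ^ 39 * A ^ 3 ≤ L := by
    rw [hA, div_pow, mul_div_assoc', div_le_iff₀ (by positivity)]
    nlinarith
  obtain ⟨l, hl⟩ : ∃ l, l = ⌈A⌉₊ + 10 ^ 12 := ⟨_, rfl⟩
  have hlA : A + 10 ^ 12 ≤ (l : ℝ) := by rw [hl]; push_cast; linarith [Nat.le_ceil A]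
  have hlK : (l : ℝ) ≤ 3 * 10 ^ 12 * A := by
    have := Nat.ceil_lt_add_one (show 0 ≤ A by linarith)
    rw [hl]; push_cast; linarith
  have hl1 : (10 ^ 12 : ℝ) ≤ l := by linarith
  have hlp : (0 : ℝ) < l := by linarith
  have hl3 : 8 * (l : ℝ) ^ 3 ≤ L := by
    have : (l : ℝ) ^ 3 ≤ (3 * 10 ^ 12 * A) ^ 3 := by gcongr
    have h4 : (0 : ℝ) ≤ A ^ 3 := by positivity
    linarith
  set y := exp (L / (4 * l)) with hy
  have hyt : y ^ (4 * l) = t := by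
    rw [hy, ← exp_nat_mul]; push_cast; rw [mul_div_cancel₀ _ (by positivity), exp_log (by linarith)]
  have hy1 : 1 ≤ y := one_le_exp (by positivity)
  set U := ⌊y⌋₊ with hU
  have hUy : (U : ℝ) ≤ y := Nat.floor_le (by linarith)
  have hU1 : (1 : ℝ) ≤ U := by exact_mod_cast Nat.le_floor (by exact_mod_cast hy1)
  have hyU : y < U + 1 := Nat.lt_floor_add_one y
  have hll : (l : ℝ) ^ 2 ≤ L / (8 * l) := by rw [le_div_iff₀ (by positivity)]; linarith
  have hlsq : (l : ℝ) ≤ l ^ 2 := by nlinarith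
  have hlogU : L / (8 * l) ≤ Real.log U := by
    have h5 : y / 2 ≤ U := by linarith
    have h6 := Real.log_le_log (by positivity) h5
    rw [Real.log_div (by positivity) (by norm_num), hy, log_exp] at h6
    have : L / (4 * l) = 2 * (L / (8 * l)) := by field_simp; norm_num
    have := Real.log_two_lt_d9
    linarith
  have hE := expsum (l := l) (U := U) (N := N) (N' := N') (t := t) (by omega) (hll.trans hlogU)
    (by rw [← hyt]; gcongr)
    (by
      rw [← hyt]
      calc y ^ (4 * l) ≤ (U * exp (1 / U)) ^ (4 * l) := by
            gcongr
            have := mul_le_mul_of_nonneg_left (add_one_le_exp (1 / (U : ℝ))) (show (0:ℝ) ≤ U by linarith)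
            rw [mul_add, mul_one_div_cancel (by positivity)] at this; linarith
        _ ≤ U ^ (4 * l) * U ^ 4 := by
            rw [mul_pow]; gcongr
            rw [← exp_nat_mul, ← exp_log (show (0 : ℝ) < U by linarith), ← exp_nat_mul,
              exp_log (show (0 : ℝ) < U by linarith)]
            refine exp_le_exp.2 ?_
            push_cast
            have : (l : ℝ) * (1 / U) ≤ l * 1 := by gcongr; rw [div_le_one (by linarith)]; exact hU1
            linarith
        _ = _ := by rw [← pow_add])
    (by
      have : (U : ℝ) ^ 3 ≤ N := by
        calc (U : ℝ) ^ 3 ≤ y ^ 3 := by gcongr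
          _ = exp (3 * (L / (4 * l))) := by rw [hy, ← exp_nat_mul]; norm_num
          _ ≤ exp lam := by
              gcongr
              have : L = A * lam := by rw [hA, div_mul_cancel₀ _ hl0.ne']
              rw [mul_div_assoc', div_le_iff₀ (by positivity)]
              nlinarith
          _ = N := exp_log (by exact_mod_cast (by omega : 0 < N))
      exact_mod_cast this) hN'
  refine hE.trans ?_
  gcongr
  have h7 : L / (8 * l ^ 3) ≤ Real.log U / l ^ 2 := by
    rw [show L / (8 * (l : ℝ) ^ 3) = L / (8 * l) / l ^ 2 by field_simp]; gcongr
  have h8 : lam ^ 3 / (10 ^ 45 * L ^ 2) ≤ 1 / 1000000 * (L / (8 * l ^ 3)) := by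
    calc lam ^ 3 / (10 ^ 45 * L ^ 2) = 1 / 1000000 * (L / (10 ^ 39 * A ^ 3)) := by
          rw [hA]; field_simp; norm_num
      _ ≤ _ := by
          refine mul_le_mul_of_nonneg_left (div_le_div_of_nonneg_left hL0.le (by positivity) ?_) (by norm_num)
          have : (l : ℝ) ^ 3 ≤ (3 * 10 ^ 12 * A) ^ 3 := by gcongr
          have h4 : (0 : ℝ) ≤ A ^ 3 := by positivity
          linarith
  linarith

lemma npow_eq (n : ℕ) (hn : 0 < n) (σ t : ℝ) : (n : ℂ) ^ (-((σ : ℂ) + t * Complex.I)) =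
    (((n : ℝ) ^ (-σ) : ℝ) : ℂ) * (starRingEnd ℂ) (ei (t * Real.log n)) := by
  have hn0 : (n : ℂ) ≠ 0 := by exact_mod_cast hn.ne'
  rw [Complex.ofReal_cpow (by positivity), neg_add, Complex.cpow_add _ _ hn0, ei, ← Complex.exp_conj,
    Complex.cpow_def_of_ne_zero hn0 (-(t * Complex.I))]
  congr 1
  · push_cast; rfl
  · rw [← Complex.natCast_log, map_mul, Complex.conj_I, Complex.conj_ofReal]; push_cast; congr 1; ring

lemma zblk {t σ ε : ℝ} {N : ℕ} (ht : 1 < t) (hε : 0 < ε) (hL : 1 ≤ Real.log t)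
    (hbig : 10 ^ 45 ≤ Real.log t ^ (3 * ε))
    (hσ : 1 - Real.log t ^ (-(2 / 3 : ℝ) - ε) ≤ σ) (hσ0 : 0 ≤ σ) (hN1 : 1 ≤ N)
    (h2 : Real.log N ≤ 2 * Real.log t) :
    ‖∑ n ∈ Ioc N (2 * N), (n : ℂ) ^ (-((σ : ℂ) + t * Complex.I))‖ ≤ 5 := by
  set L := Real.log t
  have hNR : (1 : ℝ) ≤ N := by exact_mod_cast hN1
  have hlam0 : 0 ≤ Real.log N := Real.log_nonneg hNR
  set lam := Real.log N
  have hL0 : 0 < L := by linarith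
  have hNe : (N : ℝ) = exp lam := (exp_log (by linarith)).symm
  have hA : ∀ B : ℝ, (∀ M ≤ 2 * N, ‖∑ n ∈ Ioc N M, ei (t * Real.log n)‖ ≤ N * B) → 0 ≤ B →
      ‖∑ n ∈ Ioc N (2 * N), (n : ℂ) ^ (-((σ : ℂ) + t * Complex.I))‖ ≤
        exp (L ^ (-(2 / 3 : ℝ) - ε) * lam) * B := by
    intro B hB hB0
    rw [sum_congr rfl fun n hn => npow_eq n (by have := (mem_Ioc.1 hn).1; omega) σ t]
    refine (abel_mono (a := fun n => (n : ℝ) ^ (-σ)) N (2 * N) (by omega) (fun n _ => by positivity) (fun n hn => ?_)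
      (B := N * B) fun M hM => ?_).trans ?_
    · have : (0 : ℝ) < n := by exact_mod_cast (by omega : 0 < n)
      exact Real.rpow_le_rpow_of_nonpos this (by push_cast; linarith) (by linarith)
    · rw [← map_sum, Complex.norm_conj]; exact hB M hM
    · have h1 : ((N + 1 : ℕ) : ℝ) ^ (-σ) ≤ (N : ℝ) ^ (-σ) :=
        Real.rpow_le_rpow_of_nonpos (by linarith) (by push_cast; linarith) (by linarith)
      calc ((N + 1 : ℕ) : ℝ) ^ (-σ) * (N * B) ≤ (N : ℝ) ^ (-σ) * (N * B) := by gcongr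
        _ = exp ((1 - σ) * lam) * B := by
            rw [hNe, ← exp_mul, ← mul_assoc, ← exp_add]; ring_nf
        _ ≤ _ := by gcongr; linarith
  set η := L ^ (-(2 / 3 : ℝ) - ε) with hη
  have hη0 : 0 < η := by positivity
  rcases le_total lam (L ^ (2 / 3 + ε)) with hc | hc
  · have := hA 1 (fun M hM => by
      refine (norm_sum_le _ _).trans ?_
      simp only [ei_norm, sum_const, Nat.card_Ioc, nsmul_eq_mul, mul_one]
      exact_mod_cast (by omega)) zero_le_one
    refine this.trans ?_
    have h3 : η * lam ≤ 1 := by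
      calc η * lam ≤ η * L ^ (2 / 3 + ε) := by gcongr
        _ = 1 := by rw [hη, ← rpow_add hL0]; ring_nf; simp
    rw [mul_one]
    calc exp (η * lam) ≤ exp 1 := by gcongr
      _ ≤ 5 := by linarith [exp_one_lt_d9]
  · have hp : (0 : ℝ) < L ^ (2 / 3 + ε) := by positivity
    have h3 : 10 ^ 45 * L ^ 2 ≤ lam ^ 3 := by
      calc 10 ^ 45 * L ^ 2 ≤ L ^ (3 * ε) * L ^ 2 := by gcongr
        _ = (L ^ (2 / 3 + ε)) ^ 3 := by
            rw [← rpow_natCast, ← rpow_natCast, ← rpow_add hL0, ← rpow_mul hL0.le]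
            congr 1; push_cast; ring
        _ ≤ _ := by gcongr
    have h4 : 10 ^ 45 * L ^ 2 * η ≤ lam ^ 2 := by
      calc 10 ^ 45 * L ^ 2 * η ≤ L ^ (3 * ε) * L ^ 2 * η := by gcongr
        _ = (L ^ (2 / 3 + ε)) ^ 2 := by
            rw [hη, ← rpow_natCast, ← rpow_natCast, ← rpow_add hL0, ← rpow_add hL0, ← rpow_mul hL0.le]
            congr 1; push_cast; ring
        _ ≤ _ := by gcongr
    have hN2 : 2 ≤ N := by
      by_contra h
      have : N = 1 := by omega
      have : lam = 0 := by simp [lam, this]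
      linarith
    have := hA (5 * exp (-(lam ^ 3 / (10 ^ 45 * L ^ 2)))) (fun M hM => (blk ht hN2 h2 (by
      have : 0 ≤ L ^ 2 := by positivity
      linarith) hM).trans (by apply le_of_eq; ring)) (by positivity)
    refine this.trans ?_
    rw [mul_left_comm, ← exp_add]
    have : exp (η * lam + -(lam ^ 3 / (10 ^ 45 * L ^ 2))) ≤ 1 := by
      rw [exp_le_one_iff, ← sub_eq_add_neg, sub_nonpos, le_div_iff₀ (by positivity)]
      have := mul_le_mul_of_nonneg_right h4 hlam0
      linarith
    linarith

lemma zeta_bd0 {t σ ε : ℝ} (ht : 2 ≤ t) (hε : 0 < ε) (hL : 1 ≤ Real.log t)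
    (hbig : 10 ^ 45 ≤ Real.log t ^ (3 * ε))
    (hσ : 1 - Real.log t ^ (-(2 / 3 : ℝ) - ε) ≤ σ) (hσ0 : 3 / 4 ≤ σ) (hσ2 : σ ≤ 2) :
    ‖riemannZeta (σ + t * Complex.I)‖ ≤ 26 * Real.log t := by
  set L := Real.log t with hLd
  set s : ℂ := σ + t * Complex.I with hs
  have hre : s.re = σ := by simp [hs]
  have him : s.im = t := by simp [hs]
  have ht0 : 0 < t := by linarith
  have hl2 : 0 < Real.log 2 := by linarith [Real.log_two_gt_d9]
  obtain ⟨J, hJ⟩ : ∃ J, J = ⌈2 * L / Real.log 2⌉₊ := ⟨_, rfl⟩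
  have hJ1 : 2 * L ≤ J * Real.log 2 := by rw [← div_le_iff₀ hl2, hJ]; exact Nat.le_ceil _
  have hJ2 : (J : ℝ) < 2 * L / Real.log 2 + 1 := by rw [hJ]; exact Nat.ceil_lt_add_one (by positivity)
  have hJ3 : J * Real.log 2 < 2 * L + Real.log 2 := by
    have := mul_lt_mul_of_pos_right hJ2 hl2
    rwa [add_mul, div_mul_cancel₀ _ hl2.ne', one_mul] at this
  have hsum : ∀ j ≤ J, ‖∑ n ∈ Icc (1 : ℕ) (2 ^ j), (n : ℂ) ^ (-s)‖ ≤ 1 + 5 * j := by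
    intro j
    induction j with
    | zero => intro _; simp
    | succ j ih =>
      intro hj
      have hsplit : ∑ n ∈ Icc (1 : ℕ) (2 ^ (j + 1)), (n : ℂ) ^ (-s) =
          ∑ n ∈ Icc (1 : ℕ) (2 ^ j), (n : ℂ) ^ (-s) + ∑ n ∈ Ioc (2 ^ j : ℕ) (2 * 2 ^ j), (n : ℂ) ^ (-s) := by
        rw [← sum_union (by
          rw [disjoint_left]; intro x hx hx'; rw [mem_Icc] at hx; rw [mem_Ioc] at hx'; omega)]
        congr 1; ext x; simp only [mem_union, mem_Icc, mem_Ioc, pow_succ]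
        have : 1 ≤ 2 ^ j := Nat.one_le_two_pow
        omega
      rw [hsplit]
      have hb := zblk (N := 2 ^ j) (by linarith : 1 < t) hε hL hbig hσ (by linarith) Nat.one_le_two_pow (by
        push_cast; rw [Real.log_pow]
        have : (j : ℝ) + 1 ≤ J := by exact_mod_cast hj
        nlinarith)
      have := ih (by omega)
      refine (norm_add_le _ _).trans ?_
      push_cast; linarith
  have h1 := hsum J le_rfl
  have hs1 : s ≠ 1 := fun h => by rw [h] at him; simp at him; linarith
  have h2 := zeta_approx (N := 2 ^ J) (by rw [hre]; linarith) hs1 Nat.one_le_two_pow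
  rw [hre] at h2
  have hNe : ((2 ^ J : ℕ) : ℝ) = exp (J * Real.log 2) := by
    push_cast; rw [exp_nat_mul, exp_log two_pos]
  have hte : t = exp L := (exp_log ht0).symm
  have hs1n : t ≤ ‖s - 1‖ := by
    have := Complex.abs_im_le_norm (s - 1)
    rw [Complex.sub_im, him] at this; simp at this
    exact (le_abs_self t).trans this
  have hsn : ‖s‖ ≤ 2 * t := by
    refine (norm_add_le _ _).trans ?_
    rw [norm_mul, Complex.norm_I, Complex.norm_real, Complex.norm_real, Real.norm_of_nonneg (by linarith),
      Real.norm_of_nonneg ht0.le]; linarith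
  rw [hNe, ← exp_mul, ← exp_mul] at h2
  have h3 : exp (J * Real.log 2 * (1 - σ)) / ‖s - 1‖ ≤ 1 := by
    rw [div_le_one (by linarith)]
    refine le_trans ?_ hs1n
    rw [hte]; gcongr
    have : 0 ≤ J * Real.log 2 := by positivity
    have h4 : J * Real.log 2 * (1 - σ) ≤ J * Real.log 2 * (1 / 4) := by gcongr; linarith
    have := Real.log_two_lt_d9
    linarith
  have h5 : ‖s‖ * (exp (J * Real.log 2 * -σ) / σ) ≤ 4 := by
    have h6 : exp (J * Real.log 2 * -σ) ≤ t⁻¹ := by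
      rw [hte, ← exp_neg]; gcongr
      nlinarith
    calc ‖s‖ * (exp (J * Real.log 2 * -σ) / σ) ≤ (2 * t) * (t⁻¹ / (1 / 2)) := by
          gcongr; linarith
      _ = 4 := by field_simp; norm_num
  have h7 : (J : ℝ) ≤ 3 * L + 1 := by
    have : 2 * L / Real.log 2 ≤ 3 * L := by
      rw [div_le_iff₀ hl2]; nlinarith [Real.log_two_gt_d9]
    linarith
  have h8 := norm_sub_norm_le (riemannZeta s) (∑ n ∈ Icc (1 : ℕ) (2 ^ J), (n : ℂ) ^ (-s))
  push_cast at h2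
  linarith

lemma conj_eq (σ t : ℝ) : (starRingEnd ℂ) ((σ : ℂ) + t * Complex.I) = σ + (-t : ℝ) * Complex.I := by
  simp [Complex.ext_iff]

lemma zeta_bd {t σ ε : ℝ} (ht : 2 ≤ |t|) (hε : 0 < ε) (hL : 1 ≤ Real.log |t|)
    (hbig : 10 ^ 45 ≤ Real.log |t| ^ (3 * ε))
    (hσ : 1 - Real.log |t| ^ (-(2 / 3 : ℝ) - ε) ≤ σ) (hσ0 : 3 / 4 ≤ σ) (hσ2 : σ ≤ 2) :
    ‖riemannZeta (σ + t * Complex.I)‖ ≤ 26 * Real.log |t| := by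
  have h := zeta_bd0 ht hε hL hbig hσ hσ0 hσ2
  rcases abs_choice t with h1 | h1
  · rwa [h1] at h ⊢
  · rw [h1, ← conj_eq, riemannZeta_conj, Complex.norm_conj, ← h1] at h; exact h

end VK

namespace VK
open UnitAddTorus Finset Metric

lemma ld_bd {f : ℂ → ℂ} {c : ℂ} {r M : ℝ} (hr : 0 < r) (hM : 0 < M) (hf : DifferentiableOn ℂ f (ball c r))
    (h0 : ∀ z ∈ ball c r, f z ≠ 0) (hb : ∀ z ∈ ball c r, ‖f z‖ ≤ exp M * ‖f c‖)
    {z : ℂ} (hz : z ∈ closedBall c (r / 4)) : ‖deriv f z / f z‖ ≤ 8 * M / r := by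
  have hc : c ∈ ball c r := mem_ball_self hr
  have hd : DifferentiableOn ℂ (fun z => deriv f z / f z) (ball c r) :=
    (hf.deriv isOpen_ball).div hf h0
  obtain ⟨h, hh0, hh⟩ := hd.isExactOn_ball.with_val_at c 0
  have hdh : DifferentiableOn ℂ h (ball c r) := fun z hz => (hh z hz).differentiableAt.differentiableWithinAt
  have hexp : ∀ z ∈ ball c r, f z = f c * Complex.exp (h z) := by
    have hk : ∀ z ∈ ball c r, HasDerivAt (fun z => f z * Complex.exp (-h z)) 0 z := by
      intro z hz
      have := (hf.differentiableAt (isOpen_ball.mem_nhds hz)).hasDerivAt.mul (hh z hz).neg.cexp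
      convert! this using 1
      have := h0 z hz
      field_simp; ring
    intro z hz
    have := isOpen_ball.is_const_of_deriv_eq_zero (convex_ball c r).isPreconnected
      (fun z hz => (hk z hz).differentiableAt.differentiableWithinAt) (fun z hz => (hk z hz).deriv) hz hc
    simp only [hh0, neg_zero, Complex.exp_zero, mul_one] at this
    rw [← this, mul_assoc, ← Complex.exp_add]; simp
  have hre : ∀ z ∈ ball c r, (h z).re ≤ M := by
    intro z hz
    have h1 := hb z hz
    rw [hexp z hz, norm_mul, Complex.norm_exp, mul_comm] at h1
    exact exp_le_exp.1 (le_of_mul_le_mul_right h1 (norm_pos_iff.2 (h0 c hc)))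
  have hBC : ∀ w ∈ closedBall c (r / 2), ‖h w‖ ≤ 2 * M := by
    intro w hw
    rw [mem_closedBall, dist_eq_norm] at hw
    have hB := Complex.borelCaratheodory_zero (f := fun z => h (c + z)) (R := r) (z := w - c) hM
      (hdh.comp (by fun_prop) (fun x hx => by simpa [dist_eq_norm] using hx))
      (fun x hx => hre _ (by simpa [dist_eq_norm] using hx)) hr
      (by rw [mem_ball_zero_iff]; linarith) (by simpa using hh0)
    simp only [add_sub_cancel] at hB
    refine hB.trans ?_
    rw [div_le_iff₀ (by linarith)]
    nlinarith
  have hz' : dist z c ≤ r / 4 := hz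
  rw [← (hh z (by rw [mem_ball]; linarith)).deriv]
  have hsub : closedBall z (r / 4) ⊆ closedBall c (r / 2) := closedBall_subset_closedBall' (by linarith)
  have := Complex.norm_deriv_le_of_forall_mem_sphere_norm_le (f := h) (c := z) (R := r / 4) (C := 2 * M) (by positivity)
    (DifferentiableOn.diffContOnCl (by
      rw [closure_ball _ (by positivity)]
      exact hdh.mono (hsub.trans (closedBall_subset_ball (by linarith)))))
    (fun w hw => hBC w (hsub (sphere_subset_closedBall hw)))
  refine this.trans (le_of_eq ?_)
  field_simp; norm_num

lemma div_zero {f : ℂ → ℂ} {c ρ : ℂ} {R K : ℝ} (hR : 0 < R) (hf : DifferentiableOn ℂ f (ball c R))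
    (h0 : f c ≠ 0) (hK : ∀ z ∈ ball c R, ‖f z‖ ≤ K * ‖f c‖) (hρ : ρ ∈ closedBall c (R / 4)) (hfρ : f ρ = 0) :
    ∃ g : ℂ → ℂ, DifferentiableOn ℂ g (ball c R) ∧ (∀ z, f z = (z - ρ) * g z) ∧
      (∀ z ∈ ball c R, ‖g z‖ ≤ K / 2 * ‖g c‖) ∧ deriv f c / f c = 1 / (c - ρ) + deriv g c / g c := by
  have hρ' : dist ρ c ≤ R / 4 := hρ
  have hK0 : 0 ≤ K := by
    by_contra h
    have := hK c (mem_ball_self hR)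
    nlinarith [norm_pos_iff.2 h0]
  have hmem : ball c R ∈ nhds ρ := isOpen_ball.mem_nhds (by rw [mem_ball]; linarith)
  have hg : DifferentiableOn ℂ (dslope f ρ) (ball c R) := (Complex.differentiableOn_dslope hmem).2 hf
  have hfg : ∀ z, f z = (z - ρ) * dslope f ρ z := fun z => by
    have := sub_smul_dslope f ρ z; rw [hfρ, sub_zero] at this; exact this.symm
  refine ⟨dslope f ρ, hg, hfg, ?_, ?_⟩
  · intro z hz
    rw [mem_ball] at hz
    set r := max (dist z c) (3 * R / 4)
    have hr1 : 3 * R / 4 ≤ r := le_max_right _ _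
    have hr2 : r < R := max_lt hz (by linarith)
    have hr0 : r ≠ 0 := by linarith
    have hzc : z ∈ closure (ball c r) := by
      rw [closure_ball _ hr0]; exact (le_max_left _ _ : dist z c ≤ r)
    have hd : DiffContOnCl ℂ (dslope f ρ) (ball c r) := by
      refine DifferentiableOn.diffContOnCl ?_
      rw [closure_ball _ hr0]
      exact hg.mono (closedBall_subset_ball hr2)
    refine Complex.norm_le_of_forall_mem_frontier_norm_le isBounded_ball hd (fun w hw => ?_) hzc
    rw [frontier_ball _ hr0, mem_sphere] at hw
    have h1 := hK w (by rw [mem_ball]; linarith)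
    rw [hfg w, hfg c, norm_mul, norm_mul] at h1
    have h2 : R / 2 ≤ ‖w - ρ‖ := by
      rw [← dist_eq_norm]; have := dist_triangle w ρ c; linarith
    have h3 : ‖c - ρ‖ ≤ R / 4 := by rw [← dist_eq_norm, dist_comm]; exact hρ'
    have h4 : R / 2 * ‖dslope f ρ w‖ ≤ ‖w - ρ‖ * ‖dslope f ρ w‖ := by gcongr
    have h5 : K * (‖c - ρ‖ * ‖dslope f ρ c‖) ≤ K * (R / 4 * ‖dslope f ρ c‖) := by gcongr
    refine le_of_mul_le_mul_left ?_ (show 0 < R / 2 by linarith)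
    linarith
  · have hcρ : c - ρ ≠ 0 := fun h => h0 (by rw [hfg, h, zero_mul])
    have hgc : dslope f ρ c ≠ 0 := fun h => h0 (by rw [hfg, h, mul_zero])
    have hd : HasDerivAt (fun z => (z - ρ) * dslope f ρ z) (1 * dslope f ρ c + (c - ρ) * deriv (dslope f ρ) c) c :=
      ((hasDerivAt_id c).sub_const ρ).mul (hg.differentiableAt (isOpen_ball.mem_nhds (mem_ball_self hR))).hasDerivAt
    have hd' := (hd.congr_of_eventuallyEq (Eventually.of_forall hfg)).deriv
    rw [hd', hfg c]; field_simp

lemma landau_aux {c : ℂ} {R M : ℝ} (hR : 0 < R) (hM : 0 < M) (n : ℕ) : ∀ (f : ℂ → ℂ) (K : ℝ), K < 2 ^ n → K ≤ exp M →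
    DifferentiableOn ℂ f (ball c R) → f c ≠ 0 → (∀ z ∈ ball c R, ‖f z‖ ≤ K * ‖f c‖) →
    (∀ z ∈ ball c R, f z = 0 → z.re < c.re) → -(deriv f c / f c).re ≤ 32 * M / R := by
  induction n with
  | zero =>
    intro f K hK _ _ h0 hb _
    have := hb c (mem_ball_self hR)
    rw [pow_zero] at hK
    nlinarith [norm_pos_iff.2 h0]
  | succ n ih =>
    intro f K hK hKM hf h0 hb hz
    by_cases hρ : ∃ ρ ∈ closedBall c (R / 4), f ρ = 0
    · obtain ⟨ρ, hρ, hfρ⟩ := hρ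
      obtain ⟨g, hg, hfg, hgb, hde⟩ := div_zero hR hf h0 hb hρ hfρ
      have hρ' : ρ.re < c.re := hz ρ (closedBall_subset_ball (by linarith) hρ) hfρ
      have hgc : g c ≠ 0 := fun h => h0 (by rw [hfg, h, mul_zero])
      have := ih g (K / 2) (by rw [pow_succ] at hK; linarith) (by linarith [exp_pos M]) hg hgc hgb
        (fun z hz' hgz => hz z hz' (by rw [hfg, hgz, mul_zero]))
      rw [hde, Complex.add_re]
      have hpos : 0 ≤ (1 / (c - ρ)).re := by
        rw [one_div, Complex.inv_re]; exact div_nonneg (by simp; linarith) (Complex.normSq_nonneg _)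
      linarith
    · push Not at hρ
      have hsub : ball c (R / 4) ⊆ ball c R := ball_subset_ball (by linarith)
      have := ld_bd (r := R / 4) (by positivity) hM (hf.mono hsub) (fun z hz => hρ z (ball_subset_closedBall hz))
        (fun z hz => (hb z (hsub hz)).trans (by gcongr)) (z := c) (mem_closedBall_self (by positivity))
      have h2 := Complex.abs_re_le_norm (deriv f c / f c)
      have h3 := neg_abs_le (deriv f c / f c).re
      have : 8 * M / (R / 4) = 32 * M / R := by field_simp; norm_num
      linarith

lemma landau {f : ℂ → ℂ} {c : ℂ} {R M : ℝ} (hR : 0 < R) (hM : 0 < M) (hf : DifferentiableOn ℂ f (ball c R))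
    (h0 : f c ≠ 0) (hb : ∀ z ∈ ball c R, ‖f z‖ ≤ exp M * ‖f c‖)
    (hz : ∀ z ∈ ball c R, f z = 0 → z.re < c.re) :
    -(deriv f c / f c).re ≤ 32 * M / R ∧ ∀ ρ ∈ closedBall c (R / 4), f ρ = 0 →
      -(deriv f c / f c).re ≤ 32 * M / R - (1 / (c - ρ)).re := by
  obtain ⟨n, hn⟩ := pow_unbounded_of_one_lt (exp M) one_lt_two
  refine ⟨landau_aux hR hM n f _ hn le_rfl hf h0 hb hz, fun ρ hρ hfρ => ?_⟩
  obtain ⟨g, hg, hfg, hgb, hde⟩ := div_zero hR hf h0 hb hρ hfρ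
  have hgc : g c ≠ 0 := fun h => h0 (by rw [hfg, h, mul_zero])
  have := landau_aux hR hM n g (exp M / 2) (by linarith [exp_pos M]) (by linarith [exp_pos M]) hg hgc hgb
        (fun z hz' hgz => hz z hz' (by rw [hfg, hgz, mul_zero]))
  rw [hde, Complex.add_re]
  linarith

end VK

namespace VK
open UnitAddTorus Finset Metric

lemma lam_sum {s : ℂ} (hs : 1 < s.re) :
    HasSum (fun n : ℕ => (ArithmeticFunction.vonMangoldt n : ℂ) * (n : ℂ) ^ (-s)) (-(deriv riemannZeta s / riemannZeta s)) := by
  have h := (ArithmeticFunction.LSeriesSummable_vonMangoldt hs).LSeriesHasSum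
  rw [ArithmeticFunction.LSeries_vonMangoldt_eq_deriv_riemannZeta_div hs, neg_div] at h
  unfold LSeriesHasSum at h
  convert! h using 1
  funext n
  rw [LSeries.term_def]
  split_ifs with h0
  · simp [h0]
  · rw [Complex.cpow_neg, div_eq_mul_inv]

lemma lam_re {σ : ℝ} (hs : 1 < σ) (t : ℝ) :
    HasSum (fun n : ℕ => ArithmeticFunction.vonMangoldt n * (n : ℝ) ^ (-σ) * cos (t * Real.log n))
      (-(deriv riemannZeta (σ + t * Complex.I) / riemannZeta (σ + t * Complex.I)).re) := by
  have h := Complex.hasSum_re (lam_sum (s := σ + t * Complex.I) (by simpa using hs))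
  convert! h using 1
  funext n
  rcases Nat.eq_zero_or_pos n with rfl | hn
  · simp
  · rw [npow_eq n hn, ei, ← Complex.exp_conj, ← mul_assoc, ← Complex.ofReal_mul, Complex.re_ofReal_mul, Complex.exp_re]
    simp [-Complex.natCast_log, -Complex.ofReal_natCast]

lemma lam_norm {σ : ℝ} (hs : 1 < σ) (t : ℝ) :
    ‖deriv riemannZeta (σ + t * Complex.I) / riemannZeta (σ + t * Complex.I)‖ ≤
      -(deriv riemannZeta σ / riemannZeta σ).re := by
  have h := lam_sum (s := σ + t * Complex.I) (by simpa using hs)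
  have h0 := lam_re hs 0
  simp only [Complex.ofReal_zero, zero_mul, add_zero, cos_zero, mul_one] at h0
  rw [← norm_neg, ← h.tsum_eq]
  refine tsum_of_norm_bounded h0 fun n => ?_
  rcases Nat.eq_zero_or_pos n with rfl | hn
  · simp
  · rw [npow_eq n hn, norm_mul, norm_mul, RCLike.norm_conj, ei_norm, mul_one, Complex.norm_real, Complex.norm_real,
      norm_of_nonneg ArithmeticFunction.vonMangoldt_nonneg, norm_of_nonneg (by positivity)]

lemma t341 {σ : ℝ} (hs : 1 < σ) (t : ℝ) :
    0 ≤ 3 * -(deriv riemannZeta σ / riemannZeta σ).re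
      + 4 * -(deriv riemannZeta (σ + t * Complex.I) / riemannZeta (σ + t * Complex.I)).re
      + -(deriv riemannZeta (σ + (2 * t : ℝ) * Complex.I) / riemannZeta (σ + (2 * t : ℝ) * Complex.I)).re := by
  have h0 := lam_re hs 0
  simp only [Complex.ofReal_zero, zero_mul, add_zero, cos_zero, mul_one] at h0
  refine (((h0.mul_left 3).add ((lam_re hs t).mul_left 4)).add (lam_re hs (2 * t))).nonneg fun n => ?_
  have h1 : 0 ≤ ArithmeticFunction.vonMangoldt n * (n : ℝ) ^ (-σ) :=
    mul_nonneg ArithmeticFunction.vonMangoldt_nonneg (by positivity)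
  rw [mul_assoc 2 t, cos_two_mul]
  nlinarith [mul_nonneg h1 (sq_nonneg (1 + cos (t * Real.log n)))]

lemma z1_ne {s : ℂ} (hs : 1 ≤ s.re) : riemannZeta₁ s ≠ 0 := by
  by_cases h : s = 1
  · simp [h]
  · intro h0
    exact riemannZeta_ne_zero_of_one_le_re hs (by rw [riemannZeta_eq_inv_sub_mul h, h0, mul_zero])

lemma ld_eq {s : ℂ} (hs : s ≠ 1) (h1 : riemannZeta₁ s ≠ 0) : deriv riemannZeta s / riemannZeta s =
    -(s - 1)⁻¹ + deriv riemannZeta₁ s / riemannZeta₁ s := by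
  rw [deriv_riemannZeta_eq_neg_inv_sub_sq_mul_add hs, riemannZeta_eq_inv_sub_mul hs]
  have := sub_ne_zero.2 hs
  field_simp

lemma ld_one : ∃ A > (0 : ℝ), ∀ σ : ℝ, 1 < σ → σ ≤ 2 → -(deriv riemannZeta σ / riemannZeta σ).re ≤ 1 / (σ - 1) + A := by
  have hc : ContinuousOn (fun σ : ℝ => deriv riemannZeta₁ σ / riemannZeta₁ σ) (Set.Icc 1 2) := by
    refine ContinuousOn.div ?_ ?_ fun σ hσ => z1_ne (by simpa using hσ.1)
    · exact (differentiable_riemannZeta₁.deriv.continuous.comp Complex.continuous_ofReal).continuousOn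
    · exact (differentiable_riemannZeta₁.continuous.comp Complex.continuous_ofReal).continuousOn
  obtain ⟨A, hA⟩ := isCompact_Icc.exists_bound_of_continuousOn hc
  refine ⟨max A 1, by positivity, fun σ h1 h2 => ?_⟩
  have h3 := (Complex.abs_re_le_norm _).trans (hA σ ⟨h1.le, h2⟩)
  rw [ld_eq (by exact_mod_cast h1.ne') (z1_ne (by simpa using h1.le)), Complex.add_re]
  have h4 : (-((σ : ℂ) - 1)⁻¹).re = -(1 / (σ - 1)) := by
    rw [Complex.neg_re, one_div, ← Complex.ofReal_one, ← Complex.ofReal_sub, ← Complex.ofReal_inv, Complex.ofReal_re]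
  rw [h4]
  linarith [neg_abs_le ((deriv riemannZeta₁ σ / riemannZeta₁ σ).re), le_max_left A 1]

lemma zinv {σ : ℝ} (hs : 1 < σ) (t : ℝ) : 1 ≤ (2 + 1 / (σ - 1)) * ‖riemannZeta (σ + t * Complex.I)‖ := by
  have hre : 1 < (σ + t * Complex.I : ℂ).re := by simpa using hs
  have h := LSeries_one_mul_Lseries_moebius hre
  rw [LSeries_one_eq_riemannZeta hre] at h
  have hz : ‖riemannZeta σ‖ ≤ 2 + 1 / (σ - 1) := by
    have := zeta_approx (s := σ) (by simp; linarith) (by exact_mod_cast hs.ne') (N := 1) le_rfl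
    have h2 := norm_le_norm_add_norm_sub' (riemannZeta σ) 1
    have h3 : ‖(σ : ℂ) - 1‖ = σ - 1 := by
      rw [← Complex.ofReal_one, ← Complex.ofReal_sub, Complex.norm_real, norm_of_nonneg (by linarith)]
    simp [h3, abs_of_pos (show 0 < σ by linarith), mul_inv_cancel₀ (show σ ≠ 0 by linarith)] at this h2 ⊢
    linarith
  have h1 : HasSum (fun n : ℕ => ‖LSeries.term 1 (σ : ℂ) n‖) ‖riemannZeta σ‖ := by
    have := (LSeriesHasSum_one (s := σ) (by simpa using hs))
    have h2 := Complex.hasSum_re this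
    have h3 : ∀ n, (LSeries.term 1 (σ : ℂ) n).re = ‖LSeries.term 1 (σ : ℂ) n‖ := by
      intro n
      rw [LSeries.norm_term_eq, LSeries.term_def]
      split_ifs
      · simp
      · simp only [Pi.one_apply, norm_one, Complex.ofReal_re]
        rw [← Complex.ofReal_natCast, ← Complex.ofReal_cpow (by positivity), ← Complex.ofReal_one, ← Complex.ofReal_div,
          Complex.ofReal_re]
    simp only [h3] at h2
    convert! h2 using 1
    rw [← Complex.abs_re_eq_norm.2 (riemannZeta_im_eq_zero_of_one_lt hs), abs_of_pos (riemannZeta_re_pos_of_one_lt hs)]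
  have h2 : ‖LSeries (fun n => ((ArithmeticFunction.moebius n : ℤ) : ℂ)) (σ + t * Complex.I)‖ ≤ ‖riemannZeta σ‖ := by
    refine tsum_of_norm_bounded h1 fun n => ?_
    rw [LSeries.norm_term_eq, LSeries.norm_term_eq]
    split_ifs
    · rfl
    · simp only [Complex.add_re, Complex.ofReal_re, Complex.mul_re, Complex.I_re, mul_zero, Complex.ofReal_im, Complex.I_im,
        zero_mul, sub_zero, add_zero, Pi.one_apply, norm_one]
      gcongr
      rw [Complex.norm_intCast]
      exact_mod_cast ArithmeticFunction.abs_moebius_le_one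
  have h3 := congrArg norm h
  rw [norm_mul, norm_one] at h3
  nlinarith [mul_le_mul_of_nonneg_left (h2.trans hz) (norm_nonneg (riemannZeta (σ + t * Complex.I)))]
end VK

namespace VK
open UnitAddTorus Finset Metric

lemma pwl {L L' p : ℝ} (h0 : 0 < L') (h : L' ≤ 2 * L) (hp : 0 ≤ p) (hp1 : p ≤ 1) : L ^ (-p) / 2 ≤ L' ^ (-p) := by
  have hL : 0 < L := by linarith
  calc L ^ (-p) / 2 = 2 ^ (-1 : ℝ) * L ^ (-p) := by rw [rpow_neg_one]; ring
    _ ≤ 2 ^ (-p) * L ^ (-p) := by gcongr <;> linarith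
    _ = (2 * L) ^ (-p) := (mul_rpow (by norm_num) hL.le).symm
    _ ≤ _ := rpow_le_rpow_of_nonpos h0 h (by linarith)

lemma log_im {γ τ : ℝ} (hL : 4 ≤ Real.log |γ|) (h1 : |γ| - 1 ≤ |τ|) (h2 : |τ| ≤ 2 * |γ| + 1) :
    2 ≤ |τ| ∧ Real.log |γ| / 2 ≤ Real.log |τ| ∧ Real.log |τ| ≤ 2 * Real.log |γ| := by
  have hγ : 0 < |γ| := by
    by_contra h
    have : |γ| = 0 := le_antisymm (not_lt.1 h) (abs_nonneg _)
    rw [this, Real.log_zero] at hL; norm_num at hL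
  have h5 : 5 ≤ |γ| := by
    have := Real.add_one_le_exp (Real.log |γ|); rw [exp_log hγ] at this; linarith
  refine ⟨by linarith, ?_, ?_⟩
  · rw [← Real.log_sqrt hγ.le]
    refine Real.log_le_log (by positivity) (le_trans ?_ h1)
    rw [Real.sqrt_le_left (by linarith)]; nlinarith
  · rw [← Real.log_rpow hγ]
    refine Real.log_le_log (by linarith) (h2.trans ?_)
    rw [rpow_two]; nlinarith

lemma zb {ε : ℝ} (hε : 0 < ε) (hε1 : ε ≤ 1 / 3) : ∃ L₀ ≥ (4 : ℝ), ∀ γ, L₀ ≤ Real.log |γ| → ∀ z : ℂ, |γ| - 1 ≤ |z.im| →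
    |z.im| ≤ 2 * |γ| + 1 → 1 - (Real.log |γ| ^ (2 / 3 + ε))⁻¹ / 2 ≤ z.re → z.re ≤ 2 →
    ‖riemannZeta z‖ ≤ 52 * Real.log |γ| := by
  obtain ⟨L₁, hL₁⟩ := eventually_atTop.1 ((tendsto_rpow_atTop (show 0 < 3 * ε by positivity)).eventually_ge_atTop (10 ^ 45))
  refine ⟨max 4 (2 * L₁), le_max_left _ _, fun γ hγ z h1 h2 h3 h4 => ?_⟩
  have hL4 := (le_max_left _ _).trans hγ
  have hL1 := (le_max_right _ _).trans hγ
  obtain ⟨a1, a2, a3⟩ := log_im hL4 h1 h2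
  set L := Real.log |γ|
  have hX : 2 ≤ L ^ (2 / 3 + ε) := calc
    (2 : ℝ) = 4 ^ (1 / 2 : ℝ) := by rw [show (4 : ℝ) = 2 ^ (2 : ℝ) by norm_num, ← rpow_mul (by norm_num)]; norm_num
    _ ≤ L ^ (1 / 2 : ℝ) := by gcongr
    _ ≤ _ := rpow_le_rpow_of_exponent_le (by linarith) (by linarith)
  have hX' : (L ^ (2 / 3 + ε))⁻¹ ≤ 1 / 2 := by
    rw [one_div]; exact inv_anti₀ (by norm_num) hX
  have := zeta_bd (t := z.im) (σ := z.re) a1 hε (by linarith) (hL₁ _ (by linarith)) (by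
    have := pwl (L := L) (L' := Real.log |z.im|) (p := 2 / 3 + ε) (by linarith) a3 (by linarith) (by linarith)
    rw [rpow_neg (by linarith)] at this
    rw [show -(2 / 3 : ℝ) - ε = -(2 / 3 + ε) by ring]; linarith) (by linarith) h4
  rw [Complex.re_add_im] at this
  linarith

lemma evL {ε : ℝ} (hε : 0 < ε) (B : ℝ) : ∃ L₀ ≥ (4 : ℝ), ∀ L ≥ L₀, B ≤ L ^ ε ∧ 156 * L ^ 2 ≤ exp (L ^ ε / 1000) := by
  have h1 := (tendsto_rpow_atTop hε).eventually_ge_atTop B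
  have h2 : ∀ᶠ L : ℝ in atTop, 156 * L ^ 2 ≤ exp (L ^ ε / 1000) := by
    have := (tendsto_rpow_atTop hε).eventually
      ((isLittleO_rpow_exp_pos_mul_atTop (2 / ε) (show (0 : ℝ) < 1 / 1000 by norm_num)).bound (show (0 : ℝ) < 1 / 156 by norm_num))
    filter_upwards [this, eventually_ge_atTop 0] with L hL hL0
    rw [← rpow_mul hL0, mul_div_cancel₀ _ hε.ne', rpow_two, norm_of_nonneg (by positivity), norm_of_nonneg (by positivity)] at hL
    rw [show L ^ ε / 1000 = 1 / 1000 * L ^ ε by ring]; linarith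
  obtain ⟨L₁, h⟩ := eventually_atTop.1 (h1.and h2)
  exact ⟨max 4 L₁, le_max_left _ _, fun L hL => h L ((le_max_right _ _).trans hL)⟩

lemma im_bd {c z : ℂ} {R : ℝ} (h : z ∈ ball c R) : |z.re - c.re| < R ∧ |z.im - c.im| < R := by
  rw [mem_ball, dist_eq_norm] at h
  exact ⟨(Complex.abs_re_le_norm (z - c)).trans_lt h, (Complex.abs_im_le_norm (z - c)).trans_lt h⟩

lemma zdiff {c : ℂ} {R : ℝ} (hR : R ≤ 1) (hc : 1 ≤ |c.im|) : DifferentiableOn ℂ riemannZeta (ball c R) := fun z hz =>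
  (differentiableAt_riemannZeta (fun h => by
    have := (im_bd hz).2
    rw [h, Complex.one_im, zero_sub, abs_neg] at this; linarith)).differentiableWithinAt

lemma zdisc {ε : ℝ} (hε : 0 < ε) (hε1 : ε ≤ 1 / 12) : ∃ L₀ ≥ (4 : ℝ), ∀ γ τ δ R : ℝ, L₀ ≤ Real.log |γ| → |γ| ≤ |τ| →
    |τ| ≤ 2 * |γ| → (Real.log |γ| ^ (2 / 3 + 4 * ε))⁻¹ ≤ δ → δ ≤ 1 / 4 → R ≤ 1 / 2 →
    R ≤ δ + (Real.log |γ| ^ (2 / 3 + ε))⁻¹ / 2 →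
    ∀ z ∈ ball ((1 + δ : ℝ) + τ * Complex.I : ℂ) R, ‖riemannZeta z‖ ≤
      exp (Real.log |γ| ^ ε / 1000) * ‖riemannZeta ((1 + δ : ℝ) + τ * Complex.I)‖ := by
  obtain ⟨L₁, hL₁, h1⟩ := zb hε (by linarith)
  obtain ⟨L₂, hL₂, h2⟩ := evL hε 1
  refine ⟨max L₁ L₂, hL₁.trans (le_max_left _ _), fun γ τ δ R hL ht1 ht2 hd hd1 hR hRd z hz => ?_⟩
  have hLa := (le_max_left _ _).trans hL
  have hLb := (le_max_right _ _).trans hL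
  have h3 := h1 γ hLa z
  obtain ⟨-, h4⟩ := h2 _ hLb
  set L := Real.log |γ|
  have hL0 : 0 < L := by linarith
  obtain ⟨i1, i2⟩ := im_bd hz
  simp only [Complex.add_re, Complex.add_im, Complex.ofReal_re, Complex.ofReal_im, Complex.mul_re, Complex.mul_im, Complex.I_re,
    Complex.I_im, mul_zero, mul_one, zero_mul, sub_zero, add_zero, zero_add] at i1 i2
  have i3 := abs_sub_abs_le_abs_sub z.im τ
  have i4 := abs_sub_abs_le_abs_sub τ z.im
  rw [abs_sub_comm τ] at i4
  rw [abs_lt] at i1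
  have h5 := h3 (by linarith) (by linarith) (by linarith) (by linarith)
  have hX : 0 < L ^ (2 / 3 + 4 * ε) := by positivity
  have hd0 : 0 < δ := lt_of_lt_of_le (by positivity) hd
  have h6 := zinv (σ := 1 + δ) (by linarith) τ
  rw [add_sub_cancel_left] at h6
  have h7 : 1 / δ ≤ L ^ (2 / 3 + 4 * ε) := by
    rw [one_div]; exact inv_le_of_inv_le₀ hX hd
  have h8 : L ^ (2 / 3 + 4 * ε) ≤ L := by
    calc L ^ (2 / 3 + 4 * ε) ≤ L ^ (1 : ℝ) := rpow_le_rpow_of_exponent_le (by linarith) (by linarith)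
      _ = L := rpow_one L
  set Z := ‖riemannZeta ((1 + δ : ℝ) + τ * Complex.I)‖
  have hZ : 0 ≤ Z := norm_nonneg _
  have h9 : 1 ≤ (3 * L) * Z := h6.trans (by gcongr; linarith)
  calc ‖riemannZeta z‖ ≤ 52 * L * 1 := by linarith
    _ ≤ 52 * L * (3 * L * Z) := by gcongr
    _ = 156 * L ^ 2 * Z := by ring
    _ ≤ _ := by gcongr

lemma zf {ε : ℝ} (hε : 0 < ε) (hε1 : ε ≤ 1 / 12) : ∃ L₀ ≥ (4 : ℝ), ∀ ρ : ℂ, L₀ ≤ Real.log |ρ.im| →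
    1 - (Real.log |ρ.im| ^ (2 / 3 + 3 * ε))⁻¹ / 7 < ρ.re → riemannZeta ρ ≠ 0 := by
  obtain ⟨L₁, hL₁, h1⟩ := zdisc hε hε1
  obtain ⟨A, hA, h2⟩ := ld_one
  obtain ⟨L₂, hL₂, h3⟩ := evL hε (6 * A + 4)
  refine ⟨max L₁ L₂, hL₁.trans (le_max_left _ _), fun ρ hL hρ hζ => ?_⟩
  have hLa := (le_max_left _ _).trans hL
  have hLb := (le_max_right _ _).trans hL
  have hρ1 : ρ.re < 1 := by
    by_contra h; exact riemannZeta_ne_zero_of_one_le_re (not_lt.1 h) hζ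
  have g1 : 1 ≤ |ρ.im| := by linarith [(log_im (hL₁.trans hLa) (by linarith) (by linarith [abs_nonneg ρ.im])).1]
  obtain ⟨h4, -⟩ := h3 _ hLb
  have h5 := h1 ρ.im
  set L := Real.log |ρ.im|
  have hL0 : 0 < L := by linarith
  set u := L ^ ε with hu
  set X := L ^ (2 / 3 + ε) with hX
  have hX1 : 1 ≤ X := one_le_rpow (by linarith) (by linarith)
  have e3 : L ^ (2 / 3 + 3 * ε) = u ^ 2 * X := by
    rw [hu, hX, ← rpow_mul_natCast hL0.le, ← rpow_add hL0]; congr 1; push_cast; ring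
  have e4 : L ^ (2 / 3 + 4 * ε) = u ^ 3 * X := by
    rw [hu, hX, ← rpow_mul_natCast hL0.le, ← rpow_add hL0]; congr 1; push_cast; ring
  rw [e3] at hρ
  rw [e4] at h5
  have hu4 : 4 ≤ u := by linarith
  have hu0 : 0 < u := by linarith
  have hX0 : 0 < X := by linarith
  set δ := (u ^ 2 * X)⁻¹ with hδ
  have hδ0 : 0 < δ := by positivity
  have huX : 16 * X ≤ u ^ 2 * X := by gcongr; nlinarith
  have hδX : δ ≤ X⁻¹ / 16 := by
    rw [hδ, show X⁻¹ / 16 = (16 * X)⁻¹ by rw [mul_inv]; ring]; exact inv_anti₀ (by positivity) huX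
  have hXi : X⁻¹ ≤ 1 := inv_le_one_of_one_le₀ hX1
  have hXi0 : 0 < X⁻¹ := by positivity
  have hde : (u ^ 3 * X)⁻¹ ≤ δ := inv_anti₀ (by positivity) (by gcongr <;> [linarith; norm_num])
  have hM : 0 < u / 1000 := by positivity
  have hnz : ∀ (τ : ℝ) (z : ℂ), z ∈ ball ((1 + δ : ℝ) + τ * Complex.I : ℂ) (X⁻¹ / 2) → riemannZeta z = 0 →
      z.re < ((1 + δ : ℝ) + τ * Complex.I : ℂ).re := by
    intro τ z _ hz
    have : z.re < 1 := by
      by_contra h; exact riemannZeta_ne_zero_of_one_le_re (not_lt.1 h) hz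
    simp; linarith
  have hc0 : ∀ τ : ℝ, riemannZeta ((1 + δ : ℝ) + τ * Complex.I : ℂ) ≠ 0 := fun τ =>
    riemannZeta_ne_zero_of_one_le_re (by simp; linarith)
  have k1 := (landau (f := riemannZeta) (c := (1 + δ : ℝ) + ρ.im * Complex.I) (R := X⁻¹ / 2) (by positivity) hM
    (zdiff (by linarith) (by simpa using g1)) (hc0 _)
    (h5 _ δ _ hLa le_rfl (by linarith) hde (by linarith) (by linarith) (by linarith)) (hnz _)).2 ρ
    (by
      rw [mem_closedBall, dist_comm, dist_eq_norm]
      have : (((1 + δ : ℝ) + ρ.im * Complex.I : ℂ) - ρ) = ((1 + δ - ρ.re : ℝ) : ℂ) := by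
        simp [Complex.ext_iff]
      rw [this, Complex.norm_real, norm_of_nonneg (by linarith)]; linarith) hζ
  have k2 := (landau (f := riemannZeta) (c := (1 + δ : ℝ) + (2 * ρ.im : ℝ) * Complex.I) (R := X⁻¹ / 2) (by positivity) hM
    (zdiff (by linarith) (by simp; linarith)) (hc0 _)
    (h5 _ δ _ hLa (by rw [abs_mul, abs_two]; linarith) (by rw [abs_mul, abs_two]) hde
      (by linarith) (by linarith) (by linarith)) (hnz _)).1
  have k3 := t341 (σ := 1 + δ) (by linarith) ρ.im
  have k4 := h2 (1 + δ) (by linarith) (by linarith)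
  have k5 : (1 / (((1 + δ : ℝ) + ρ.im * Complex.I : ℂ) - ρ)).re = 1 / (1 + δ - ρ.re) := by
    have : (((1 + δ : ℝ) + ρ.im * Complex.I : ℂ) - ρ) = ((1 + δ - ρ.re : ℝ) : ℂ) := by
      simp [Complex.ext_iff]
    rw [this, ← Complex.ofReal_one, ← Complex.ofReal_div, Complex.ofReal_re]
  rw [k5] at k1
  rw [add_sub_cancel_left] at k4
  have k6 : 7 / 8 * (1 / δ) < 1 / (1 + δ - ρ.re) := by
    rw [show 7 / 8 * (1 / δ) = 1 / (8 / 7 * δ) by field_simp]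
    exact one_div_lt_one_div_of_lt (by linarith) (by linarith)
  have k7 : 1 / δ = u ^ 2 * X := by rw [hδ, one_div, inv_inv]
  have k8 : 32 * (u / 1000) / (X⁻¹ / 2) = 0.064 * (u * X) := by field_simp; norm_num
  rw [k8] at k1 k2
  rw [k7] at k4 k6
  have k9 : (6 * A + 4) * (u * X) ≤ u * (u * X) := by gcongr
  have k11 : 1 ≤ u * X := one_le_mul_of_one_le_of_one_le (by linarith) hX1
  have k10 : A * 1 ≤ A * (u * X) := by gcongr
  clear h5 h3 h2 h1 hnz hc0
  linarith

lemma ldb {ε : ℝ} (hε : 0 < ε) (hε1 : ε ≤ 1 / 20) : ∃ L₀ ≥ (4 : ℝ), ∀ t σ : ℝ, L₀ ≤ Real.log |t| →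
    1 - (Real.log |t| ^ (2 / 3 + 4 * ε))⁻¹ ≤ σ → σ ≤ 2 → riemannZeta (σ + t * Complex.I) ≠ 0 ∧
      ‖deriv riemannZeta (σ + t * Complex.I) / riemannZeta (σ + t * Complex.I)‖ ≤ Real.log |t| ∧
      ‖riemannZeta (σ + t * Complex.I)‖ ≤ 52 * Real.log |t| := by
  obtain ⟨L₁, hL₁, h1⟩ := zdisc hε (by linarith)
  obtain ⟨L₂, hL₂, h2⟩ := zf hε (by linarith)
  obtain ⟨A, hA, h3⟩ := ld_one
  obtain ⟨L₃, hL₃, h4⟩ := evL hε (100 + A)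
  obtain ⟨L₄, hL₄, h5⟩ := zb hε (by linarith)
  refine ⟨max (max L₁ L₄) (max (2 * L₂) L₃), hL₁.trans ((le_max_left _ _).trans (le_max_left _ _)), fun t σ hL hσ hσ2 => ?_⟩
  have hLa := (le_max_left _ _).trans ((le_max_left _ _).trans hL)
  have hLd := (le_max_right _ _).trans ((le_max_left _ _).trans hL)
  have hLb := (le_max_left _ _).trans ((le_max_right _ _).trans hL)
  have hLc := (le_max_right _ _).trans ((le_max_right _ _).trans hL)
  have g1 : 2 ≤ |t| := by linarith [(log_im (hL₁.trans hLa) (by linarith) (by linarith [abs_nonneg t])).1]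
  have h6 := (h4 _ hLc).1
  have h7 := h1 t
  have h8 := h5 t hLd
  have hlog : ∀ z : ℂ, |z.im - t| ≤ 1 → Real.log |t| / 2 ≤ Real.log |z.im| ∧ Real.log |z.im| ≤ 2 * Real.log |t| := by
    intro z hz
    have i3 := abs_sub_abs_le_abs_sub z.im t
    have i4 := abs_sub_abs_le_abs_sub t z.im
    rw [abs_sub_comm t] at i4
    exact (log_im (hL₁.trans hLa) (by linarith) (by linarith)).2
  set L := Real.log |t|
  have hL0 : 0 < L := by linarith
  set u := L ^ ε with hu
  set X := L ^ (2 / 3 + ε) with hX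
  have hX1 : 1 ≤ X := one_le_rpow (by linarith) (by linarith)
  have e3 : L ^ (2 / 3 + 3 * ε) = u ^ 2 * X := by
    rw [hu, hX, ← rpow_mul_natCast hL0.le, ← rpow_add hL0]; congr 1; push_cast; ring
  have e4 : L ^ (2 / 3 + 4 * ε) = u ^ 3 * X := by
    rw [hu, hX, ← rpow_mul_natCast hL0.le, ← rpow_add hL0]; congr 1; push_cast; ring
  have e5 : u * (u ^ 3 * X) ≤ L := calc
    u * (u ^ 3 * X) = L ^ (2 / 3 + 5 * ε) := by
      rw [hu, hX, ← rpow_mul_natCast hL0.le, ← rpow_add hL0, ← rpow_add hL0]; congr 1; push_cast; ring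
    _ ≤ L ^ (1 : ℝ) := rpow_le_rpow_of_exponent_le (by linarith) (by linarith)
    _ = L := rpow_one L
  rw [e4] at hσ h7
  have hu4 : 100 ≤ u := by linarith
  have hu0 : 0 < u := by linarith
  have hX0 : 0 < X := by linarith
  set κ := (u ^ 3 * X)⁻¹ with hκ
  have hY : 1 ≤ u ^ 3 * X := one_le_mul_of_one_le_of_one_le (one_le_pow₀ (by linarith)) hX1
  have hκ0 : 0 < κ := by positivity
  have hκ1 : κ * 100 ≤ (u ^ 2 * X)⁻¹ := by
    rw [hκ, show (u ^ 3 * X)⁻¹ = (u ^ 2 * X)⁻¹ * u⁻¹ by rw [← mul_inv]; congr 1; ring, mul_assoc]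
    refine mul_le_of_le_one_right (by positivity) ?_
    rw [← div_eq_inv_mul, div_le_one hu0]; exact hu4
  have hκ2 : (u ^ 2 * X)⁻¹ ≤ X⁻¹ := inv_anti₀ hX0 (le_mul_of_one_le_left hX0.le (one_le_pow₀ (by linarith)))
  have hXi : X⁻¹ ≤ 1 := inv_le_one_of_one_le₀ hX1
  have hre : (σ + t * Complex.I : ℂ).re = σ := by simp
  have him : (σ + t * Complex.I : ℂ).im = t := by simp
  have hz52 := h8 (σ + t * Complex.I) (by rw [him]; linarith) (by rw [him]; linarith) (by rw [hre]; linarith)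
    (by rw [hre]; linarith)
  have hnz : ∀ z ∈ ball ((1 + κ : ℝ) + t * Complex.I : ℂ) (8 * κ), riemannZeta z ≠ 0 := by
    intro z hz
    obtain ⟨i1, i2⟩ := im_bd hz
    simp only [Complex.add_re, Complex.add_im, Complex.ofReal_re, Complex.ofReal_im, Complex.mul_re, Complex.mul_im, Complex.I_re,
      Complex.I_im, mul_zero, mul_one, zero_mul, sub_zero, add_zero, zero_add] at i1 i2
    obtain ⟨l1, l2⟩ := hlog z (by linarith)
    refine h2 z (by linarith) ?_
    have := pwl (L := L) (L' := Real.log |z.im|) (p := 2 / 3 + 3 * ε) (by linarith) l2 (by linarith) (by linarith)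
    rw [rpow_neg (by linarith), rpow_neg (by linarith), e3] at this
    rw [abs_lt] at i1
    linarith
  rcases le_or_gt (1 + κ) σ with hc | hc
  · refine ⟨riemannZeta_ne_zero_of_one_le_re (by rw [hre]; linarith), ?_, hz52⟩
    refine (lam_norm (by linarith) t).trans ((h3 σ (by linarith) hσ2).trans ?_)
    have : 1 / (σ - 1) ≤ u ^ 3 * X := by
      rw [one_div]; exact inv_le_of_inv_le₀ (by positivity) (by linarith)
    have j1 := mul_le_mul_of_nonneg_right h6 (by linarith : 0 ≤ u ^ 3 * X)
    have j2 := mul_le_mul_of_nonneg_left hY hA.le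
    linarith
  · have hmem : (σ + t * Complex.I : ℂ) ∈ closedBall ((1 + κ : ℝ) + t * Complex.I : ℂ) (8 * κ / 4) := by
      rw [mem_closedBall, dist_eq_norm]
      rw [show (σ + t * Complex.I : ℂ) - ((1 + κ : ℝ) + t * Complex.I) = ((σ - (1 + κ) : ℝ) : ℂ) by push_cast; ring,
        Complex.norm_real, norm_eq_abs, abs_le]
      constructor <;> linarith
    refine ⟨hnz _ (closedBall_subset_ball (by linarith) hmem), ?_, hz52⟩
    refine (ld_bd (M := u / 1000) (by positivity) (by positivity) (zdiff (by linarith) (by simp; linarith)) hnz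
      (h7 _ κ _ hLa le_rfl (by linarith) le_rfl (by linarith) (by linarith) (by linarith)) hmem).trans ?_
    have : 8 * (u / 1000) / (8 * κ) = u * (u ^ 3 * X) / 1000 := by rw [hκ]; field_simp
    rw [this]; linarith
end VK

namespace VK
open UnitAddTorus Finset Metric

noncomputable def Ph (s : ℂ) : ℂ := -(deriv riemannZeta₁ s / riemannZeta₁ s) - riemannZeta₀ s

lemma Ph_diff {s : ℂ} (h : riemannZeta₁ s ≠ 0) : DifferentiableAt ℂ Ph s := by
  unfold Ph
  exact ((differentiable_riemannZeta₁.deriv s).div (differentiable_riemannZeta₁ s) h).neg.sub (differentiable_riemannZeta₀ s)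

lemma Ph_eq {s : ℂ} (hs : s ≠ 1) (h : riemannZeta₁ s ≠ 0) : Ph s = -(deriv riemannZeta s / riemannZeta s) - riemannZeta s := by
  rw [Ph, ld_eq hs h, riemannZeta_eq_inv_sub_add hs]; ring

lemma region {ε : ℝ} (hε : 0 < ε) (hε1 : ε ≤ 1 / 20) : ∃ C > (0 : ℝ), ∃ T₁ ≥ (3 : ℝ), ∀ T ≥ T₁, ∀ s : ℂ,
    1 - (Real.log T ^ (2 / 3 + 4 * ε))⁻¹ ≤ s.re → s.re ≤ 2 → |s.im| ≤ T →
      riemannZeta₁ s ≠ 0 ∧ ‖Ph s‖ ≤ C * (1 + |s.im|) ^ (1 / 2 : ℝ) := by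
  obtain ⟨L₀, hL₀, h1⟩ := ldb hε hε1
  let K : Set ℂ := Set.Icc 1 2 ×ℂ Set.Icc (-exp L₀) (exp L₀)
  have hK : IsCompact K := isCompact_Icc.reProdIm isCompact_Icc
  have hU : IsOpen {s : ℂ | riemannZeta₁ s ≠ 0} := isOpen_ne_fun differentiable_riemannZeta₁.continuous continuous_const
  obtain ⟨δ, hδ, h2⟩ := hK.exists_cthickening_subset_open hU (fun s hs => z1_ne (Complex.mem_reProdIm.1 hs).1.1)
  obtain ⟨C, hC⟩ := (hK.cthickening (r := δ)).exists_bound_of_continuousOn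
    (fun s hs => (Ph_diff (h2 hs)).continuousAt.continuousWithinAt)
  have hev : ∀ᶠ T : ℝ in atTop, (Real.log T ^ (2 / 3 + 4 * ε))⁻¹ ≤ δ :=
    (tendsto_inv_atTop_zero.comp ((tendsto_rpow_atTop (by positivity)).comp tendsto_log_atTop)).eventually_le_const hδ
  obtain ⟨T₀, hT₀⟩ := eventually_atTop.1 hev
  refine ⟨max C 200, by positivity, max 3 T₀, le_max_left _ _, fun T hT s hs1 hs2 hsT => ?_⟩
  have hT3 := (le_max_left _ _).trans hT
  have hp : 1 ≤ (1 + |s.im|) ^ (1 / 2 : ℝ) := one_le_rpow (by linarith [abs_nonneg s.im]) (by norm_num)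
  rcases le_or_gt |s.im| (exp L₀) with hc | hc
  · have hδT := hT₀ T ((le_max_right _ _).trans hT)
    have hm : s ∈ cthickening δ K := by
      refine mem_cthickening_of_dist_le s ((max s.re 1 : ℝ) + s.im * Complex.I) δ K ?_ ?_
      · rw [Complex.mem_reProdIm]
        simp only [Complex.add_re, Complex.add_im, Complex.ofReal_re, Complex.ofReal_im, Complex.mul_re, Complex.mul_im,
          Complex.I_re, Complex.I_im, mul_zero, mul_one, zero_mul, sub_zero, add_zero, zero_add]
        exact ⟨⟨le_max_right _ _, max_le hs2 (by norm_num)⟩, abs_le.1 hc⟩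
      · rw [dist_eq_norm]
        have : s - ((max s.re 1 : ℝ) + s.im * Complex.I) = ((s.re - max s.re 1 : ℝ) : ℂ) := by simp [Complex.ext_iff]
        rw [this, Complex.norm_real, norm_eq_abs, abs_sub_comm, abs_of_nonneg (by linarith [le_max_left s.re 1]),
          sub_le_iff_le_add]
        exact max_le (by linarith) (by linarith)
    refine ⟨h2 hm, (hC s hm).trans ((le_max_left C 200).trans (le_mul_of_one_le_right (by positivity) hp))⟩
  · have hL := (Real.le_log_iff_exp_le ((exp_pos _).trans hc)).2 hc.le
    have ht0 : 0 < |s.im| := (exp_pos _).trans hc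
    obtain ⟨a1, a2, a3⟩ := h1 s.im s.re hL (by
      refine le_trans ?_ hs1
      have : Real.log |s.im| ≤ Real.log T := Real.log_le_log ht0 hsT
      have h0 : 0 < Real.log |s.im| := by linarith
      gcongr) hs2
    rw [Complex.re_add_im] at a1 a2 a3
    have hs : s ≠ 1 := fun h => by rw [h] at ht0; simp at ht0
    have hz : riemannZeta₁ s ≠ 0 := fun h => a1 (by rw [riemannZeta_eq_inv_sub_mul hs, h, mul_zero])
    refine ⟨hz, ?_⟩
    rw [Ph_eq hs hz]
    have h5 := Real.log_le_rpow_div ht0.le (show (0 : ℝ) < 1 / 2 by norm_num)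
    have h6 : |s.im| ^ (1 / 2 : ℝ) ≤ (1 + |s.im|) ^ (1 / 2 : ℝ) := by gcongr; linarith
    have h7 := norm_sub_le (-(deriv riemannZeta s / riemannZeta s)) (riemannZeta s)
    rw [norm_neg] at h7
    have h8 : 200 * (1 + |s.im|) ^ (1 / 2 : ℝ) ≤ max C 200 * (1 + |s.im|) ^ (1 / 2 : ℝ) := by gcongr; exact le_max_right _ _
    linarith
end VK

namespace VK
open UnitAddTorus Finset Metric

noncomputable def Kr (s : ℂ) : ℂ := 1 / s - 1 / (s + 1)

lemma Kr_bd {s : ℂ} (hs : 1 / 2 ≤ s.re) : ‖Kr s‖ ≤ 6 * (1 + |s.im|) ^ (-2 : ℝ) := by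
  have h1 : s ≠ 0 := fun h => by rw [h] at hs; norm_num at hs
  have h2 : s + 1 ≠ 0 := fun h => by
    have := congrArg Complex.re h; simp at this; linarith
  have e : Kr s = 1 / (s * (s + 1)) := by rw [Kr]; field_simp; ring
  have a1 := Complex.abs_im_le_norm s
  have a2 := Complex.re_le_norm s
  have a3 := Complex.abs_im_le_norm (s + 1)
  have a4 := Complex.re_le_norm (s + 1)
  simp only [Complex.add_re, Complex.one_re, Complex.add_im, Complex.one_im, add_zero] at a3 a4
  have ht := abs_nonneg s.im
  have h5 : (1 + |s.im|) ^ 2 ≤ 6 * (‖s‖ * ‖s + 1‖) := by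
    have : ((1 + |s.im|) / 3) * ((1 + |s.im|) / 2) ≤ ‖s‖ * ‖s + 1‖ := by gcongr <;> linarith
    linarith
  rw [e, norm_div, norm_mul, norm_one, rpow_neg (by positivity), rpow_two, ← div_eq_mul_inv, div_le_div_iff₀
    (by have := norm_pos_iff.2 h1; have := norm_pos_iff.2 h2; positivity) (by positivity)]
  linarith

lemma Kr_diff {s : ℂ} (hs : 0 < s.re) : DifferentiableAt ℂ Kr s := by
  have h1 : s ≠ 0 := fun h => by rw [h] at hs; simp at hs
  have h2 : s + 1 ≠ 0 := fun h => by
    have := congrArg Complex.re h; simp at this; linarith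
  unfold Kr
  fun_prop (disch := assumption)

lemma vl_cont {f : ℂ → ℂ} {c : ℝ} (h : ∀ t : ℝ, DifferentiableAt ℂ f (c + t * Complex.I)) :
    Continuous fun t : ℝ => f (c + t * Complex.I) :=
  continuous_iff_continuousAt.2 fun t => ContinuousAt.comp (f := fun t : ℝ => (c + t * Complex.I : ℂ)) (h t).continuousAt (by fun_prop)

lemma Kr_int {c : ℝ} (hc : 1 / 2 ≤ c) : Integrable fun t : ℝ => Kr (c + t * Complex.I) := by
  have h1 : Integrable fun t : ℝ => 6 * (1 + ‖t‖) ^ (-2 : ℝ) := (integrable_one_add_norm (by simp)).const_mul 6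
  refine h1.mono' (vl_cont fun t => Kr_diff (by simp; linarith)).aestronglyMeasurable (Eventually.of_forall fun t => ?_)
  have := Kr_bd (s := c + t * Complex.I) (by simpa using hc)
  simpa using this

lemma kern {c y : ℝ} (hc : 1 / 2 ≤ c) (hy : 0 < y) :
    ∫ t : ℝ, (y : ℂ) ^ (-(c + t * Complex.I)) * Kr (c + t * Complex.I) = 2 * π * (max (1 - y) 0 : ℝ) := by
  set f : ℝ → ℂ := fun t => Set.indicator (Set.Ioc 0 1) (fun _ => 1 : ℝ → ℂ) t -
    Set.indicator (Set.Ioc 0 1) (fun t => (t : ℂ) ^ (1 : ℂ) : ℝ → ℂ) t with hf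
  have hm : ∀ s : ℂ, 0 < s.re → HasMellin f s (Kr s) := fun s hs => by
    have h1 := hasMellin_one_Ioc hs
    have h2 := hasMellin_cpow_Ioc 1 (s := s) (by simp; linarith)
    have := hasMellin_sub h1.1 h2.1
    rwa [h1.2, h2.2] at this
  have hfx : ∀ t : ℝ, 0 < t → f t = ((max (1 - t) 0 : ℝ) : ℂ) := by
    intro t ht
    by_cases h : t ≤ 1
    · simp [hf, ht, h]
    · have : max (1 - t) 0 = 0 := max_eq_right (by linarith)
      simp [hf, h, this]
  have hcont : ContinuousAt f y := by
    have h1 : ContinuousAt (fun t : ℝ => ((max (1 - t) 0 : ℝ) : ℂ)) y := by fun_prop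
    exact h1.congr (by filter_upwards [lt_mem_nhds hy] with t ht using (hfx t ht).symm)
  have hre : ∀ t : ℝ, 0 < (c + t * Complex.I : ℂ).re := fun t => by simp; linarith
  have he : ∀ t : ℝ, mellin f (c + t * Complex.I) = Kr (c + t * Complex.I) := fun t => (hm _ (hre t)).2
  have hv : Complex.VerticalIntegrable (mellin f) c := by
    unfold Complex.VerticalIntegrable
    simp only [he]; exact Kr_int hc
  have := mellinInv_mellin_eq c f hy (hm c (by simp; linarith)).1 hv hcont
  rw [mellinInv] at this
  simp only [he, smul_eq_mul] at this
  rw [hfx y hy] at this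
  rw [← this, Complex.real_smul]
  push_cast
  have hpi : (π : ℂ) ≠ 0 := by exact_mod_cast pi_ne_zero
  rw [← mul_assoc, mul_one_div_cancel (mul_ne_zero two_ne_zero hpi), one_mul]

noncomputable def av (n : ℕ) : ℝ := if n = 0 then 0 else ArithmeticFunction.vonMangoldt n - 1

lemma av_sum {s : ℂ} (hs : 1 < s.re) : HasSum (fun n : ℕ => (av n : ℂ) * (n : ℂ) ^ (-s)) (Ph s) := by
  have hs1 : s ≠ 1 := fun h => by rw [h] at hs; simp at hs
  rw [Ph_eq hs1 (z1_ne hs.le)]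
  have h2 := LSeriesHasSum_one hs
  unfold LSeriesHasSum at h2
  convert! (lam_sum hs).sub h2 using 1
  funext n
  rw [LSeries.term_def, av]
  split_ifs with h0
  · simp [h0]
  · rw [Complex.cpow_neg, Pi.one_apply]; push_cast; ring

lemma av_abs {c : ℝ} (hc : 1 < c) : Summable fun n : ℕ => |av n| * (n : ℝ) ^ (-c) := by
  have h := (av_sum (s := c) (by simpa using hc)).summable.norm
  refine h.congr fun n => ?_
  rcases Nat.eq_zero_or_pos n with rfl | hn
  · simp [av]
  · rw [norm_mul, Complex.norm_real, norm_eq_abs, Complex.norm_natCast_cpow_of_pos hn]; simp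

lemma perron {c x : ℝ} (hc : 1 < c) (hx : 0 < x) :
    ∫ t : ℝ, (x : ℂ) ^ (c + t * Complex.I : ℂ) * Kr (c + t * Complex.I) * Ph (c + t * Complex.I) =
      ((2 * π * ∑ n ∈ Icc 1 ⌊x⌋₊, (ArithmeticFunction.vonMangoldt n - 1) * (1 - n / x) : ℝ) : ℂ) := by
  set F : ℕ → ℝ → ℂ := fun n t => (av n : ℂ) * (((n / x : ℝ) : ℂ) ^ (-(c + t * Complex.I)) * Kr (c + t * Complex.I)) with hF
  have hxc : (x : ℂ) ≠ 0 := by exact_mod_cast hx.ne'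
  have hKi := Kr_int (c := c) (by linarith)
  have hnx : ∀ n : ℕ, 0 < n → 0 < (n / x : ℝ) := fun n hn => by positivity
  have hFn : ∀ n t, ‖F n t‖ = |av n| * (n : ℝ) ^ (-c) * x ^ c * ‖Kr (c + t * Complex.I)‖ := by
    intro n t
    rcases Nat.eq_zero_or_pos n with rfl | hn
    · simp [hF, av]
    · simp only [hF]
      rw [norm_mul, norm_mul, Complex.norm_real, norm_eq_abs, Complex.norm_cpow_eq_rpow_re_of_pos (hnx n hn)]
      simp only [Complex.neg_re, Complex.add_re, Complex.ofReal_re, Complex.mul_re, Complex.I_re, mul_zero, Complex.ofReal_im,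
        Complex.I_im, mul_one, sub_self, add_zero]
      rw [div_rpow (by positivity) hx.le, rpow_neg hx.le, div_inv_eq_mul]; ring
  have hFm : ∀ n, Continuous (F n) := by
    intro n
    rcases Nat.eq_zero_or_pos n with rfl | hn
    · simp only [hF, av, if_true, Complex.ofReal_zero, zero_mul]; exact continuous_const
    · have h0 : ((n / x : ℝ) : ℂ) ≠ 0 := by exact_mod_cast (hnx n hn).ne'
      refine continuous_const.mul (Continuous.mul ?_ (vl_cont fun t => Kr_diff (by simp; linarith)))
      exact Continuous.const_cpow (by fun_prop) (Or.inl h0)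
  have h1 := hasSum_integral_of_summable_integral_norm (μ := volume) (F := F)
    (fun n => (hKi.norm.const_mul (|av n| * (n : ℝ) ^ (-c) * x ^ c)).mono' (hFm n).aestronglyMeasurable
      (Eventually.of_forall fun t => (hFn n t).le))
    (by
      simp only [hFn, integral_const_mul]
      exact ((av_abs hc).mul_right _).mul_right _)
  have h2 : ∀ t : ℝ, ∑' n, F n t = (x : ℂ) ^ (c + t * Complex.I : ℂ) * Kr (c + t * Complex.I) * Ph (c + t * Complex.I) := by
    intro t
    have h3 := (av_sum (s := c + t * Complex.I) (by simpa using hc)).mul_left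
      ((x : ℂ) ^ (c + t * Complex.I : ℂ) * Kr (c + t * Complex.I))
    rw [← h3.tsum_eq]
    refine tsum_congr fun n => ?_
    rcases Nat.eq_zero_or_pos n with rfl | hn
    · simp [hF, av]
    · simp only [hF]
      rw [Complex.ofReal_div, div_eq_mul_inv, ← Complex.ofReal_inv, Complex.mul_cpow_ofReal_nonneg (by positivity) (by positivity),
        Complex.ofReal_inv, Complex.inv_cpow _ _ (by rw [Complex.arg_ofReal_of_nonneg hx.le]; exact pi_pos.ne),
        Complex.cpow_neg (x : ℂ), inv_inv, Complex.ofReal_natCast]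
      ring
  simp only [h2] at h1
  refine h1.unique ?_
  have h4 : ∀ n, ∫ t, F n t = ((2 * π * (av n * max (1 - n / x) 0) : ℝ) : ℂ) := by
    intro n
    rcases Nat.eq_zero_or_pos n with rfl | hn
    · simp [hF, av]
    · simp only [hF]
      rw [integral_const_mul, kern (by linarith) (hnx n hn)]; push_cast; ring
  simp only [h4]
  rw [Complex.hasSum_ofReal, mul_sum]
  have h5 : ∀ n ∈ Icc 1 ⌊x⌋₊, 2 * π * ((ArithmeticFunction.vonMangoldt n - 1) * (1 - n / x)) =
      2 * π * (av n * max (1 - n / x) 0) := by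
    intro n hn
    rw [Finset.mem_Icc] at hn
    have : (n : ℝ) ≤ x := (Nat.le_floor_iff hx.le).1 hn.2
    rw [av, if_neg (by omega), max_eq_left]
    rw [sub_nonneg, div_le_one hx]; exact this
  rw [sum_congr rfl h5]
  refine hasSum_sum_of_ne_finset_zero fun n hn => ?_
  rcases Nat.eq_zero_or_pos n with rfl | hn0
  · simp [av]
  · have : ⌊x⌋₊ < n := by rw [Finset.mem_Icc] at hn; omega
    rw [max_eq_right, mul_zero, mul_zero]
    rw [sub_nonpos, one_le_div hx]; exact ((Nat.floor_lt hx.le).1 this).le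
end VK

namespace VK
open UnitAddTorus Finset Metric

lemma shift : ∃ J > (0 : ℝ), ∀ C T η c x : ℝ, 0 < C → 1 ≤ T → 0 < η → η ≤ 1 / 2 → 1 < c → c ≤ 2 → 1 ≤ x →
    (∀ s : ℂ, 1 - η ≤ s.re → s.re ≤ 2 → |s.im| ≤ T → riemannZeta₁ s ≠ 0 ∧ ‖Ph s‖ ≤ C * (1 + |s.im|) ^ (1 / 2 : ℝ)) →
    (∀ s : ℂ, 1 < s.re → s.re ≤ 2 → ‖Ph s‖ ≤ C * (1 + |s.im|) ^ (1 / 2 : ℝ)) →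
    |∑ n ∈ Icc 1 ⌊x⌋₊, (ArithmeticFunction.vonMangoldt n - 1) * (1 - n / x)| ≤
      J * C * (x ^ (1 - η) + x ^ c * T ^ (-(1 / 4) : ℝ)) := by
  set w : ℝ → ℝ := fun t => (1 + ‖t‖) ^ (-(5 / 4) : ℝ) with hw
  have hwi : Integrable w := integrable_one_add_norm (by norm_num)
  have hw0 : ∀ t, 0 ≤ w t := fun t => by positivity
  set J := ∫ t, w t
  have hJ : 0 ≤ J := integral_nonneg hw0
  refine ⟨6 * J + 24, by positivity, fun C T η c x hC hT hη hη1 hc hc2 hx hA hB => ?_⟩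
  have hx0 : 0 < x := by linarith
  set g : ℂ → ℂ := fun s => (x : ℂ) ^ s * Kr s * Ph s with hg
  have hpt : ∀ t : ℝ, (1 + |t|) ^ (-2 : ℝ) * (1 + |t|) ^ (1 / 2 : ℝ) ≤ w t ∧
      (T ≤ |t| → (1 + |t|) ^ (-2 : ℝ) * (1 + |t|) ^ (1 / 2 : ℝ) ≤ T ^ (-(1 / 4) : ℝ) * w t) := by
    intro t
    have h1 : 1 ≤ 1 + |t| := by linarith [abs_nonneg t]
    rw [← rpow_add (by linarith), hw]
    simp only [norm_eq_abs]
    refine ⟨rpow_le_rpow_of_exponent_le h1 (by norm_num), fun h => ?_⟩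
    calc (1 + |t|) ^ (-2 + 1 / 2 : ℝ) = (1 + |t|) ^ (-(1 / 4) : ℝ) * (1 + |t|) ^ (-(5 / 4) : ℝ) := by
          rw [← rpow_add (by linarith)]; norm_num
      _ ≤ _ := mul_le_mul_of_nonneg_right (rpow_le_rpow_of_nonpos (by linarith : (0 : ℝ) < T)
        (by linarith : T ≤ 1 + |t|) (by norm_num)) (by positivity)
  have hgn : ∀ s : ℂ, 1 / 2 ≤ s.re → ‖Ph s‖ ≤ C * (1 + |s.im|) ^ (1 / 2 : ℝ) →
      ‖g s‖ ≤ 6 * C * x ^ s.re * ((1 + |s.im|) ^ (-2 : ℝ) * (1 + |s.im|) ^ (1 / 2 : ℝ)) := by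
    intro s h1 h2
    simp only [hg]
    rw [norm_mul, norm_mul, Complex.norm_cpow_eq_rpow_re_of_pos hx0]
    calc x ^ s.re * ‖Kr s‖ * ‖Ph s‖ ≤ x ^ s.re * (6 * (1 + |s.im|) ^ (-2 : ℝ)) * (C * (1 + |s.im|) ^ (1 / 2 : ℝ)) := by
          gcongr; exact Kr_bd h1
      _ = _ := by ring
  have hgd : ∀ s : ℂ, 1 / 2 ≤ s.re → riemannZeta₁ s ≠ 0 → DifferentiableAt ℂ g s := fun s h1 h2 => by
    refine DifferentiableAt.mul (DifferentiableAt.mul ?_ (Kr_diff (by linarith))) (Ph_diff h2)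
    exact differentiableAt_id.const_cpow (Or.inl (by exact_mod_cast hx0.ne'))
  have hre : ∀ σ t : ℝ, (σ + t * Complex.I : ℂ).re = σ := fun σ t => by simp
  have him : ∀ σ t : ℝ, (σ + t * Complex.I : ℂ).im = t := fun σ t => by simp
  have hbc : ∀ t : ℝ, ‖g (c + t * Complex.I)‖ ≤ 6 * C * x ^ c * ((1 + |t|) ^ (-2 : ℝ) * (1 + |t|) ^ (1 / 2 : ℝ)) := fun t => by
    have := hgn (c + t * Complex.I) (by rw [hre]; linarith) (hB _ (by rw [hre]; linarith) (by rw [hre]; linarith))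
    rwa [hre, him] at this
  have hxc : 0 < x ^ c := by positivity
  have hint : Integrable fun t : ℝ => g (c + t * Complex.I) :=
    (hwi.const_mul (6 * C * x ^ c)).mono' (vl_cont fun t => hgd _ (by rw [hre]; linarith)
      (z1_ne (by rw [hre]; linarith))).aestronglyMeasurable
      (Eventually.of_forall fun t => (hbc t).trans (mul_le_mul_of_nonneg_left (hpt t).1 (by positivity)))
  have hT0 : 0 < T ^ (-(1 / 4) : ℝ) := by positivity
  have htail : ‖∫ t in (Set.Ioc (-T) T)ᶜ, g (c + t * Complex.I)‖ ≤ 6 * C * x ^ c * T ^ (-(1 / 4) : ℝ) * J := by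
    have h1 : ‖∫ t in (Set.Ioc (-T) T)ᶜ, g (c + t * Complex.I)‖ ≤
        ∫ t in (Set.Ioc (-T) T)ᶜ, 6 * C * x ^ c * T ^ (-(1 / 4) : ℝ) * w t := by
      refine norm_integral_le_of_norm_le (hwi.const_mul _).integrableOn
        (ae_restrict_of_forall_mem measurableSet_Ioc.compl fun t ht => ?_)
      have : T ≤ |t| := by
        by_contra h; exact ht ⟨(abs_lt.1 (not_le.1 h)).1, (abs_lt.1 (not_le.1 h)).2.le⟩
      refine (hbc t).trans ?_
      rw [mul_assoc (6 * C * x ^ c)]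
      exact mul_le_mul_of_nonneg_left ((hpt t).2 this) (by positivity)
    refine h1.trans ?_
    rw [← integral_const_mul]
    exact setIntegral_le_integral (hwi.const_mul _) (Eventually.of_forall fun t => by have := hw0 t; positivity)
  have hrect := Complex.integral_boundary_rect_eq_zero_of_differentiableOn g ((1 - η : ℝ) + (-T : ℝ) * Complex.I) (c + T * Complex.I)
    (fun s hs => by
      rw [Complex.mem_reProdIm, hre, hre, him, him, Set.uIcc_of_le (by linarith), Set.uIcc_of_le (by linarith)] at hs
      exact (hgd s (by linarith [hs.1.1]) (hA s hs.1.1 (by linarith [hs.1.2]) (abs_le.2 hs.2)).1).differentiableWithinAt)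
  simp only [hre, him] at hrect
  have hhor : ∀ τ : ℝ, |τ| = T → ‖∫ u : ℝ in (1 - η)..c, g (u + τ * Complex.I)‖ ≤ 12 * C * x ^ c * T ^ (-(1 / 4) : ℝ) := by
    intro τ hτ
    have h1 : ∀ u ∈ Set.uIoc (1 - η) c, ‖g (u + τ * Complex.I)‖ ≤ 6 * C * x ^ c * T ^ (-(1 / 4) : ℝ) := by
      intro u hu
      rw [Set.uIoc_of_le (by linarith)] at hu
      have h2 := hgn (u + τ * Complex.I) (by rw [hre]; linarith [hu.1]) (hA _ (by rw [hre]; linarith [hu.1])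
        (by rw [hre]; linarith [hu.2]) (by rw [him]; exact hτ.le)).2
      rw [hre, him] at h2
      have h3 : w τ ≤ 1 := rpow_le_one_of_one_le_of_nonpos (by linarith [norm_nonneg τ]) (by norm_num)
      calc _ ≤ _ := h2
        _ ≤ 6 * C * x ^ c * (T ^ (-(1 / 4) : ℝ) * 1) := mul_le_mul (mul_le_mul_of_nonneg_left
            (rpow_le_rpow_of_exponent_le hx hu.2) (by positivity))
            (((hpt τ).2 hτ.ge).trans (mul_le_mul_of_nonneg_left h3 hT0.le)) (by positivity) (by positivity)
        _ = _ := by ring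
    refine (intervalIntegral.norm_integral_le_of_norm_le_const h1).trans ?_
    rw [abs_of_nonneg (by linarith), show 12 * C * x ^ c * T ^ (-(1 / 4) : ℝ) = 6 * C * x ^ c * T ^ (-(1 / 4) : ℝ) * 2 by ring]
    gcongr; linarith
  have hleft : ‖∫ y : ℝ in (-T)..T, g ((1 - η : ℝ) + y * Complex.I)‖ ≤ 6 * C * x ^ (1 - η) * J := by
    have h1 : ‖∫ y : ℝ in (-T)..T, g ((1 - η : ℝ) + y * Complex.I)‖ ≤ ∫ y : ℝ in (-T)..T, 6 * C * x ^ (1 - η) * w y := by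
      refine intervalIntegral.norm_integral_le_of_norm_le (by linarith) (Eventually.of_forall fun t ht => ?_)
        (hwi.const_mul _).intervalIntegrable
      have h2 := hgn ((1 - η : ℝ) + t * Complex.I) (by rw [hre]; linarith) (hA _ (by rw [hre])
        (by rw [hre]; linarith) (by rw [him, abs_le]; exact ⟨ht.1.le, ht.2⟩)).2
      rw [hre, him] at h2
      exact h2.trans (mul_le_mul_of_nonneg_left (hpt t).1 (by positivity))
    refine h1.trans ?_
    rw [intervalIntegral.integral_of_le (by linarith), ← integral_const_mul]
    exact setIntegral_le_integral (hwi.const_mul _) (Eventually.of_forall fun t => by have := hw0 t; positivity)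
  have hP := perron hc hx0
  have hsplit := integral_add_compl (μ := volume) (measurableSet_Ioc (a := -T) (b := T)) hint
  rw [← intervalIntegral.integral_of_le (by linarith)] at hsplit
  rw [show (∫ t : ℝ, (x : ℂ) ^ (c + t * Complex.I : ℂ) * Kr (c + t * Complex.I) * Ph (c + t * Complex.I)) =
    ∫ t : ℝ, g (c + t * Complex.I) from rfl, ← hsplit] at hP
  have hmid : ‖∫ t : ℝ in (-T)..T, g (c + t * Complex.I)‖ ≤ 6 * C * x ^ (1 - η) * J + 24 * C * x ^ c * T ^ (-(1 / 4) : ℝ) := by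
    have a1 := hhor (-T) (by rw [abs_neg, abs_of_pos (by linarith)])
    have a2 := hhor T (abs_of_pos (by linarith))
    set I1 := ∫ u : ℝ in (1 - η)..c, g (u + (-T : ℝ) * Complex.I)
    set I2 := ∫ u : ℝ in (1 - η)..c, g (u + T * Complex.I)
    set I3 := ∫ t : ℝ in (-T)..T, g (c + t * Complex.I)
    set I4 := ∫ y : ℝ in (-T)..T, g ((1 - η : ℝ) + y * Complex.I)
    have e : Complex.I * I3 = Complex.I * I4 + I2 - I1 := by
      simp only [smul_eq_mul] at hrect
      linear_combination hrect
    have e2 : ‖I3‖ = ‖Complex.I * I4 + I2 - I1‖ := by rw [← e, norm_mul, Complex.norm_I, one_mul]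
    have e3 := (norm_sub_le (Complex.I * I4 + I2) I1).trans (add_le_add_left (norm_add_le (Complex.I * I4) I2) _)
    rw [norm_mul, Complex.norm_I, one_mul] at e3
    rw [e2]; linarith
  have hN := congrArg norm hP
  rw [Complex.norm_real, norm_eq_abs, abs_mul, abs_of_pos (by positivity)] at hN
  set S := |∑ n ∈ Icc 1 ⌊x⌋₊, (ArithmeticFunction.vonMangoldt n - 1) * (1 - n / x)|
  have h1 := norm_add_le (∫ t : ℝ in (-T)..T, g (c + t * Complex.I)) (∫ t in (Set.Ioc (-T) T)ᶜ, g (c + t * Complex.I))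
  have hS : S ≤ 2 * π * S := le_mul_of_one_le_left (abs_nonneg _) (by linarith [pi_gt_three])
  have h3 : 0 ≤ C * x ^ (1 - η) := by positivity
  clear hgn hgd hpt hA hB hbc hhor hre him hP hsplit
  linarith

lemma psi1 {ε : ℝ} (hε : 0 < ε) (hε1 : ε ≤ 1 / 20) : ∃ C > (0 : ℝ), ∀ᶠ x : ℝ in atTop,
    |∑ n ∈ Icc 1 ⌊x⌋₊, (ArithmeticFunction.vonMangoldt n - 1) * (1 - n / x)| ≤
      C * (x * exp (-(Real.log x ^ (3 / 5 - 3 * ε) / 4))) := by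
  obtain ⟨C, hC, T₁, hT₁, h1⟩ := region hε hε1
  obtain ⟨J, hJ, h2⟩ := shift
  refine ⟨J * C * (1 + exp 1), by positivity, ?_⟩
  have ht : Tendsto (fun x : ℝ => exp (Real.log x ^ (3 / 5 : ℝ))) atTop atTop :=
    tendsto_exp_atTop.comp ((tendsto_rpow_atTop (by norm_num)).comp tendsto_log_atTop)
  filter_upwards [ht.eventually_ge_atTop T₁, tendsto_log_atTop.eventually_ge_atTop 32, eventually_ge_atTop 1] with x hT hL hx
  have hx0 : 0 < x := by linarith
  set L := Real.log x with hLdef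
  have hL0 : 0 < L := by linarith
  have hη : (Real.log (exp (L ^ (3 / 5 : ℝ))) ^ (2 / 3 + 4 * ε))⁻¹ = L ^ (-(3 / 5) * (2 / 3 + 4 * ε)) := by
    rw [Real.log_exp, ← rpow_mul hL0.le, ← rpow_neg hL0.le]; congr 1; ring
  have h3 := h1 _ hT
  rw [hη] at h3
  have hη1 : L ^ (-(3 / 5) * (2 / 3 + 4 * ε)) ≤ 1 / 2 := calc
    L ^ (-(3 / 5) * (2 / 3 + 4 * ε)) ≤ L ^ (-(1 / 5) : ℝ) := rpow_le_rpow_of_exponent_le (by linarith) (by linarith)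
    _ ≤ 32 ^ (-(1 / 5) : ℝ) := rpow_le_rpow_of_nonpos (by norm_num) hL (by norm_num)
    _ = 1 / 2 := by
      rw [show (32 : ℝ) = 2 ^ (5 : ℝ) by norm_num, ← rpow_mul (by norm_num), show (5 : ℝ) * -(1 / 5) = -1 by norm_num,
        rpow_neg_one]; norm_num
  have hLi : L⁻¹ ≤ 1 := inv_le_one_of_one_le₀ (by linarith)
  have h4 := h2 C (exp (L ^ (3 / 5 : ℝ))) _ (1 + L⁻¹) x hC (by linarith) (by positivity) hη1
    (by have : 0 < L⁻¹ := by positivity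
        linarith) (by linarith) hx h3 (fun s hs1 hs2 => by
      refine (h1 (max T₁ |s.im|) (le_max_left _ _) s ?_ hs2 (le_max_right _ _)).2
      have : 0 ≤ Real.log (max T₁ |s.im|) := Real.log_nonneg (by linarith [le_max_left T₁ |s.im|])
      have : 0 ≤ (Real.log (max T₁ |s.im|) ^ (2 / 3 + 4 * ε))⁻¹ := by positivity
      linarith)
  refine h4.trans ?_
  have hxL : ∀ a : ℝ, x ^ a = exp (L * a) := fun a => rpow_def_of_pos hx0 a
  have e1 : x ^ (1 - L ^ (-(3 / 5) * (2 / 3 + 4 * ε))) ≤ x * exp (-(L ^ (3 / 5 - 3 * ε) / 4)) := by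
    rw [sub_eq_add_neg, rpow_add hx0, rpow_one, hxL]
    refine mul_le_mul_of_nonneg_left (exp_le_exp.2 ?_) hx0.le
    rw [mul_neg, neg_le_neg_iff]
    have : L * L ^ (-(3 / 5) * (2 / 3 + 4 * ε)) = L ^ (1 + -(3 / 5) * (2 / 3 + 4 * ε)) := by rw [rpow_add hL0, rpow_one]
    rw [this]
    have h5 : L ^ (3 / 5 - 3 * ε) ≤ L ^ (1 + -(3 / 5) * (2 / 3 + 4 * ε)) :=
      rpow_le_rpow_of_exponent_le (by linarith) (by linarith)
    have : 0 ≤ L ^ (3 / 5 - 3 * ε) := by positivity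
    linarith
  have e2 : x ^ (1 + L⁻¹) * exp (L ^ (3 / 5 : ℝ)) ^ (-(1 / 4) : ℝ) ≤ exp 1 * (x * exp (-(L ^ (3 / 5 - 3 * ε) / 4))) := by
    rw [rpow_add hx0, rpow_one, hxL, mul_inv_cancel₀ hL0.ne', ← exp_mul, mul_comm x, mul_assoc]
    refine mul_le_mul_of_nonneg_left (mul_le_mul_of_nonneg_left (exp_le_exp.2 ?_) hx0.le) (exp_pos _).le
    have h5 : L ^ (3 / 5 - 3 * ε) ≤ L ^ (3 / 5 : ℝ) := rpow_le_rpow_of_exponent_le (by linarith) (by linarith)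
    linarith
  calc _ ≤ J * C * (x * exp (-(L ^ (3 / 5 - 3 * ε) / 4)) + exp 1 * (x * exp (-(L ^ (3 / 5 - 3 * ε) / 4)))) := by gcongr
    _ = _ := by ring
end VK

namespace VK
open UnitAddTorus Finset Metric

noncomputable def DD (x : ℝ) : ℝ := ∑ n ∈ Icc 1 ⌊x⌋₊, (ArithmeticFunction.vonMangoldt n - 1) * (x - n)

lemma sand {y z : ℝ} (hy : 1 ≤ y) (hyz : y ≤ z) :
    (z - y) * Chebyshev.psi y ≤ (z - y) * z + (DD z - DD y) ∧
    (z - y) * (y - 1) + (DD z - DD y) ≤ (z - y) * Chebyshev.psi z := by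
  set q : ℕ → ℝ := fun n => (z - n) - max (y - n) 0 with hq
  have hsub : Icc 1 ⌊y⌋₊ ⊆ Icc 1 ⌊z⌋₊ := Icc_subset_Icc le_rfl (Nat.floor_mono hyz)
  have hle : ∀ n ∈ Icc 1 ⌊z⌋₊, (n : ℝ) ≤ z := fun n hn => (Nat.le_floor_iff (by linarith)).1 (mem_Icc.1 hn).2
  have hley : ∀ n ∈ Icc 1 ⌊y⌋₊, (n : ℝ) ≤ y := fun n hn => (Nat.le_floor_iff (by linarith)).1 (mem_Icc.1 hn).2
  have hD : DD z - DD y = ∑ n ∈ Icc 1 ⌊z⌋₊, ArithmeticFunction.vonMangoldt n * q n - ∑ n ∈ Icc 1 ⌊z⌋₊, q n := by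
    have : DD y = ∑ n ∈ Icc 1 ⌊z⌋₊, (ArithmeticFunction.vonMangoldt n - 1) * max (y - n) 0 := by
      rw [DD, ← sum_subset hsub (f := fun n : ℕ => (ArithmeticFunction.vonMangoldt n - 1) * max (y - n) 0)]
      · exact sum_congr rfl fun n hn => by rw [max_eq_left (by linarith [hley n hn])]
      · intro n hn hn2
        rw [max_eq_right, mul_zero]
        by_contra h
        exact hn2 (mem_Icc.2 ⟨(mem_Icc.1 hn).1, Nat.le_floor (by linarith)⟩)
    rw [this, DD, ← sum_sub_distrib, ← sum_sub_distrib]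
    exact sum_congr rfl fun n _ => by simp only [hq]; ring
  have q0 : ∀ n ∈ Icc 1 ⌊z⌋₊, 0 ≤ q n := fun n hn => by
    have := hle n hn
    simp only [hq]; rcases max_cases (y - (n : ℝ)) 0 with h | h <;> linarith
  have q1 : ∀ n ∈ Icc 1 ⌊z⌋₊, q n ≤ z - y := fun n hn => by
    simp only [hq]; linarith [le_max_left (y - (n : ℝ)) 0]
  have q2 : ∀ n ∈ Icc 1 ⌊y⌋₊, q n = z - y := fun n hn => by
    simp only [hq]; rw [max_eq_left (by linarith [hley n hn])]; ring
  have p0 : ∀ n : ℕ, 0 ≤ ArithmeticFunction.vonMangoldt n := fun n => ArithmeticFunction.vonMangoldt_nonneg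
  have hps : ∀ t, Chebyshev.psi t = ∑ n ∈ Icc 1 ⌊t⌋₊, ArithmeticFunction.vonMangoldt n := fun t => rfl
  have c1 : ∑ n ∈ Icc 1 ⌊z⌋₊, q n ≤ (z - y) * z := by
    refine (sum_le_card_nsmul _ _ _ q1).trans ?_
    rw [Nat.card_Icc, nsmul_eq_mul, Nat.add_sub_cancel, mul_comm]
    exact mul_le_mul_of_nonneg_left (Nat.floor_le (by linarith)) (by linarith)
  have c2 : (z - y) * (y - 1) ≤ ∑ n ∈ Icc 1 ⌊z⌋₊, q n := by
    refine le_trans ?_ (sum_le_sum_of_subset_of_nonneg hsub fun n hn _ => q0 n hn)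
    rw [sum_congr rfl q2, sum_const, Nat.card_Icc, nsmul_eq_mul, Nat.add_sub_cancel, mul_comm]
    exact mul_le_mul_of_nonneg_right (by linarith [Nat.lt_floor_add_one y]) (by linarith)
  have c3 : (z - y) * Chebyshev.psi y ≤ ∑ n ∈ Icc 1 ⌊z⌋₊, ArithmeticFunction.vonMangoldt n * q n := by
    refine le_trans ?_ (sum_le_sum_of_subset_of_nonneg hsub fun n hn _ => mul_nonneg (p0 n) (q0 n hn))
    rw [hps, mul_sum]
    exact sum_le_sum fun n hn => by rw [q2 n hn, mul_comm]
  have c4 : ∑ n ∈ Icc 1 ⌊z⌋₊, ArithmeticFunction.vonMangoldt n * q n ≤ (z - y) * Chebyshev.psi z := by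
    rw [hps, mul_sum]
    exact sum_le_sum fun n hn => by rw [mul_comm]; exact mul_le_mul_of_nonneg_right (q1 n hn) (p0 n)
  rw [hD]; constructor <;> linarith

lemma psi2 {ε : ℝ} (hε : 0 < ε) (hε1 : ε ≤ 1 / 20) : ∃ C > (0 : ℝ), ∀ᶠ x : ℝ in atTop,
    |Chebyshev.psi x - x| ≤ C * (x * exp (-(Real.log x ^ (3 / 5 - 3 * ε) / 16))) := by
  obtain ⟨C, hC, h⟩ := psi1 hε hε1
  obtain ⟨X, hX⟩ := eventually_atTop.1 h
  refine ⟨8 * C + 2, by positivity, ?_⟩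
  set a := 3 / 5 - 3 * ε
  have ha : 0 < a := by simp only [a]; linarith
  have ha1 : a ≤ 1 := by simp only [a]; linarith
  filter_upwards [eventually_ge_atTop (2 * X), eventually_ge_atTop 4, tendsto_log_atTop.eventually_ge_atTop 2] with x h1 h4 hL
  have hx0 : 0 < x := by linarith
  set L := Real.log x with hLdef
  have hLa : 0 < L ^ a := rpow_pos_of_pos (by linarith) _
  set h := exp (-(L ^ a / 16)) with hh
  have h0 : 0 < h := exp_pos _
  have hLL : L ^ a ≤ L := by simpa using rpow_le_rpow_of_exponent_le (x := L) (by linarith) ha1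
  have hh1 : h ≤ 1 := by rw [hh, exp_le_one_iff]; linarith
  have hDb : ∀ y, x / 2 ≤ y → y ≤ 2 * x → |DD y| ≤ 4 * C * x ^ 2 * h ^ 2 := by
    intro y hy1 hy2
    have hy0 : 0 < y := by linarith
    have e : DD y = y * ∑ n ∈ Icc 1 ⌊y⌋₊, (ArithmeticFunction.vonMangoldt n - 1) * (1 - n / y) := by
      rw [DD, mul_sum]; exact sum_congr rfl fun n _ => by field_simp
    have e2 : exp (-(Real.log y ^ a / 4)) ≤ h ^ 2 := by
      rw [hh, ← exp_nat_mul, exp_le_exp]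
      have : L / 2 ≤ Real.log y := by
        have := Real.log_le_log (by linarith) hy1
        rw [Real.log_div (by linarith) (by norm_num)] at this
        linarith [Real.log_two_lt_d9]
      have l1 := rpow_le_rpow (by linarith) this ha.le
      have l2 : L ^ a / 2 ≤ (L / 2) ^ a := by
        rw [div_rpow (by linarith) (by norm_num)]
        refine div_le_div_of_nonneg_left hLa.le (by positivity) ?_
        simpa using rpow_le_rpow_of_exponent_le (x := (2 : ℝ)) (by norm_num) ha1
      push_cast; linarith
    rw [e, abs_mul, abs_of_pos hy0]
    calc y * _ ≤ y * (C * (y * h ^ 2)) := by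
          refine mul_le_mul_of_nonneg_left ((hX y (by linarith)).trans ?_) hy0.le
          gcongr
      _ = C * h ^ 2 * (y * y) := by ring
      _ ≤ C * h ^ 2 * ((2 * x) * (2 * x)) := by gcongr
      _ = _ := by ring
  have hhx : 1 ≤ x * h := by
    rw [hh]; nth_rewrite 1 [← exp_log hx0]; rw [← exp_add, one_le_exp_iff]; linarith
  have b0 := abs_le.1 (hDb x (by linarith) (by linarith))
  have hmul : ∀ w, x * h * w ≤ 8 * C * x ^ 2 * h ^ 2 → w ≤ 8 * C * (x * h) := fun w hw => by
    refine le_of_mul_le_mul_left (hw.trans_eq ?_) (by positivity : 0 < x * h); ring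
  rw [abs_le]; constructor
  · rcases le_or_gt h (1 / 2) with hh2 | hh2
    · have hxh : x * h ≤ x * (1 / 2) := by gcongr
      have b1 := abs_le.1 (hDb (x - x * h) (by linarith) (by linarith))
      have s := (sand (y := x - x * h) (z := x) (by linarith) (by linarith)).2
      have := hmul (x - x * h - 1 - Chebyshev.psi x) (by linarith)
      linarith
    · have := Chebyshev.psi_nonneg x
      have : x * (1 / 2) ≤ x * h := by gcongr
      have : 0 ≤ C * (x * h) := by positivity
      linarith
  · have hxh : x * h ≤ x := mul_le_of_le_one_right hx0.le hh1
    have b1 := abs_le.1 (hDb (x + x * h) (by linarith) (by linarith))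
    have s := (sand (y := x) (z := x + x * h) (by linarith) (by linarith)).1
    have := hmul (Chebyshev.psi x - (x + x * h)) (by linarith)
    linarith

lemma theta1 {ε : ℝ} (hε : 0 < ε) (hε1 : ε ≤ 1 / 20) : ∃ C > (0 : ℝ), ∀ᶠ x : ℝ in atTop,
    |Chebyshev.theta x - x| ≤ C * (x * exp (-(Real.log x ^ (3 / 5 - 3 * ε) / 16))) := by
  obtain ⟨C, hC, h⟩ := psi2 hε hε1
  refine ⟨C + 8, by positivity, ?_⟩
  filter_upwards [h, eventually_ge_atTop 1, tendsto_log_atTop.eventually_ge_atTop 1] with x h1 h2 hL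
  have h3 := Chebyshev.psi_sub_theta_le h2
  have h4 := Chebyshev.theta_le_psi x
  have hx0 : 0 < x := by linarith
  have h5 : 2 * √x * Real.log x ≤ 8 * (x * exp (-(Real.log x ^ (3 / 5 - 3 * ε) / 16))) := by
    have l1 := Real.log_le_rpow_div hx0.le (ε := 1 / 4) (by norm_num)
    have hLL : Real.log x ^ (3 / 5 - 3 * ε) ≤ Real.log x := by
      simpa using rpow_le_rpow_of_exponent_le (x := Real.log x) hL (by linarith : 3 / 5 - 3 * ε ≤ 1)
    calc 2 * √x * Real.log x ≤ 2 * √x * (x ^ (1 / 4 : ℝ) / (1 / 4)) := by gcongr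
      _ = 8 * (x ^ (1 / 2 : ℝ) * x ^ (1 / 4 : ℝ)) := by rw [Real.sqrt_eq_rpow]; ring
      _ = 8 * (x * exp (-(Real.log x / 4))) := by
        rw [← rpow_add hx0]
        nth_rewrite 2 [← exp_log hx0]
        rw [← exp_add, rpow_def_of_pos hx0]; ring_nf
      _ ≤ _ := by
        refine mul_le_mul_of_nonneg_left (mul_le_mul_of_nonneg_left (exp_le_exp.2 ?_) hx0.le) (by norm_num)
        linarith
  rw [abs_le] at *; constructor <;> linarith
end VK

namespace VK
open UnitAddTorus Finset Metric

lemma mert {ε : ℝ} (hε : 0 < ε) (hε1 : ε ≤ 1 / 20) : ∃ C > (0 : ℝ), ∀ᶠ x : ℝ in atTop, ∀ y : ℝ, √x ≤ y → y ≤ x →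
    |∑ p ∈ (Ioc ⌊y⌋₊ ⌊x⌋₊).filter Nat.Prime, (1 / (p : ℝ)) - Real.log (Real.log x / Real.log y)| ≤
      C * exp (-(Real.log x ^ (3 / 5 - 3 * ε) / 32)) := by
  obtain ⟨C, hC, h⟩ := theta1 hε hε1
  obtain ⟨X, hX⟩ := eventually_atTop.1 h
  refine ⟨6 * C, by positivity, ?_⟩
  set a := 3 / 5 - 3 * ε
  have ha : 0 < a := by simp only [a]; linarith
  have ha1 : a ≤ 1 := by simp only [a]; linarith
  filter_upwards [tendsto_sqrt_atTop.eventually_ge_atTop X, tendsto_log_atTop.eventually_ge_atTop 2, eventually_ge_atTop 1] with x h1 hL hx1 y hy hyx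
  have hx0 : 0 < x := by linarith
  have hsx : 1 ≤ √x := by rwa [Real.one_le_sqrt]
  set L := Real.log x with hLdef
  have hLa : 0 < L ^ a := rpow_pos_of_pos (by linarith) _
  set E := exp (-(L ^ a / 32)) with hE
  have hE0 : 0 < E := exp_pos _
  have hlog : ∀ t, y ≤ t → L / 2 ≤ Real.log t := fun t ht => by
    rw [hLdef, ← Real.log_sqrt hx0.le]; exact Real.log_le_log (by linarith) (by linarith)
  have hR : ∀ t, y ≤ t → |Chebyshev.theta t - t| ≤ C * E * t := fun t ht => by
    refine (hX t (by linarith)).trans ?_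
    rw [mul_assoc, mul_comm t]
    have l1 := rpow_le_rpow (by linarith) (hlog t ht) ha.le
    have l2 : L ^ a / 2 ≤ (L / 2) ^ a := by
      rw [div_rpow (by linarith) (by norm_num)]
      refine div_le_div_of_nonneg_left hLa.le (by positivity) ?_
      simpa using rpow_le_rpow_of_exponent_le (x := (2 : ℝ)) (by norm_num) ha1
    refine mul_le_mul_of_nonneg_left (mul_le_mul_of_nonneg_right (exp_le_exp.2 ?_) (by linarith)) hC.le
    linarith
  set f : ℝ → ℝ := fun t => (t * Real.log t)⁻¹ with hf
  set f' : ℝ → ℝ := fun t => -(Real.log t + 1) / (t * Real.log t) ^ 2 with hf'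
  have hpos : ∀ t, y ≤ t → 0 < t ∧ 0 < Real.log t := fun t ht => ⟨by linarith, by linarith [hlog t ht]⟩
  have hfd : ∀ t, y ≤ t → HasDerivAt f (f' t) t := fun t ht => by
    obtain ⟨p1, p2⟩ := hpos t ht
    have := ((hasDerivAt_id t).mul (Real.hasDerivAt_log p1.ne')).inv (mul_pos p1 p2).ne'
    convert! this using 1
    simp only [hf', id]; congr 2; field_simp
  have hgd : ∀ t, y ≤ t → HasDerivAt (fun t => (Real.log t)⁻¹ - Real.log (Real.log t)) (f' t * t) t := fun t ht => by
    obtain ⟨p1, p2⟩ := hpos t ht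
    have := ((Real.hasDerivAt_log p1.ne').inv p2.ne').sub ((Real.hasDerivAt_log p1.ne').log p2.ne')
    convert! this using 1
    simp only [hf']; field_simp; ring
  have hfc : ContinuousOn f' (Set.Icc y x) := by
    intro t ht
    obtain ⟨p1, p2⟩ := hpos t ht.1
    have := Real.continuousAt_log p1.ne'
    refine ContinuousAt.continuousWithinAt ?_
    simp only [hf']
    refine ContinuousAt.div (by fun_prop) (by fun_prop) (by positivity)
  have hder : Set.EqOn (deriv f) f' (Set.Icc y x) := fun t ht => (hfd t ht.1).deriv
  have hint : IntegrableOn f' (Set.Icc y x) := hfc.integrableOn_Icc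
  set c : ℕ → ℝ := fun n => if n.Prime then Real.log n else 0 with hc
  have hth : ∀ t, ∑ k ∈ Icc 0 ⌊t⌋₊, c k = Chebyshev.theta t := fun t => by
    rw [Chebyshev.theta_eq_sum_Icc, sum_filter]
  have habel := sum_mul_eq_sub_sub_integral_mul (f := f) c (a := y) (b := x) (by linarith) hyx (fun t ht => (hfd t ht.1).differentiableAt)
    (hint.congr_fun hder.symm measurableSet_Icc)
  simp only [hth] at habel
  have hs : ∑ k ∈ Ioc ⌊y⌋₊ ⌊x⌋₊, f k * c k = ∑ p ∈ (Ioc ⌊y⌋₊ ⌊x⌋₊).filter Nat.Prime, (1 / (p : ℝ)) := by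
    rw [sum_filter]
    refine sum_congr rfl fun n hn => ?_
    simp only [hc, hf]
    split_ifs with hp
    · have : 0 < Real.log n := Real.log_pos (by exact_mod_cast hp.one_lt)
      field_simp
    · simp
  have hi1 : ∫ t in Set.Ioc y x, deriv f t * Chebyshev.theta t = ∫ t in y..x, f' t * Chebyshev.theta t := by
    rw [intervalIntegral.integral_of_le hyx]
    exact setIntegral_congr_fun measurableSet_Ioc fun t ht => by simp only [hder (Set.Ioc_subset_Icc_self ht)]
  have hii1 : IntervalIntegrable f' volume y x := hfc.intervalIntegrable_of_Icc hyx
  have hid : ContinuousOn (fun t : ℝ => f' t * t) (Set.uIcc y x) := by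
    rw [Set.uIcc_of_le hyx]; exact hfc.mul continuousOn_id
  have hii3 : IntervalIntegrable (fun t => f' t * Chebyshev.theta t) volume y x :=
    (Chebyshev.theta_mono.intervalIntegrable).continuousOn_mul (by rwa [Set.uIcc_of_le hyx])
  have hi2 : ∫ t in y..x, f' t * t = (L⁻¹ - Real.log L) - ((Real.log y)⁻¹ - Real.log (Real.log y)) :=
    intervalIntegral.integral_eq_sub_of_hasDerivAt (fun t ht => hgd t (by rw [Set.uIcc_of_le hyx] at ht; exact ht.1))
      hid.intervalIntegrable
  have hi3 : ∫ t in y..x, f' t * (Chebyshev.theta t - t) = (∫ t in y..x, f' t * Chebyshev.theta t) - ∫ t in y..x, f' t * t := by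
    rw [← intervalIntegral.integral_sub hii3 hid.intervalIntegrable]
    exact intervalIntegral.integral_congr fun t _ => by ring
  have hb : ‖∫ t in y..x, f' t * (Chebyshev.theta t - t)‖ ≤ ∫ t in y..x, 4 * C * E / L * t⁻¹ := by
    refine intervalIntegral.norm_integral_le_of_norm_le hyx (Eventually.of_forall fun t ht => ?_)
      (((intervalIntegral.intervalIntegrable_inv (fun t ht => by
        rw [Set.uIcc_of_le hyx] at ht; exact (hpos t ht.1).1.ne') continuousOn_id)).const_mul _)
    obtain ⟨p1, p2⟩ := hpos t ht.1.le
    have q := hlog t ht.1.le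
    rw [norm_mul, norm_eq_abs, norm_eq_abs]
    have e1 : |f' t| ≤ 4 / (L * t ^ 2) := by
      simp only [hf']
      rw [abs_div, abs_neg, abs_of_pos (by linarith), abs_of_pos (by positivity), div_le_div_iff₀ (by positivity) (by positivity)]
      have m1 : (Real.log t + 1) * L ≤ 4 * (Real.log t * Real.log t) := by
        have : (Real.log t + 1) * L ≤ (2 * Real.log t) * (2 * Real.log t) := by
          apply mul_le_mul <;> linarith
        linarith
      calc _ = ((Real.log t + 1) * L) * t ^ 2 := by ring
        _ ≤ (4 * (Real.log t * Real.log t)) * t ^ 2 := by gcongr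
        _ = _ := by ring
    calc _ ≤ 4 / (L * t ^ 2) * (C * E * t) := mul_le_mul e1 (hR t ht.1.le) (abs_nonneg _) (by positivity)
      _ = _ := by field_simp
  have hy0 := hpos y le_rfl
  have hb2 : ∫ t in y..x, 4 * C * E / L * t⁻¹ ≤ 4 * C * E := by
    rw [intervalIntegral.integral_const_mul, integral_inv_of_pos hy0.1 hx0, Real.log_div hx0.ne' hy0.1.ne']
    calc _ ≤ 4 * C * E / L * L := by gcongr; linarith
      _ = _ := by field_simp
  rw [norm_eq_abs] at hb
  have hfb : ∀ t, y ≤ t → |f t * (Chebyshev.theta t - t)| ≤ C * E := fun t ht => by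
    obtain ⟨p1, p2⟩ := hpos t ht
    have q := hlog t ht
    rw [abs_mul]
    have : |f t| ≤ t⁻¹ := by
      simp only [hf]; rw [abs_of_pos (by positivity)]
      exact inv_anti₀ p1 (le_mul_of_one_le_right p1.le (by linarith))
    calc _ ≤ t⁻¹ * (C * E * t) := mul_le_mul this (hR t ht) (abs_nonneg _) (by positivity)
      _ = _ := by field_simp
  have f1 := hfb x hyx
  have f2 := hfb y le_rfl
  have g1 : f x * x = L⁻¹ := by simp only [hf]; rw [← hLdef]; field_simp
  have g2 : f y * y = (Real.log y)⁻¹ := by simp only [hf]; have := hy0.1; field_simp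
  rw [← hs, habel, hi1, Real.log_div (by linarith) hy0.2.ne']
  rw [mul_sub] at f1 f2
  have b3 := hb.trans hb2
  rw [hi3, hi2] at b3
  rw [abs_le] at *
  rw [g1] at f1; rw [g2] at f2
  constructor <;> linarith
end VK

namespace VK
open UnitAddTorus Finset Metric

lemma lp_spec {n : ℕ} (hn : 2 ≤ n) : (largestPrimeFactor n).Prime ∧ largestPrimeFactor n ∣ n ∧
    ∀ p, p.Prime → p ∣ n → p ≤ largestPrimeFactor n := by
  have e : largestPrimeFactor n = n.primeFactors.sup id := by rw [largestPrimeFactor, if_neg (by omega)]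
  obtain ⟨q, hq, h⟩ := exists_mem_eq_sup n.primeFactors (Nat.nonempty_primeFactors.2 (by omega)) id
  rw [e]
  refine ⟨?_, ?_, fun p hp hd => le_sup (f := id) (Nat.mem_primeFactors.2 ⟨hp, hd, by omega⟩)⟩
  · rw [h]; exact Nat.prime_of_mem_primeFactors hq
  · rw [h]; exact Nat.dvd_of_mem_primeFactors hq

lemma lp_one : largestPrimeFactor 1 = 1 := by simp [largestPrimeFactor]

lemma lp_dvd {n : ℕ} (hn : 1 ≤ n) : largestPrimeFactor n ∣ n := by
  rcases hn.eq_or_lt with rfl | h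
  · rw [lp_one]
  · exact (lp_spec h).2.1

lemma srt {l : List ℕ} (hl : l.Pairwise (· ≤ ·)) {k : ℕ} (hk : k < l.length) :
    l.countP (· < l[k]) ≤ k ∧ k + 1 ≤ l.countP (· ≤ l[k]) := by
  have hm : ∀ i j (hi : i < l.length) (hj : j < l.length), i ≤ j → l[i] ≤ l[j] := fun i j hi hj h => by
    rcases h.eq_or_lt with rfl | h
    · exact le_rfl
    · exact List.pairwise_iff_getElem.1 hl i j hi hj h
  constructor
  · have h0 : (l.drop k).countP (· < l[k]) = 0 := by
      rw [List.countP_eq_zero]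
      intro a ha
      obtain ⟨i, hi, rfl⟩ := List.mem_iff_getElem.1 ha
      rw [List.getElem_drop]
      simpa using hm k (k + i) hk (by rw [List.length_drop] at hi; omega) (by omega)
    have h1 : (l.take k ++ l.drop k).countP (· < l[k]) = l.countP (· < l[k]) := by rw [List.take_append_drop]
    rw [← h1, List.countP_append, h0]
    exact (List.countP_le_length).trans (by simp)
  · have h0 : (l.take (k + 1)).countP (· ≤ l[k]) = (l.take (k + 1)).length := by
      rw [List.countP_eq_length]
      intro a ha
      obtain ⟨i, hi, rfl⟩ := List.mem_iff_getElem.1 ha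
      rw [List.getElem_take]
      rw [List.length_take] at hi
      simpa using hm i k (by omega) hk (by omega)
    have h1 : (l.take (k + 1) ++ l.drop (k + 1)).countP (· ≤ l[k]) = l.countP (· ≤ l[k]) := by rw [List.take_append_drop]
    rw [← h1, List.countP_append, h0, List.length_take]; omega

lemma med {x : ℝ} (hx : 1 ≤ x) :
    2 * #{n ∈ Icc 1 ⌊x⌋₊ | medianLPF x < largestPrimeFactor n} ≤ ⌊x⌋₊ ∧
    ⌊x⌋₊ ≤ 2 * #{n ∈ Icc 1 ⌊x⌋₊ | medianLPF x < largestPrimeFactor n} +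
      2 * #{n ∈ Icc 1 ⌊x⌋₊ | largestPrimeFactor n = medianLPF x} + 1 ∧
    ∃ n ∈ Icc 1 ⌊x⌋₊, largestPrimeFactor n = medianLPF x := by
  set N := ⌊x⌋₊ with hN
  have hN1 : 1 ≤ N := Nat.le_floor (by simpa using hx)
  set l := ((Icc 1 N).val.map largestPrimeFactor).sort (· ≤ ·) with hl
  have hlen : l.length = N := by simp [hl]
  have hk : (N + 1) / 2 - 1 < l.length := by omega
  have hM : medianLPF x = l[(N + 1) / 2 - 1] := by
    rw [medianLPF, ← hN, ← hl, List.getD_eq_getElem _ _ hk]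
  have hs : l.Pairwise (· ≤ ·) := Multiset.pairwise_sort _ _
  have hc : ∀ p : ℕ → Prop, l.countP (fun a => decide (p a)) = #{n ∈ Icc 1 N | p (largestPrimeFactor n)} := fun p => by
    have : (l : Multiset ℕ) = (Icc 1 N).val.map largestPrimeFactor := Multiset.sort_eq _ _
    rw [← Multiset.coe_countP, this, Multiset.countP_map]; rfl
  obtain ⟨s1, s2⟩ := srt hs hk
  rw [← hM] at s1 s2
  have c1 := hc (· < medianLPF x)
  have c2 := hc (· ≤ medianLPF x)
  have t1 : #{n ∈ Icc 1 N | largestPrimeFactor n ≤ medianLPF x} + #{n ∈ Icc 1 N | medianLPF x < largestPrimeFactor n} = N := by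
    have := card_filter_add_card_filter_not (s := Icc 1 N) (fun n => largestPrimeFactor n ≤ medianLPF x)
    simpa using this
  have t2 : #{n ∈ Icc 1 N | largestPrimeFactor n ≤ medianLPF x} ≤
      #{n ∈ Icc 1 N | largestPrimeFactor n < medianLPF x} + #{n ∈ Icc 1 N | largestPrimeFactor n = medianLPF x} := by
    refine (card_le_card fun n hn => ?_).trans (card_union_le _ _)
    simp only [mem_union, mem_filter] at hn ⊢
    rcases hn.2.lt_or_eq with h | h
    · exact Or.inl ⟨hn.1, h⟩
    · exact Or.inr ⟨hn.1, h⟩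
  have c1' : l.countP (· < medianLPF x) = #{n ∈ Icc 1 N | largestPrimeFactor n < medianLPF x} := by convert c1
  have c2' : l.countP (· ≤ medianLPF x) = #{n ∈ Icc 1 N | largestPrimeFactor n ≤ medianLPF x} := by convert c2
  rw [c1'] at s1
  rw [c2'] at s2
  refine ⟨by omega, by omega, ?_⟩
  have : medianLPF x ∈ l := by rw [hM]; exact List.getElem_mem _
  rw [hl, Multiset.mem_sort, Multiset.mem_map] at this
  obtain ⟨n, hn, h⟩ := this
  exact ⟨n, hn, h⟩

lemma cnt {N m : ℕ} (hm : 1 ≤ m) (h : N < (m + 1) ^ 2) :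
    #{n ∈ Icc 1 N | m < largestPrimeFactor n} = ∑ p ∈ (Ioc m N).filter Nat.Prime, N / p := by
  have h2 : ∀ n ∈ Icc 1 N, m < largestPrimeFactor n → 2 ≤ n := fun n hn hl => by
    rcases (mem_Icc.1 hn).1.eq_or_lt with rfl | h
    · rw [lp_one] at hl; omega
    · exact h
  rw [card_eq_sum_card_fiberwise (f := largestPrimeFactor) (t := (Ioc m N).filter Nat.Prime)]
  · refine sum_congr rfl fun p hp => ?_
    obtain ⟨hp1, hp⟩ := mem_filter.1 hp
    rw [mem_Ioc] at hp1
    rw [← Nat.Ioc_filter_dvd_card_eq_div]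
    congr 1; ext n
    simp only [mem_filter, mem_Icc, mem_Ioc]
    constructor
    · rintro ⟨⟨hn, hl⟩, rfl⟩
      exact ⟨hn, lp_dvd hn.1⟩
    · rintro ⟨hn, hd⟩
      have hn2 : 2 ≤ n := hp.two_le.trans (Nat.le_of_dvd (by omega) hd)
      obtain ⟨a1, a2, a3⟩ := lp_spec hn2
      have b := a3 p hp hd
      have : largestPrimeFactor n = p := by
        by_contra hne
        have := Nat.le_of_dvd (by omega) (((Nat.coprime_primes hp a1).2 (Ne.symm hne)).mul_dvd_of_dvd_of_dvd hd a2)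
        have : (m + 1) * (m + 1) ≤ p * largestPrimeFactor n := Nat.mul_le_mul (by omega) (by omega)
        nlinarith
      exact ⟨⟨⟨hn.1, hn.2⟩, by omega⟩, this⟩
  · intro n hn
    obtain ⟨hn, hl⟩ := mem_filter.1 hn
    have := lp_spec (h2 n hn hl)
    rw [mem_coe, mem_filter, mem_Ioc]
    exact ⟨⟨hl, (Nat.le_of_dvd (by linarith [h2 n hn hl]) this.2.1).trans (mem_Icc.1 hn).2⟩, this.1⟩

lemma med_ge : ∀ᶠ x : ℝ in atTop, √x ≤ medianLPF x := by
  obtain ⟨C, hC, h⟩ := mert (ε := 1 / 20) (by norm_num) le_rfl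
  have ht : Tendsto (fun x : ℝ => C * exp (-(Real.log x ^ (3 / 5 - 3 * (1 / 20) : ℝ) / 32))) atTop (nhds (C * 0)) :=
    (tendsto_exp_neg_atTop_nhds_zero.comp (((tendsto_rpow_atTop (by norm_num)).comp tendsto_log_atTop).atTop_div_const (by norm_num))).const_mul C
  rw [mul_zero] at ht
  filter_upwards [h, ht.eventually_le_const (show (0 : ℝ) < 1 / 20 by norm_num), Chebyshev.eventually_primeCounting_le one_pos,
    tendsto_log_atTop.eventually_ge_atTop 60, eventually_ge_atTop 1] with x h1 h2 h3 hL hx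
  by_contra hlt
  push Not at hlt
  have hx0 : 0 < x := by linarith
  have hs1 : 1 ≤ √x := by rwa [Real.one_le_sqrt]
  have hMm : medianLPF x ≤ ⌊√x⌋₊ := Nat.le_floor hlt.le
  have k1 := h1 (√x) le_rfl (by rw [Real.sqrt_le_left hx0.le]; nlinarith)
  rw [Real.log_sqrt hx0.le, div_div_cancel₀ (by linarith)] at k1
  have hfl : (⌊x⌋₊ : ℝ) ≤ x := Nat.floor_le hx0.le
  have k2 := cnt (N := ⌊x⌋₊) (m := ⌊√x⌋₊) (Nat.le_floor (by simpa using hs1)) (by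
    have := Nat.lt_floor_add_one (√x)
    have : x < (⌊√x⌋₊ + 1 : ℝ) ^ 2 := by
      calc x = √x ^ 2 := (Real.sq_sqrt hx0.le).symm
        _ < _ := by gcongr
    exact_mod_cast hfl.trans_lt this)
  have k3 : #{n ∈ Icc 1 ⌊x⌋₊ | ⌊√x⌋₊ < largestPrimeFactor n} ≤ #{n ∈ Icc 1 ⌊x⌋₊ | medianLPF x < largestPrimeFactor n} :=
    card_le_card fun n hn => by
      simp only [mem_filter] at hn ⊢; exact ⟨hn.1, by omega⟩
  have k4 := (med hx).1
  have k5 : (∑ p ∈ (Ioc ⌊√x⌋₊ ⌊x⌋₊).filter Nat.Prime, (1 / (p : ℝ))) * x - Nat.primeCounting ⌊x⌋₊ ≤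
      ((∑ p ∈ (Ioc ⌊√x⌋₊ ⌊x⌋₊).filter Nat.Prime, ⌊x⌋₊ / p : ℕ) : ℝ) := by
    have : ((#((Ioc ⌊√x⌋₊ ⌊x⌋₊).filter Nat.Prime) : ℕ) : ℝ) ≤ Nat.primeCounting ⌊x⌋₊ := by
      rw [Nat.primeCounting, Nat.primeCounting', Nat.count_eq_card_filter_range]
      norm_cast
      refine card_le_card fun n hn => ?_
      simp only [mem_filter, mem_Ioc, mem_range] at hn ⊢; exact ⟨by omega, hn.2⟩
    rw [sum_mul]
    push_cast
    have e : ∑ p ∈ (Ioc ⌊√x⌋₊ ⌊x⌋₊).filter Nat.Prime, (1 / (p : ℝ) * x - 1) ≤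
        ∑ p ∈ (Ioc ⌊√x⌋₊ ⌊x⌋₊).filter Nat.Prime, ((⌊x⌋₊ / p : ℕ) : ℝ) := by
      refine sum_le_sum fun p _ => ?_
      rw [← Nat.floor_div_natCast, one_div_mul_eq_div]
      linarith [Nat.lt_floor_add_one (x / p)]
    rw [sum_sub_distrib, sum_const, nsmul_eq_mul, mul_one] at e
    linarith
  have k6 : (Nat.primeCounting ⌊x⌋₊ : ℝ) ≤ x * (1 / 20) := by
    refine h3.trans ?_
    rw [div_le_iff₀ (by linarith)]
    have : Real.log 4 ≤ 2 := by
      rw [show (4 : ℝ) = 2 ^ 2 by norm_num, Real.log_pow]; push_cast; linarith [Real.log_two_lt_d9]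
    calc _ ≤ (2 + 1) * x := by gcongr
      _ ≤ x * (1 / 20) * Real.log x := by nlinarith
  have k7 : 2 * ((∑ p ∈ (Ioc ⌊√x⌋₊ ⌊x⌋₊).filter Nat.Prime, ⌊x⌋₊ / p : ℕ) : ℝ) ≤ ⌊x⌋₊ := by
    rw [← k2]; exact_mod_cast (Nat.mul_le_mul_left 2 k3).trans k4
  have k8 := (abs_le.1 (k1.trans h2)).1
  have k9 : (1 / 2 + 9 / 100) * x ≤ (∑ p ∈ (Ioc ⌊√x⌋₊ ⌊x⌋₊).filter Nat.Prime, (1 / (p : ℝ))) * x :=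
    mul_le_mul_of_nonneg_right (by linarith [Real.log_two_gt_d9]) hx0.le
  linarith

lemma main_aux {ε : ℝ} (hε : 0 < ε) (hε1 : ε ≤ 1 / 20) : ∃ C > (0 : ℝ), ∀ᶠ x : ℝ in atTop,
      |(∑ p ∈ (Finset.range (⌊x⌋₊ + 1)).filter (fun p => p.Prime ∧ medianLPF x < p),
            Int.fract (x / p)) -
          x * (Real.log (Real.log x / Real.log (medianLPF x)) - 1 / 2)| ≤
        C * (x * exp (-(Real.log x ^ (3 / 5 - 3 * ε) / 32))) := by
  obtain ⟨C, hC, h⟩ := mert hε hε1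
  refine ⟨C + 2, by positivity, ?_⟩
  filter_upwards [h, med_ge, tendsto_log_atTop.eventually_ge_atTop 1, eventually_ge_atTop 1] with x h1 hM hL hx
  have hx0 : 0 < x := by linarith
  have hs1 : 1 ≤ √x := by rwa [Real.one_le_sqrt]
  have hfl : (⌊x⌋₊ : ℝ) ≤ x := Nat.floor_le hx0.le
  obtain ⟨m1, m2, n, hn, hnM⟩ := med hx
  set M := medianLPF x
  set N := ⌊x⌋₊ with hN
  have hM1 : 1 ≤ M := by exact_mod_cast hs1.trans hM
  have hn1 := (mem_Icc.1 hn).1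
  have hMN : M ≤ N := by
    rw [← hnM]; exact (Nat.le_of_dvd hn1 (lp_dvd hn1)).trans (mem_Icc.1 hn).2
  have k1 := h1 M hM ((Nat.cast_le.2 hMN).trans hfl)
  rw [Nat.floor_natCast] at k1
  have k2 := cnt (N := N) hM1 (by
    have : x < (M + 1 : ℝ) ^ 2 := by
      calc x = √x ^ 2 := (Real.sq_sqrt hx0.le).symm
        _ < _ := by gcongr; linarith
    exact_mod_cast hfl.trans_lt this)
  have k3 : ((#{n ∈ Icc 1 N | largestPrimeFactor n = M} : ℕ) : ℝ) ≤ √x := by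
    have : #{n ∈ Icc 1 N | largestPrimeFactor n = M} ≤ N / M := by
      rw [← Nat.Ioc_filter_dvd_card_eq_div]
      refine card_le_card fun n hn => ?_
      simp only [mem_filter, mem_Icc, mem_Ioc] at hn ⊢
      exact ⟨hn.1, hn.2 ▸ lp_dvd hn.1.1⟩
    calc _ ≤ ((N / M : ℕ) : ℝ) := by exact_mod_cast this
      _ ≤ N / M := Nat.cast_div_le
      _ ≤ x / √x := by gcongr
      _ = √x := Real.div_sqrt
  have hset : (Finset.range (N + 1)).filter (fun p => p.Prime ∧ M < p) = (Ioc M N).filter Nat.Prime := by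
    ext p; simp only [mem_filter, mem_range, mem_Ioc]
    constructor
    · rintro ⟨a, b, c⟩; exact ⟨⟨c, by omega⟩, b⟩
    · rintro ⟨⟨a, b⟩, c⟩; exact ⟨by omega, c, a⟩
  have hS : ∑ p ∈ (Finset.range (N + 1)).filter (fun p => p.Prime ∧ M < p), Int.fract (x / p) =
      x * (∑ p ∈ (Ioc M N).filter Nat.Prime, (1 / (p : ℝ))) - ((∑ p ∈ (Ioc M N).filter Nat.Prime, N / p : ℕ) : ℝ) := by
    rw [hset, mul_sum]; push_cast
    rw [← sum_sub_distrib]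
    refine sum_congr rfl fun p _ => ?_
    rw [hN, ← Nat.floor_div_natCast, natCast_floor_eq_intCast_floor (by positivity), mul_one_div, Int.fract]
  rw [hS, ← k2]
  set K := #{n ∈ Icc 1 N | M < largestPrimeFactor n}
  set E := exp (-(Real.log x ^ (3 / 5 - 3 * ε) / 32)) with hE
  have q1 : (2 * K : ℝ) ≤ N := by exact_mod_cast m1
  have q2 : (N : ℝ) ≤ 2 * K + 2 * (#{n ∈ Icc 1 N | largestPrimeFactor n = M} : ℕ) + 1 := by exact_mod_cast m2
  have q3 : x < N + 1 := Nat.lt_floor_add_one x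
  have q4 : √x ≤ x * E := by
    have hLL : Real.log x ^ (3 / 5 - 3 * ε) ≤ Real.log x := by
      simpa using rpow_le_rpow_of_exponent_le (x := Real.log x) hL (by linarith : 3 / 5 - 3 * ε ≤ 1)
    calc √x = x * exp (-(Real.log x / 2)) := by
          nth_rewrite 2 [← exp_log hx0]
          rw [← exp_add, Real.sqrt_eq_rpow, rpow_def_of_pos hx0]; ring_nf
      _ ≤ _ := mul_le_mul_of_nonneg_left (exp_le_exp.2 (by linarith)) hx0.le
  set S1 := ∑ p ∈ (Ioc M N).filter Nat.Prime, (1 / (p : ℝ))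
  set G := Real.log (Real.log x / Real.log M)
  have q5 : |x * (S1 - G)| ≤ x * (C * E) := by
    rw [abs_mul, abs_of_pos hx0]; exact mul_le_mul_of_nonneg_left k1 hx0.le
  rw [abs_le] at q5 ⊢
  constructor <;> linarith
end VK

theorem sum_fract_median_functional_equation :
    ∀ ε > (0:ℝ), ∃ c > (0:ℝ), ∃ C > (0:ℝ), ∀ᶠ x : ℝ in atTop,
      |(∑ p ∈ (Finset.range (⌊x⌋₊ + 1)).filter (fun p => p.Prime ∧ medianLPF x < p),
            Int.fract (x / p)) -
          x * (Real.log (Real.log x / Real.log (medianLPF x)) - 1 / 2)| ≤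
        C * x * Real.exp (-c * (Real.log x) ^ ((3:ℝ)/5 - ε)) := by
  intro ε hε
  obtain ⟨C, hC, h⟩ := VK.main_aux (ε := min (ε / 3) (1 / 20)) (by positivity) (min_le_right _ _)
  refine ⟨1 / 32, by norm_num, C, hC, ?_⟩
  filter_upwards [h, tendsto_log_atTop.eventually_ge_atTop 1, eventually_ge_atTop 1] with x h1 hL hx
  refine h1.trans ?_
  rw [mul_assoc]
  refine mul_le_mul_of_nonneg_left (mul_le_mul_of_nonneg_left (exp_le_exp.2 ?_) (by linarith)) hC.le
  have : Real.log x ^ ((3 : ℝ) / 5 - ε) ≤ Real.log x ^ (3 / 5 - 3 * min (ε / 3) (1 / 20)) :=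
    rpow_le_rpow_of_exponent_le hL (by linarith [min_le_left (ε / 3) (1 / 20)])
  linarith
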